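/- Assume p = 2r+1 < p_B(N). There exists a constant C = C(N,p,B) > 0 such that every positive classical solution U = (u_1,…,u_m) of (S) on B_1 × (−1,1) satisfies ∫_{−1/2}^{1/2} ∫_{B_{1/2}} Σ_{i=1}^m ( Σ_{j=1}^m β_{ij} u_i^r u_j^{r+1} )^2 dx dt ≤ C. -/

import Mathlib

open Real Set Metric MeasureTheory

/-- The Laplacian in the space variable, as the sum of second derivatives in
the coordinate directions. -/
noncomputable def lap {N : ℕ} (f : EuclideanSpace ℝ (Fin N) → ℝ)
    (x : EuclideanSpace ℝ (Fin N)) : ℝ :=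
  ∑ i, iteratedFDeriv ℝ 2 f x ![EuclideanSpace.single i 1, EuclideanSpace.single i 1]

open scoped ContDiff

section DirectionalDerivative

variable {V : Type*} [NormedAddCommGroup V] [NormedSpace ℝ V]

/-- The derivative of `f` in the direction `v`, as a function. -/
noncomputable def dd (v : V) (f : V → ℝ) : V → ℝ := fun x => fderiv ℝ f x v

lemma dd_mul {f g : V → ℝ} {x : V} (hf : DifferentiableAt ℝ f x) (hg : DifferentiableAt ℝ g x)
    (v : V) : dd v (fun y => f y * g y) x = dd v f x * g x + f x * dd v g x := by
  simp only [dd, fderiv_fun_mul hf hg]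
  simp
  ring

lemma dd_add {f g : V → ℝ} {x : V} (hf : DifferentiableAt ℝ f x) (hg : DifferentiableAt ℝ g x)
    (v : V) : dd v (fun y => f y + g y) x = dd v f x + dd v g x := by
  simp [dd, fderiv_fun_add hf hg]

lemma dd_comp {f : V → ℝ} {h : ℝ → ℝ} {h' : ℝ} {x : V} (hf : DifferentiableAt ℝ f x)
    (hh : HasDerivAt h h' (f x)) (v : V) : dd v (fun y => h (f y)) x = h' * dd v f x := by
  have := (hh.comp_hasFDerivAt x hf.hasFDerivAt).fderiv
  simp only [Function.comp_def] at this
  simp [dd, this]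

lemma dd_const_mul {f : V → ℝ} {x : V} (c : ℝ) (hf : DifferentiableAt ℝ f x) (v : V) :
    dd v (fun y => c * f y) x = c * dd v f x :=
  dd_comp hf (by simpa using (hasDerivAt_id (f x)).const_mul c) v

@[simp] lemma dd_const (c : ℝ) (v : V) : dd v (fun _ : V => c) = fun _ => 0 := by
  ext x; simp [dd]

lemma dd_congr {f g : V → ℝ} {x : V} (h : f =ᶠ[nhds x] g) (v : V) : dd v f x = dd v g x := by
  simp [dd, h.fderiv_eq]

lemma ContDiff.dd {f : V → ℝ} {m n : ℕ∞ω} (hf : ContDiff ℝ n f) (hmn : m + 1 ≤ n) (v : V) :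
    ContDiff ℝ m (dd v f) :=
  (hf.fderiv_right hmn).clm_apply contDiff_const

lemma ContDiff.dd_smooth {f : V → ℝ} (hf : ContDiff ℝ ∞ f) (v : V) : ContDiff ℝ ∞ (_root_.dd v f) :=
  hf.dd (by simp) v

lemma ContDiffAt.dd {f : V → ℝ} {x : V} {m n : ℕ∞ω} (hf : ContDiffAt ℝ n f x) (hmn : m + 1 ≤ n)
    (v : V) : ContDiffAt ℝ m (dd v f) x :=
  (hf.fderiv_right hmn).clm_apply contDiffAt_const

lemma dd_comm {f : V → ℝ} {x : V} (hf : ContDiffAt ℝ 2 f x) (v w : V) :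
    dd v (dd w f) x = dd w (dd v f) x := by
  have hd : DifferentiableAt ℝ (fderiv ℝ f) x :=
    (hf.fderiv_right (m := 1) (by norm_num)).differentiableAt (by norm_num)
  have h1 : ∀ a b : V, dd a (dd b f) x = fderiv ℝ (fderiv ℝ f) x a b := by
    intro a b
    change fderiv ℝ (fun y => fderiv ℝ f y b) x a = _
    rw [fderiv_clm_apply hd (differentiableAt_const b)]
    simp
  rw [h1, h1]
  exact (hf.isSymmSndFDerivAt (by simp)).eq v w

lemma dd_support {f : V → ℝ} (v : V) {x : V} (hx : x ∉ tsupport f) : dd v f x = 0 := by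
  have : f =ᶠ[nhds x] fun _ => 0 := notMem_tsupport_iff_eventuallyEq.1 hx
  rw [dd_congr this v]; simp

lemma tsupport_dd {f : V → ℝ} (v : V) : tsupport (dd v f) ⊆ tsupport f := by
  apply closure_minimal _ (isClosed_tsupport f)
  intro x hx
  by_contra h
  exact hx (dd_support v h)

lemma HasCompactSupport.dd {f : V → ℝ} (hf : HasCompactSupport f) (v : V) :
    HasCompactSupport (dd v f) :=
  hf.of_isClosed_subset (isClosed_tsupport _) (tsupport_dd v)

variable [MeasurableSpace V] [BorelSpace V] [FiniteDimensional ℝ V] {μ : Measure V}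
  [μ.IsAddHaarMeasure]

lemma integral_dd_eq_zero {f : V → ℝ} (hf : ContDiff ℝ 1 f) (hs : HasCompactSupport f) (v : V) :
    ∫ x, dd v f x ∂μ = 0 := by
  have h1 : Integrable (dd v f) μ :=
    (hf.dd (m := 0) (by simp) v).continuous.integrable_of_hasCompactSupport (hs.dd v)
  have := integral_mul_fderiv_eq_neg_fderiv_mul_of_integrable (μ := μ) (f := fun _ => (1:ℝ))
    (g := f) (v := v) (by simp) (by simpa only [one_mul] using! h1)
    (by simpa using hf.continuous.integrable_of_hasCompactSupport hs) 
    (fun x _ => differentiableAt_const _) (fun x _ => hf.differentiable (by simp) x)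
  simpa [dd] using this

end DirectionalDerivative

/-- Coordinate vectors. -/
noncomputable abbrev ev {N : ℕ} (i : Fin N) : EuclideanSpace ℝ (Fin N) := EuclideanSpace.single i 1

section Laplacian
variable {N : ℕ}
local notation "𝔼" => EuclideanSpace ℝ (Fin N)

lemma lap_eq_sum_dd {f : 𝔼 → ℝ} {x : 𝔼} (hf : ContDiffAt ℝ 2 f x) :
    lap f x = ∑ i, dd (ev i) (dd (ev i) f) x := by
  have hd : DifferentiableAt ℝ (fderiv ℝ f) x :=
    (hf.fderiv_right (m := 1) (by norm_num)).differentiableAt (by norm_num)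
  refine Finset.sum_congr rfl fun i _ => ?_
  rw [iteratedFDeriv_two_apply]
  change _ = fderiv ℝ (fun y => fderiv ℝ f y (ev i)) x (ev i)
  rw [fderiv_clm_apply hd (differentiableAt_const _)]
  simp

/-- Squared length of the gradient. -/
noncomputable def gradSq (f : 𝔼 → ℝ) (x : 𝔼) : ℝ := ∑ i, dd (ev i) f x ^ 2

lemma lap_comp {f : 𝔼 → ℝ} {x : 𝔼} (hf : ContDiffAt ℝ 2 f x) {h h' : ℝ → ℝ} {h'' : ℝ}
    (hh : ContDiffAt ℝ 2 h (f x)) (h1 : ∀ᶠ s in nhds (f x), HasDerivAt h (h' s) s)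
    (h2 : HasDerivAt h' h'' (f x)) :
    lap (fun y => h (f y)) x = h' (f x) * lap f x + h'' * gradSq f x := by
  rw [lap_eq_sum_dd hf, lap_eq_sum_dd (f := fun y => h (f y)) (ContDiffAt.comp (g := h) x hh hf), gradSq, Finset.mul_sum, Finset.mul_sum,
    ← Finset.sum_add_distrib]
  refine Finset.sum_congr rfl fun i _ => ?_
  have hdiff : ∀ᶠ y in nhds x, DifferentiableAt ℝ f y :=
    (hf.eventually (by simp)).mono fun y hy => hy.differentiableAt (by norm_num)
  have e : dd (ev i) (fun y => h (f y)) =ᶠ[nhds x] fun y => h' (f y) * dd (ev i) f y := by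
    filter_upwards [hdiff, hf.continuousAt.eventually h1] with y hy hy1
    exact dd_comp hy hy1 _
  have hd1 : DifferentiableAt ℝ f x := hf.differentiableAt (by norm_num)
  rw [dd_congr e, dd_mul (f := fun y => h' (f y)) (h2.differentiableAt.comp x hd1)
    ((hf.dd (m := 1) (by norm_num) _).differentiableAt (by norm_num)), dd_comp hd1 h2]
  ring

lemma lap_add {f g : 𝔼 → ℝ} {x : 𝔼} (hf : ContDiffAt ℝ 2 f x) (hg : ContDiffAt ℝ 2 g x) :
    lap (fun y => f y + g y) x = lap f x + lap g x := by
  unfold lap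
  rw [← Finset.sum_add_distrib]
  refine Finset.sum_congr rfl fun i _ => ?_
  have := iteratedFDeriv_add_apply (i := 2) hf hg
  erw [this]; rfl

lemma lap_const_mul {f : 𝔼 → ℝ} {x : 𝔼} (hf : ContDiffAt ℝ 2 f x) (c : ℝ) :
    lap (fun y => c * f y) x = c * lap f x := by
  unfold lap
  rw [Finset.mul_sum]
  refine Finset.sum_congr rfl fun i _ => ?_
  have := iteratedFDeriv_const_smul_apply (i := 2) (a := c) hf
  erw [this]; rfl

lemma lap_const (c : ℝ) (x : 𝔼) : lap (fun _ => c) x = 0 := by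
  rw [lap_eq_sum_dd contDiffAt_const]; simp

lemma lap_sum {ι : Type*} (s : Finset ι) {f : ι → 𝔼 → ℝ} {x : 𝔼}
    (hf : ∀ i ∈ s, ContDiffAt ℝ 2 (f i) x) :
    lap (fun y => ∑ i ∈ s, f i y) x = ∑ i ∈ s, lap (f i) x := by
  classical
  induction s using Finset.induction_on with
  | empty => simp [lap_const]
  | insert a s ha ih =>
    simp only [Finset.sum_insert ha]
    rw [lap_add (hf a (by simp)) (ContDiffAt.sum fun i hi => hf i (by simp [hi])),
      ih fun i hi => hf i (by simp [hi])]

lemma lap_neg {f : 𝔼 → ℝ} {x : 𝔼} (hf : ContDiffAt ℝ 2 f x) :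
    lap (fun y => - f y) x = - lap f x := by
  simpa using lap_const_mul hf (-1)

lemma dd_affine {f : 𝔼 → ℝ} (x₀ : 𝔼) (c : ℝ) {x : 𝔼} (hf : DifferentiableAt ℝ f (x₀ + c • x))
    (v : 𝔼) : dd v (fun y => f (x₀ + c • y)) x = c * dd v f (x₀ + c • x) := by
  have h2 : HasFDerivAt (fun y : 𝔼 => x₀ + c • y) (c • ContinuousLinearMap.id ℝ 𝔼) x :=
    ((hasFDerivAt_id x).const_smul c).const_add x₀
  have := (hf.hasFDerivAt.comp x h2).fderiv
  simp only [Function.comp_def] at this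
  simp [dd, this]

lemma lap_affine {f : 𝔼 → ℝ} (x₀ : 𝔼) (c : ℝ) {x : 𝔼} (hf : ContDiffAt ℝ 2 f (x₀ + c • x)) :
    lap (fun y => f (x₀ + c • y)) x = c ^ 2 * lap f (x₀ + c • x) := by
  have ha : ContDiffAt ℝ 2 (fun y : 𝔼 => x₀ + c • y) x := by fun_prop
  rw [lap_eq_sum_dd hf, lap_eq_sum_dd (f := fun y => f (x₀ + c • y)) (ContDiffAt.comp x hf ha), Finset.mul_sum]
  refine Finset.sum_congr rfl fun i _ => ?_
  have e : dd (ev i) (fun y => f (x₀ + c • y)) =ᶠ[nhds x]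
      fun y => c * dd (ev i) f (x₀ + c • y) := by
    filter_upwards [ha.continuousAt.eventually (hf.eventually (by simp))] with y hy
    exact dd_affine x₀ c (hy.differentiableAt (by norm_num)) _
  have hf2 := (hf.dd (m := 1) (by norm_num) (ev i)).differentiableAt (by norm_num)
  have h3 : DifferentiableAt ℝ (fun y => dd (ev i) f (x₀ + c • y)) x :=
    DifferentiableAt.comp (g := dd (ev i) f) x hf2 (ha.differentiableAt (by norm_num))
  rw [dd_congr e, dd_const_mul c h3, dd_affine x₀ c hf2]
  ring

lemma continuousOn_lap {f : 𝔼 → ℝ} {s : Set 𝔼} (hs : IsOpen s) (hf : ContDiffOn ℝ 2 f s) :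
    ContinuousOn (lap f) s := by
  intro x hx
  have hfx : ContDiffAt ℝ 2 f x := hf.contDiffAt (hs.mem_nhds hx)
  have : ContinuousAt (fun y => ∑ i, dd (ev i) (dd (ev i) f) y) x := by
    apply tendsto_finsetSum
    intro i _
    exact ((hfx.dd (m := 1) (by norm_num) (ev i)).dd (m := 0) (by simp) (ev i)).continuousAt
  refine (this.congr ?_).continuousWithinAt
  filter_upwards [hfx.eventually (by simp)] with y hy
  exact (lap_eq_sum_dd hy).symm

/-- **Green's identity** against a compactly supported `C²` test function. -/
lemma integral_mul_lap {f η : 𝔼 → ℝ} {s : Set 𝔼} (hs : IsOpen s) (hf : ContDiffOn ℝ 2 f s)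
    (hη : ContDiff ℝ 2 η) (hc : HasCompactSupport η) (hsub : tsupport η ⊆ s) :
    ∫ x, f x * lap η x = ∫ x, lap f x * η x := by
  have hfx : ∀ x ∈ s, ContDiffAt ℝ 2 f x := fun x hx => hf.contDiffAt (hs.mem_nhds hx)
  have hint : ∀ a b : 𝔼 → ℝ, ContinuousOn a s → Continuous b → tsupport b ⊆ tsupport η →
      Integrable fun x => a x * b x := by
    intro a b ha hb hab
    have hcb : HasCompactSupport b := hc.of_isClosed_subset (isClosed_tsupport _) hab
    have : Continuous fun x => a x * b x := by
      rw [continuous_iff_continuousAt]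
      intro x
      by_cases hx : x ∈ tsupport b
      · exact (ha.continuousAt (hs.mem_nhds (hsub (hab hx)))).mul hb.continuousAt
      · have : (fun x => a x * b x) =ᶠ[nhds x] fun _ => 0 := by
          filter_upwards [notMem_tsupport_iff_eventuallyEq.1 hx] with y hy
          simp [hy]
        exact continuousAt_const.congr this.symm
    exact this.integrable_of_hasCompactSupport hcb.mul_left
  have c0 : ContinuousOn f s := hf.continuousOn
  have c1 : ∀ i : Fin N, ContinuousOn (dd (ev i) f) s := fun i x hx =>
    ((hfx x hx).dd (m := 1) (by norm_num) (ev i)).continuousAt.continuousWithinAt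
  have c2 : ∀ i : Fin N, ContinuousOn (dd (ev i) (dd (ev i) f)) s := fun i x hx =>
    (((hfx x hx).dd (m := 1) (by norm_num) (ev i)).dd (m := 0) (by simp)
      (ev i)).continuousAt.continuousWithinAt
  have d1 : ∀ i : Fin N, ContDiff ℝ 1 (dd (ev i) η) := fun i => hη.dd (by norm_num) _
  have d2 : ∀ i : Fin N, ContDiff ℝ 0 (dd (ev i) (dd (ev i) η)) := fun i => (d1 i).dd (by simp) _
  have t1 : ∀ i : Fin N, tsupport (dd (ev i) η) ⊆ tsupport η := fun i => tsupport_dd _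
  have t2 : ∀ i : Fin N, tsupport (dd (ev i) (dd (ev i) η)) ⊆ tsupport η := fun i =>
    (tsupport_dd _).trans (t1 i)
  have key : ∀ i : Fin N, ∫ x, f x * dd (ev i) (dd (ev i) η) x =
      ∫ x, dd (ev i) (dd (ev i) f) x * η x := by
    intro i
    have a1 := integral_mul_fderiv_eq_neg_fderiv_mul_of_integrable (μ := volume) (f := f)
      (g := dd (ev i) η) (v := ev i) (hint _ _ (c1 i) (d1 i).continuous (t1 i))
      (hint _ _ c0 (d2 i).continuous (t2 i)) (hint _ _ c0 (d1 i).continuous (t1 i))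
      (fun x hx => (hfx x (hsub (t1 i hx))).differentiableAt (by norm_num))
      (fun x _ => (d1 i).differentiable (by norm_num) x)
    have a2 := integral_mul_fderiv_eq_neg_fderiv_mul_of_integrable (μ := volume) (f := dd (ev i) f)
      (g := η) (v := ev i) (hint _ _ (c2 i) hη.continuous subset_rfl)
      (hint _ _ (c1 i) (d1 i).continuous (t1 i)) (hint _ _ (c1 i) hη.continuous subset_rfl)
      (fun x hx => ((hfx x (hsub hx)).dd (m := 1) (by norm_num) (ev i)).differentiableAt
        (by norm_num))
      (fun x _ => hη.differentiable (by norm_num) x)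
    calc _ = -∫ x, dd (ev i) f x * dd (ev i) η x := a1
      _ = - -∫ x, dd (ev i) (dd (ev i) f) x * η x := congrArg Neg.neg a2
      _ = _ := neg_neg _
  have e1 : ∀ x, f x * lap η x = ∑ i, f x * dd (ev i) (dd (ev i) η) x := fun x => by
    rw [lap_eq_sum_dd hη.contDiffAt, Finset.mul_sum]
  have e2 : ∀ x, lap f x * η x = ∑ i, dd (ev i) (dd (ev i) f) x * η x := fun x => by
    by_cases hx : x ∈ tsupport η
    · rw [lap_eq_sum_dd (hfx x (hsub hx)), Finset.sum_mul]
    · simp [image_eq_zero_of_notMem_tsupport hx]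
  simp_rw [e1, e2]
  rw [integral_finsetSum _ fun i _ => hint _ _ c0 (d2 i).continuous (t2 i),
    integral_finsetSum _ fun i _ => hint _ _ (c2 i) hη.continuous subset_rfl]
  exact Finset.sum_congr rfl fun i _ => key i

end Laplacian

/-- The linear-arithmetic core of the integral estimate: all quantities are weighted sums
of squares (`X T S E G I L D`), cross terms, or exact divergences (`Z`). -/
lemma energy_absorption {κ ϑ μ θ σ p : ℝ} (hκ : 0 < κ) (hϑ : 0 < ϑ) (hμ : 0 ≤ μ) (hθ : 0 ≤ θ)
    (hσ : 0 ≤ σ) (hp : 0 < p) (hϑd : ϑ = μ - θ * p) (K : ℝ → ℝ) :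
    ∃ C l1 l2 l4 l5 l6 : ℝ, 0 ≤ C ∧
      ∀ X T S E G I L D Z1 Z2 Z4 Z5 Z6 c1 c2 ud Fd ed gd eu eF gL gt Φt : ℝ,
      0 ≤ X → 0 ≤ T → 0 ≤ S → 0 ≤ E → 0 ≤ G → 0 ≤ I → 
      κ * X ≤ Z1 - 2 * σ * Z2 + θ * D + μ * (c1 - L - c2) + (ud - Fd - ed) + gL / 2 + σ * gd →
      D ≤ Z6 - Z4 + p * L + Fd - ud + gt / 2 - (eu - eF - E) →
      T = Z6 + Z5 - Φt + eu - ud + gt / 2 →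
      S ≤ Z5 - Φt - Z4 + p * L + Fd - eF →
      (∀ δ > 0, |c1| ≤ δ * X + δ⁻¹ * T) → (∀ δ > 0, |c2| ≤ δ * X + δ⁻¹ * E) →
      (∀ δ > 0, |ud| ≤ δ * T + δ⁻¹ * G) → (∀ δ > 0, |Fd| ≤ δ * S + δ⁻¹ * G) →
      (∀ δ > 0, |ed| ≤ δ * E + δ⁻¹ * G) → (∀ δ > 0, |gd| ≤ δ * X + δ⁻¹ * G) →
      (∀ δ > 0, |eu| ≤ δ * T + δ⁻¹ * E) → (∀ δ > 0, |eF| ≤ δ * S + δ⁻¹ * E) →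
      |gL| ≤ G → |gt| ≤ G →
      (∀ δ > 0, G ≤ δ * X + δ * S + K δ * I) → (∀ δ > 0, |Φt| ≤ δ * S + K δ * I) →
      S ≤ l1 * Z1 + l2 * Z2 + l4 * Z4 + l5 * Z5 + l6 * Z6 + C * (E + I) := by
  have ha : ∀ δ > 0, ∃ Q ≥ 0, ∀ X T S E G L D Z1 Z2 Z4 Z6 c1 c2 ud Fd ed gd eu eF gL gt : ℝ,
      0 ≤ X → 0 ≤ T → 0 ≤ S → 0 ≤ E → 0 ≤ G → 
      κ * X ≤ Z1 - 2 * σ * Z2 + θ * D + μ * (c1 - L - c2) + (ud - Fd - ed) + gL / 2 + σ * gd →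
      D ≤ Z6 - Z4 + p * L + Fd - ud + gt / 2 - (eu - eF - E) →
      (∀ δ > 0, |c1| ≤ δ * X + δ⁻¹ * T) → (∀ δ > 0, |c2| ≤ δ * X + δ⁻¹ * E) →
      (∀ δ > 0, |ud| ≤ δ * T + δ⁻¹ * G) → (∀ δ > 0, |Fd| ≤ δ * S + δ⁻¹ * G) →
      (∀ δ > 0, |ed| ≤ δ * E + δ⁻¹ * G) → (∀ δ > 0, |gd| ≤ δ * X + δ⁻¹ * G) →
      (∀ δ > 0, |eu| ≤ δ * T + δ⁻¹ * E) → (∀ δ > 0, |eF| ≤ δ * S + δ⁻¹ * E) →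
      |gL| ≤ G → |gt| ≤ G →
      κ / 2 * X + ϑ * L ≤ Z1 - 2 * σ * Z2 + θ * Z6 - θ * Z4 + Q * T + δ * S + Q * (E + G) := by
    intro δ hδ
    set a := κ / (8 * (μ + σ + 1)) with hadef
    have hapos : 0 < a := by positivity
    set b := δ / (4 * (1 + θ)) with hbdef
    have hbpos : 0 < b := by positivity
    have ea : a * (μ + σ + 1) = κ / 8 := by rw [hadef]; field_simp
    have eb : b * (1 + θ) = δ / 4 := by rw [hbdef]; field_simp
    refine ⟨μ * a⁻¹ + σ * a⁻¹ + (1 + θ) * (b⁻¹ + 1 + 1) + 10 * (1 + θ) , by positivity, ?_⟩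
    intro X T S E G L D Z1 Z2 Z4 Z6 c1 c2 ud Fd ed gd eu eF gL gt hX hT hS hE hG h1 h2 
      b1 b2 b3 b4 b5 b6 b7 b8 b9 b10
    have k1 := (abs_le.1 (b1 a hapos)).2
    have k2 := (abs_le.1 (b2 a hapos)).1
    have k3 := (abs_le.1 (b3 1 one_pos))
    have k4 := (abs_le.1 (b4 b hbpos))
    have k5 := (abs_le.1 (b5 1 one_pos)).1
    have k6 := (abs_le.1 (b6 a hapos)).2
    have k7 := (abs_le.1 (b7 1 one_pos)).1
    have k8 := (abs_le.1 (b8 b hbpos)).2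
    have k9 := (abs_le.1 b9).2
    have k10 := (abs_le.1 b10).2
    have m1 := mul_le_mul_of_nonneg_left k1 hμ
    have m2 := mul_le_mul_of_nonneg_left k2 hμ
    have m6 := mul_le_mul_of_nonneg_left k6 hσ
    have mD := mul_le_mul_of_nonneg_left h2 hθ
    have n4 := mul_le_mul_of_nonneg_left k4.2 hθ
    have n3 := mul_le_mul_of_nonneg_left k3.1 hθ
    have n7 := mul_le_mul_of_nonneg_left k7 hθ
    have n8 := mul_le_mul_of_nonneg_left k8 hθ
    have n10 := mul_le_mul_of_nonneg_left k10 hθ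
    have pX : a * (μ + σ + 1) * X = κ / 8 * X := by rw [ea]
    have pS : b * (1 + θ) * S = δ / 4 * S := by rw [eb]
    have q1 : 0 ≤ a * X := by positivity
    have q2 : 0 ≤ μ * (a * X) := by positivity
    have q2' : 0 ≤ σ * (a * X) := by positivity
    have q3 : 0 ≤ δ * S := by positivity
    have q4 : 0 ≤ b * S := by positivity
    have q5 : 0 ≤ μ * a⁻¹ * E := by positivity
    have q6 : 0 ≤ μ * a⁻¹ * T := by positivity
    have q7 : 0 ≤ μ * a⁻¹ * G := by positivity
    have q8 : 0 ≤ σ * a⁻¹ * T := by positivity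
    have q9 : 0 ≤ σ * a⁻¹ * E := by positivity
    have q10 : 0 ≤ b⁻¹ * T := by positivity
    have q11 : 0 ≤ b⁻¹ * E := by positivity
    have q12 : 0 ≤ b⁻¹ * G := by positivity
    have q13 : 0 ≤ θ * (b⁻¹ * T) := by positivity
    have q14 : 0 ≤ θ * (b⁻¹ * E) := by positivity
    have q15 : 0 ≤ θ * (b⁻¹ * G) := by positivity
    have q16 : 0 ≤ θ * T := by positivity
    have q17 : 0 ≤ θ * E := by positivity
    have q18 : 0 ≤ θ * G := by positivity
    have q19 : 0 ≤ κ * X := by positivity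
    have q20 : 0 ≤ σ * a⁻¹ * G := by positivity
    rw [hϑd]
    simp only [inv_one, one_mul] at k3 k5 k7 n3 n7
    linarith
  obtain ⟨Q, hQ, haQ⟩ := ha (ϑ / (8 * p)) (by positivity)
  set P := p / ϑ with hP
  have hPpos : 0 < P := by positivity
  have hPϑ : P * ϑ = p := by rw [hP]; field_simp
  set Bc := 2 * P * Q with hB
  have hBpos : 0 ≤ Bc := by positivity
  -- total coefficient of E + G
  set R := P * Q + Bc * 20 + 20 with hR
  have hRpos : 0 < R := by positivity
  set d1 := 1 / (16 * (Bc + 1)) with hd1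
  have hd1p : 0 < d1 := by positivity
  set d2 := min (1 / (16 * R)) (P * κ / (2 * R)) with hd2
  have hd2p : 0 < d2 := by positivity
  refine ⟨8 * (R + R * |K d2| + (Bc + 1) * |K d1|), 8 * P, - 8 * P * (2 * σ), 8 * (- P * θ - 1), 8 * (1 + Bc), 8 * (P * θ + Bc),
    by positivity, ?_⟩
  intro X T S E G I L D Z1 Z2 Z4 Z5 Z6 c1 c2 ud Fd ed gd eu eF gL gt Φt hX hT hS hE hG hI h1 h2 
      hTe hSe b1 b2 b3 b4 b5 b6 b7 b8 b9 b10 hGb hΦ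
  have A := haQ X T S E G L D Z1 Z2 Z4 Z6 c1 c2 ud Fd ed gd eu eF gL gt hX hT hS hE hG h1 h2 
      b1 b2 b3 b4 b5 b6 b7 b8 b9 b10
  have A' := mul_le_mul_of_nonneg_left A hPpos.le
  have e1 : P * (ϑ / (8 * p)) = 1 / 8 := by rw [hP]; field_simp
  have Tb : T / 2 ≤ Z5 + Z6 + |Φt| + 20 * (E + G) := by
    have k3 := (abs_le.1 (b3 (1/4) (by norm_num))).1
    have k7 := (abs_le.1 (b7 (1/4) (by norm_num))).2
    have k10 := (abs_le.1 b10).2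
    have := neg_abs_le Φt
    norm_num at k3 k7
    linarith
  have Sb : S / 2 ≤ Z5 - Z4 + |Φt| + p * L + 20 * (E + G) := by
    have k4 := (abs_le.1 (b4 (1/4) (by norm_num))).2
    have k8 := (abs_le.1 (b8 (1/4) (by norm_num))).1
    have := neg_abs_le Φt
    norm_num at k4 k8
    linarith
  have Tb' := mul_le_mul_of_nonneg_left Tb hBpos
  have f1 : R * G ≤ P * κ / 2 * X + S / 16 + R * |K d2| * I := by
    have := mul_le_mul_of_nonneg_left (hGb d2 hd2p) hRpos.le
    have r1 : R * d2 ≤ 1 / 16 := by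
      calc R * d2 ≤ R * (1 / (16 * R)) := by gcongr; exact min_le_left _ _
        _ = _ := by field_simp
    have r2 : R * d2 ≤ P * κ / 2 := by
      calc R * d2 ≤ R * (P * κ / (2 * R)) := by gcongr; exact min_le_right _ _
        _ = _ := by field_simp
    have r3 := mul_le_mul_of_nonneg_right r1 hS
    have r4 := mul_le_mul_of_nonneg_right r2 hX
    have r5 : R * (K d2 * I) ≤ R * (|K d2| * I) := by gcongr; exact le_abs_self _
    linarith
  have f2 : (Bc + 1) * |Φt| ≤ S / 16 + (Bc + 1) * |K d1| * I := by
    have := mul_le_mul_of_nonneg_left (hΦ d1 hd1p) (by positivity : 0 ≤ Bc + 1)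
    have r1 : (Bc + 1) * d1 = 1 / 16 := by rw [hd1]; field_simp
    have r3 : (Bc + 1) * d1 * S = 1 / 16 * S := by rw [r1]
    have r5 : (Bc + 1) * (K d1 * I) ≤ (Bc + 1) * (|K d1| * I) := by gcongr; exact le_abs_self _
    linarith
  have g1 : P * (ϑ * L) = p * L := by rw [← mul_assoc, hPϑ]
  have g2 : P * (ϑ / (8 * p) * S) = 1 / 8 * S := by rw [← mul_assoc, e1]
  have g3 : Bc * (T / 2) = P * Q * T := by rw [hB]; ring
  have g4 : R * (E + G) = P * (Q * (E + G)) + Bc * (20 * (E + G)) + 20 * (E + G) := by rw [hR]; ring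
  have g5 : 0 ≤ R * |K d2| * E := by positivity
  have g6 : 0 ≤ (Bc + 1) * |K d1| * E := by positivity
  have key : S / 8 ≤ P * Z1 - P * (2 * σ) * Z2 + (- P * θ - 1) * Z4 + (1 + Bc) * Z5 + (P * θ + Bc) * Z6
      + R * E + R * |K d2| * I + (Bc + 1) * |K d1| * I := by
    linarith
  have : 0 ≤ R * I := by positivity
  linarith

lemma abs_le_of_sq_le_mul {x A B δ : ℝ} (hA : 0 ≤ A) (hB : 0 ≤ B) (hδ : 0 < δ)
    (h : x ^ 2 ≤ A * B) : |x| ≤ δ * A + δ⁻¹ * B := by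
  apply abs_le_of_sq_le_sq _ (by positivity)
  have : δ * δ⁻¹ = 1 := by field_simp
  nlinarith [sq_nonneg (δ * A - δ⁻¹ * B), mul_nonneg hA hB]

lemma abs_sum_le_of_sq_le_mul {ι : Type*} (s : Finset ι) {x A B : ι → ℝ} {δ : ℝ}
    (hA : ∀ i, 0 ≤ A i) (hB : ∀ i, 0 ≤ B i) (hδ : 0 < δ) (h : ∀ i, x i ^ 2 ≤ A i * B i) :
    |∑ i ∈ s, x i| ≤ δ * ∑ i ∈ s, A i + δ⁻¹ * ∑ i ∈ s, B i := by
  rw [Finset.mul_sum, Finset.mul_sum, ← Finset.sum_add_distrib]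
  exact (Finset.abs_sum_le_sum_abs _ _).trans
    (Finset.sum_le_sum fun i _ => abs_le_of_sq_le_mul (hA i) (hB i) hδ (h i))

/-- Young's inequality absorbing a loss of `n` powers of the cutoff. -/
lemma cutoff_young {α γ : ℝ} {k n : ℕ} (hα : 0 ≤ α) (hαγ : α < γ) (hnk : n < k)
    (hk : n + n * α / (γ - α) ≤ k) {δ : ℝ} (hδ : 0 < δ) :
    ∃ K : ℝ, 0 ≤ K ∧ ∀ y ζ : ℝ, 0 < y → 0 ≤ ζ → ζ ≤ 1 →
      y ^ α * ζ ^ (k - n) ≤ δ * (y ^ γ * ζ ^ k) + K * (if ζ = 0 then 0 else 1) := by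
  have hs : 0 < γ - α := sub_pos.2 hαγ
  refine ⟨(δ⁻¹) ^ (α / (γ - α)), by positivity, fun y ζ hy h0 h1 => ?_⟩
  rcases h0.eq_or_lt with rfl | h0
  · rw [zero_pow (by omega), zero_pow (by omega)]; simp
  rw [if_neg h0.ne', mul_one]
  by_cases hc : δ⁻¹ ≤ y ^ (γ - α) * ζ ^ n
  · have : y ^ γ * ζ ^ k = (y ^ α * ζ ^ (k - n)) * (y ^ (γ - α) * ζ ^ n) := by
      rw [show y ^ γ = y ^ α * y ^ (γ - α) by rw [← rpow_add hy]; ring_nf,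
        show ζ ^ k = ζ ^ (k - n) * ζ ^ n by rw [← pow_add]; congr 1; omega]
      ring
    have h2 : 0 ≤ (δ⁻¹) ^ (α / (γ - α)) := by positivity
    have h3 : δ * (y ^ α * ζ ^ (k - n) * (δ⁻¹)) ≤ δ * (y ^ γ * ζ ^ k) := by
      rw [this]; gcongr
    have h4 : δ * (y ^ α * ζ ^ (k - n) * (δ⁻¹)) = y ^ α * ζ ^ (k - n) := by field_simp
    linarith
  · push Not at hc
    have h2 : y ^ α * ζ ^ (k - n) ≤ (y ^ (γ - α) * ζ ^ n) ^ (α / (γ - α)) := by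
      rw [mul_rpow (by positivity) (by positivity), ← rpow_mul hy.le, mul_div_cancel₀ _ hs.ne',
        ← rpow_natCast ζ n, ← rpow_mul h0.le, ← rpow_natCast ζ (k - n)]
      gcongr ?_ * ?_
      apply rpow_le_rpow_of_exponent_ge h0 h1
      rw [Nat.cast_sub hnk.le, ← mul_div_assoc]
      linarith
    have h3 : (y ^ (γ - α) * ζ ^ n) ^ (α / (γ - α)) ≤ (δ⁻¹) ^ (α / (γ - α)) := by gcongr
    have h4 : 0 ≤ δ * (y ^ γ * ζ ^ k) := by positivity
    linarith

/-- Trace inequality for `H - σ u⁻¹ v ⊗ v`. -/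
lemma trace_sq_le {N : ℕ} (H : Fin N → Fin N → ℝ) (v : Fin N → ℝ) (s : ℝ) :
    ((∑ a, H a a) + s * ∑ a, v a ^ 2) ^ 2 ≤
      N * (∑ a, ∑ b, H a b ^ 2 + 2 * s * ∑ a, ∑ b, H a b * v a * v b + s ^ 2 * (∑ a, v a ^ 2) ^ 2) := by
  have e1 : (∑ a, H a a) + s * ∑ a, v a ^ 2 = ∑ a, (H a a + s * (v a * v a)) := by
    rw [Finset.sum_add_distrib, Finset.mul_sum]
    congr 1; exact Finset.sum_congr rfl fun a _ => by ring
  have e2 : ∑ a, ∑ b, H a b ^ 2 + 2 * s * ∑ a, ∑ b, H a b * v a * v b + s ^ 2 * (∑ a, v a ^ 2) ^ 2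
      = ∑ a, ∑ b, (H a b + s * (v a * v b)) ^ 2 := by
    rw [sq (∑ a, v a ^ 2), Finset.sum_mul_sum, Finset.mul_sum, Finset.mul_sum,
      ← Finset.sum_add_distrib, ← Finset.sum_add_distrib]
    refine Finset.sum_congr rfl fun a _ => ?_
    rw [Finset.mul_sum, Finset.mul_sum,
      ← Finset.sum_add_distrib, ← Finset.sum_add_distrib]
    exact Finset.sum_congr rfl fun b _ => by ring
  rw [e1, e2]
  have h := sq_sum_le_card_mul_sum_sq (s := (Finset.univ : Finset (Fin N)))
    (f := fun a => H a a + s * (v a * v a))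
  simp only [Finset.card_univ, Fintype.card_fin] at h
  refine h.trans ?_
  gcongr with a _
  exact Finset.single_le_sum (f := fun b => (H a b + s * (v a * v b)) ^ 2)
    (fun b _ => sq_nonneg _) (Finset.mem_univ a)

/-- The Bernstein-type pointwise inequality for one component. -/
lemma bernstein_pointwise {N : ℕ} (hN : 1 ≤ N) {φ u σ : ℝ} (hφ : 0 ≤ φ)
    (H : Fin N → Fin N → ℝ) (v c : Fin N → ℝ) (Lφ : ℝ) :
    let g := ∑ a, v a ^ 2
    let Δ := ∑ a, H a a
    let d := ∑ a, v a * c a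
    let h := ∑ a, ∑ b, H a b * v a * v b
    let Q := ∑ a, ∑ b, H a b ^ 2
    σ * (1 - σ * ((N - 1) / N)) * (φ * (g / u) ^ 2) ≤
      (φ * Q - φ * Δ ^ 2 - Δ * d - g * Lφ / 2)
      - 2 * σ * (φ * (h / u) + φ * (g / u) * Δ / 2 - φ * (g / u) ^ 2 / 2 + (g / u) * d / 2)
      + (N - 1) / N * (φ * Δ ^ 2) + σ * (N + 2) / N * (φ * (g / u * Δ)) + Δ * d + g * Lφ / 2
      + σ * (g / u * d) := by
  intro g Δ d h Q
  have hN' : (0 : ℝ) < N := by exact_mod_cast hN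
  have key := trace_sq_le H v (-σ / u)
  change (Δ + -σ / u * g) ^ 2 ≤ N * (Q + 2 * (-σ / u) * h + (-σ / u) ^ 2 * g ^ 2) at key
  have e1 : -σ / u * g = -σ * (g / u) := by ring
  have e2 : 2 * (-σ / u) * h = -2 * σ * (h / u) := by ring
  have e3 : (-σ / u) ^ 2 * g ^ 2 = σ ^ 2 * (g / u) ^ 2 := by ring
  rw [e1, e2, e3] at key
  generalize g / u = y at *
  generalize h / u = h' at *
  have k2 : φ * ((Δ + -σ * y) ^ 2 / N) ≤ φ * (Q + -2 * σ * h' + σ ^ 2 * y ^ 2) := by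
    apply mul_le_mul_of_nonneg_left _ hφ
    rw [div_le_iff₀ hN']; linarith
  have k3 : φ * ((Δ + -σ * y) ^ 2 / N) = (φ * Δ ^ 2 - 2 * σ * (φ * (y * Δ)) + σ ^ 2 * (φ * y ^ 2)) / N := by
    ring
  have k4 : ((N : ℝ) - 1) / N = 1 - 1 / N := by field_simp
  have k5 : σ * ((N : ℝ) + 2) / N = σ * (1 + 2 / N) := by field_simp
  rw [k4, k5]
  rw [k3] at k2
  have : (φ * Δ ^ 2 - 2 * σ * (φ * (y * Δ)) + σ ^ 2 * (φ * y ^ 2)) / N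
    = 1 / N * (φ * Δ ^ 2) - 2 * σ * (1 / N) * (φ * (y * Δ)) + σ ^ 2 * (1 / N) * (φ * y ^ 2) := by ring
  rw [this] at k2
  have e6 : (2 : ℝ) / N = 2 * (1 / N) := by ring
  rw [e6]
  generalize (1 / N : ℝ) = n at *
  linarith

set_option maxHeartbeats 1000000 in
/-- The pointwise integral-estimate inequality, before integration. -/
lemma core_pointwise {κ μ θ σ r b B M : ℝ} (hκ : 0 < κ) (hθ : 0 ≤ θ) (hσ : 0 ≤ σ) (hr : 0 < r)
    (hϑ : 0 < μ - θ * (2 * r + 1)) (hb : 0 < b) (hB : 0 ≤ B) (hM : 0 ≤ M) (m k : ℕ)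
    (hk : 2 * (2 * r + 1) / r ≤ k) :
    ∃ C l1 l2 l4 l5 l6 : ℝ, 0 ≤ C ∧ ∀ (ζ φt Lφ Φ : ℝ) (u g Δ d ut F P z1 z2 : Fin m → ℝ),
      0 ≤ ζ → ζ ≤ 1 → |Lφ| ≤ M * ζ ^ (k - 2) → |φt| ≤ M * ζ ^ (k - 1) →
      (∀ i, 0 < u i) → (∀ i, 0 ≤ g i) → (∀ i, d i ^ 2 ≤ g i * (M * ζ ^ (2 * k - 2))) →
      (∀ i, b * u i ^ (2 * r + 1) ≤ F i) → |Φ| ≤ B * ∑ i, u i ^ (2 * r + 2) →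
      ∑ i, P i ≤ (2 * r + 1) * ∑ i, F i * (g i / u i) →
      (∀ i, κ * (ζ ^ k * (g i / u i) ^ 2) ≤ z1 i - 2 * σ * z2 i + θ * (ζ ^ k * Δ i ^ 2)
        + μ * (ζ ^ k * (g i / u i * Δ i)) + Δ i * d i + g i * Lφ / 2 + σ * (g i / u i * d i)) →
      ∑ i, ζ ^ k * F i ^ 2 ≤ l1 * ∑ i, z1 i + l2 * ∑ i, z2 i
        + l4 * ∑ i, (ζ ^ k * (F i * Δ i) + ζ ^ k * P i + F i * d i)
        + l5 * (∑ i, ζ ^ k * (F i * ut i) + Φ * φt)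
        + l6 * ∑ i, (ζ ^ k * (ut i * Δ i) + ut i * d i - g i * φt / 2)
        + C * (∑ i, ζ ^ k * (ut i - Δ i - F i) ^ 2 + if ζ = 0 then 0 else 1) := by
  have hk4 : 4 < k := by
    have : (4 : ℝ) < 2 * (2 * r + 1) / r := by rw [lt_div_iff₀ hr]; linarith
    exact_mod_cast this.trans_le hk
  have hμ : 0 ≤ μ := by
    have : 0 ≤ θ * (2 * r + 1) := by positivity
    linarith
  -- absorption constants
  have hkr : (2 * (2 * r + 1)) ≤ k * r := by rwa [div_le_iff₀ hr] at hk
  have Y1 : ∀ δ > 0, ∃ K : ℝ, 0 ≤ K ∧ ∀ y ζ : ℝ, 0 < y → 0 ≤ ζ → ζ ≤ 1 →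
      y ^ (2 : ℝ) * ζ ^ (k - 4) ≤ δ * (y ^ (2 * (2 * r + 1)) * ζ ^ k)
        + K * (if ζ = 0 then 0 else 1) := fun δ hδ =>
    cutoff_young (by norm_num) (by linarith) hk4 (by
      have : (4 : ℕ) + (4 : ℕ) * 2 / (2 * (2 * r + 1) - 2) = 2 * (2 * r + 1) / r := by
        push_cast
        rw [show 2 * (2 * r + 1) - 2 = 4 * r by ring]; field_simp; ring
      rw [this]; exact hk) hδ
  have Y2 : ∀ δ > 0, ∃ K : ℝ, 0 ≤ K ∧ ∀ y ζ : ℝ, 0 < y → 0 ≤ ζ → ζ ≤ 1 →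
      y ^ (2 * r + 2) * ζ ^ (k - 1) ≤ δ * (y ^ (2 * (2 * r + 1)) * ζ ^ k)
        + K * (if ζ = 0 then 0 else 1) := fun δ hδ =>
    cutoff_young (by linarith) (by linarith) (by omega) (by
      have : (1 : ℕ) + (1 : ℕ) * (2 * r + 2) / (2 * (2 * r + 1) - (2 * r + 2)) =
          (2 * r + 1) / r := by
        push_cast
        rw [show 2 * (2 * r + 1) - (2 * r + 2) = 2 * r by ring]; field_simp; ring
      rw [this]
      refine le_trans ?_ hk
      gcongr; linarith) hδ
  choose! K1 hK1 hY1 using Y1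
  choose! K2 hK2 hY2 using Y2
  let ε1 : ℝ → ℝ := fun δ => δ * δ * b ^ 2 / (M ^ 2 + 1)
  let ε2 : ℝ → ℝ := fun δ => δ * b ^ 2 / (B * M + 1)
  obtain ⟨C, l1, l2, l4, l5, l6, hC, H⟩ := energy_absorption (κ := κ) (μ := μ) (θ := θ) (σ := σ)
    (p := 2 * r + 1) hκ hϑ hμ hθ hσ (by linarith) rfl
    (fun δ => δ⁻¹ * M ^ 2 * (m * K1 (ε1 δ)) + B * M * (m * K2 (ε2 δ)))
  refine ⟨C, l1, l2, l4, l5, l6, hC, ?_⟩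
  intro ζ φt Lφ Φ u g Δ d ut F P z1 z2 h0 h1 hLφ hφt hu hg hd hF hΦ hP hB1
  set φ := ζ ^ k with hφ
  have hφ0 : 0 ≤ φ := by positivity
  set I : ℝ := if ζ = 0 then 0 else 1 with hI
  have hI0 : 0 ≤ I := by rw [hI]; split_ifs <;> norm_num
  have hFnn : ∀ i, 0 ≤ F i := fun i => le_trans (by have := hu i; positivity) (hF i)
  have z26 : ζ ^ (k - 1) ≤ ζ ^ (k - 2) := pow_le_pow_of_le_one h0 h1 (by omega)
  -- F controls powers of u
  have hFu : ∀ i, b ^ 2 * (u i ^ (2 * (2 * r + 1)) * φ) ≤ φ * F i ^ 2 := by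
    intro i
    have h2 : (b * u i ^ (2 * r + 1)) ^ 2 ≤ F i ^ 2 := by
      have := hu i
      gcongr; exact hF i
    have h3 : u i ^ (2 * (2 * r + 1)) = (u i ^ (2 * r + 1)) ^ 2 := by
      rw [← rpow_natCast, ← rpow_mul (hu i).le]; norm_num; ring_nf
    rw [h3]
    nlinarith [mul_le_mul_of_nonneg_left h2 hφ0]
  set e : Fin m → ℝ := fun i => ut i - Δ i - F i with he
  have hdφ : ∀ i, d i ^ 2 ≤ φ * (M * g i * ζ ^ (k - 2)) := by
    intro i
    refine (hd i).trans (le_of_eq ?_)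
    rw [show 2 * k - 2 = k + (k - 2) by omega, pow_add]; ring
  have hG0 : ∀ i, 0 ≤ M * g i * ζ ^ (k - 2) := fun i => by have := hg i; positivity
  have cross : ∀ (x A C : Fin m → ℝ), (∀ i, 0 ≤ A i) → (∀ i, 0 ≤ C i) →
      (∀ i, x i ^ 2 ≤ A i * C i) → ∀ δ > 0, |∑ i, x i| ≤ δ * ∑ i, A i + δ⁻¹ * ∑ i, C i :=
    fun x A C hA hC h δ hδ => abs_sum_le_of_sq_le_mul _ hA hC hδ h
  have sqn : ∀ f : Fin m → ℝ, ∀ i, 0 ≤ φ * f i ^ 2 := fun f i => by positivity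
  have key := H (∑ i, φ * (g i / u i) ^ 2) (∑ i, φ * ut i ^ 2) (∑ i, φ * F i ^ 2)
    (∑ i, φ * e i ^ 2) (∑ i, M * g i * ζ ^ (k - 2)) I (∑ i, φ * (F i * (g i / u i)))
    (∑ i, φ * Δ i ^ 2) (∑ i, z1 i) (∑ i, z2 i)
    (∑ i, (φ * (F i * Δ i) + φ * P i + F i * d i))
    (∑ i, φ * (F i * ut i) + Φ * φt)
    (∑ i, (φ * (ut i * Δ i) + ut i * d i - g i * φt / 2))
    (∑ i, φ * (g i / u i * ut i)) (∑ i, φ * (g i / u i * e i))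
    (∑ i, ut i * d i) (∑ i, F i * d i) (∑ i, e i * d i) (∑ i, g i / u i * d i)
    (∑ i, φ * (e i * ut i)) (∑ i, φ * (e i * F i)) (∑ i, g i * Lφ) (∑ i, g i * φt) (Φ * φt)
    (Finset.sum_nonneg fun i _ => sqn (fun i => g i / u i) i)
    (Finset.sum_nonneg fun i _ => sqn ut i)
    (Finset.sum_nonneg fun i _ => sqn F i) (Finset.sum_nonneg fun i _ => sqn e i)
    (Finset.sum_nonneg fun i _ => hG0 i) hI0 ?_ ?_ ?_ ?_
    (cross _ _ _ (sqn _) (sqn _) fun i => le_of_eq (by ring))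
    (cross _ _ _ (sqn _) (sqn _) fun i => le_of_eq (by ring))
    (cross _ _ _ (sqn _) hG0 fun i => ?_)
    (cross _ _ _ (sqn _) hG0 fun i => ?_)
    (cross _ _ _ (sqn _) hG0 fun i => ?_)
    (cross _ _ _ (sqn _) hG0 fun i => ?_)
    (cross _ _ _ (sqn _) (sqn _) fun i => le_of_eq (by ring))
    (cross _ _ _ (sqn _) (sqn _) fun i => le_of_eq (by ring))
    ?_ ?_ ?_ ?_
  · exact key
  · have := Finset.sum_le_sum fun i (_ : i ∈ Finset.univ) => hB1 i
    rw [← Finset.mul_sum] at this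
    refine this.trans (le_of_eq ?_)
    simp only [Finset.mul_sum, Finset.sum_div, ← Finset.sum_add_distrib, ← Finset.sum_sub_distrib]
    exact Finset.sum_congr rfl fun i _ => by simp only [he]; ring
  · have hP' := mul_le_mul_of_nonneg_left hP hφ0
    have e1 : φ * ((2 * r + 1) * ∑ i, F i * (g i / u i)) =
        (2 * r + 1) * ∑ i, φ * (F i * (g i / u i)) := by
      rw [← Finset.mul_sum]; ring
    rw [e1] at hP'
    have e2 : ∑ i, φ * Δ i ^ 2 = ∑ i, (φ * (ut i * Δ i) + ut i * d i - g i * φt / 2)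
        - ∑ i, (φ * (F i * Δ i) + φ * P i + F i * d i) + φ * ∑ i, P i + ∑ i, F i * d i
        - ∑ i, ut i * d i + (∑ i, g i * φt) / 2 - (∑ i, φ * (e i * ut i) - ∑ i, φ * (e i * F i)
          - ∑ i, φ * e i ^ 2) := by
      simp only [Finset.mul_sum, Finset.sum_div, ← Finset.sum_add_distrib,
        ← Finset.sum_sub_distrib]
      exact Finset.sum_congr rfl fun i _ => by simp only [he]; ring
    linarith
  · have e2 : ∑ i, φ * ut i ^ 2 = ∑ i, (φ * (ut i * Δ i) + ut i * d i - g i * φt / 2)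
        + ∑ i, φ * (F i * ut i) + ∑ i, φ * (e i * ut i) - ∑ i, ut i * d i 
        + (∑ i, g i * φt) / 2 := by
      simp only [Finset.sum_div, ← Finset.sum_add_distrib,
        ← Finset.sum_sub_distrib]
      exact Finset.sum_congr rfl fun i _ => by simp only [he]; ring
    linarith
  · have hP' := mul_le_mul_of_nonneg_left hP hφ0
    have e1 : φ * ((2 * r + 1) * ∑ i, F i * (g i / u i)) =
        (2 * r + 1) * ∑ i, φ * (F i * (g i / u i)) := by
      rw [← Finset.mul_sum]; ring
    rw [e1] at hP'
    have e2 : ∑ i, φ * F i ^ 2 = ∑ i, φ * (F i * ut i)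
        - ∑ i, (φ * (F i * Δ i) + φ * P i + F i * d i) + φ * ∑ i, P i + ∑ i, F i * d i
        - ∑ i, φ * (e i * F i) := by
      simp only [Finset.mul_sum, ← Finset.sum_add_distrib,
        ← Finset.sum_sub_distrib]
      exact Finset.sum_congr rfl fun i _ => by simp only [he]; ring
    linarith
  · have := mul_le_mul_of_nonneg_left (hdφ i) (sq_nonneg (ut i))
    linarith
  · have := mul_le_mul_of_nonneg_left (hdφ i) (sq_nonneg (F i))
    linarith
  · have := mul_le_mul_of_nonneg_left (hdφ i) (sq_nonneg (e i))
    linarith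
  · have := mul_le_mul_of_nonneg_left (hdφ i) (sq_nonneg (g i / u i))
    linarith
  · refine (Finset.abs_sum_le_sum_abs _ _).trans (Finset.sum_le_sum fun i _ => ?_)
    rw [abs_mul, abs_of_nonneg (hg i)]
    nlinarith [mul_le_mul_of_nonneg_left hLφ (hg i)]
  · refine (Finset.abs_sum_le_sum_abs _ _).trans (Finset.sum_le_sum fun i _ => ?_)
    rw [abs_mul, abs_of_nonneg (hg i)]
    have := hφt.trans (mul_le_mul_of_nonneg_left z26 hM)
    nlinarith [mul_le_mul_of_nonneg_left this (hg i)]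
  · intro δ hδ
    have hε : 0 < ε1 δ := by simp only [ε1]; positivity
    have s1 := cross (fun i => M * g i * ζ ^ (k - 2)) (fun i => φ * (g i / u i) ^ 2)
      (fun i => M ^ 2 * (u i ^ 2 * ζ ^ (k - 4))) (sqn _) (fun i => by have := hu i; positivity)
      (fun i => le_of_eq (by
        have := (hu i).ne'
        have e : ζ ^ (k - 2) * ζ ^ (k - 2) = φ * ζ ^ (k - 4) := by
          rw [hφ, ← pow_add, ← pow_add]; congr 1; omega
        field_simp
        linear_combination M ^ 2 * (g i) ^ 2 * e)) δ hδ
    have s2 : ∑ i, M ^ 2 * (u i ^ 2 * ζ ^ (k - 4)) ≤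
        ∑ i, (δ ^ 2 * (φ * F i ^ 2) + M ^ 2 * (K1 (ε1 δ) * I)) := by
      refine Finset.sum_le_sum fun i _ => ?_
      have := hY1 (ε1 δ) hε (u i) ζ (hu i) h0 h1
      rw [rpow_two] at this
      have t := mul_le_mul_of_nonneg_left this (sq_nonneg M)
      have t2 : M ^ 2 * (ε1 δ * (u i ^ (2 * (2 * r + 1)) * ζ ^ k)) ≤ δ ^ 2 * (φ * F i ^ 2) := by
        have q : M ^ 2 * ε1 δ ≤ δ ^ 2 * b ^ 2 := by
          simp only [ε1]
          rw [← mul_div_assoc, div_le_iff₀ (by positivity)]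
          have : 0 ≤ δ ^ 2 * b ^ 2 := by positivity
          linarith
        have w : 0 ≤ u i ^ (2 * (2 * r + 1)) * φ := by have := hu i; positivity
        calc _ = (M ^ 2 * ε1 δ) * (u i ^ (2 * (2 * r + 1)) * φ) := by rw [hφ]; ring
          _ ≤ (δ ^ 2 * b ^ 2) * (u i ^ (2 * (2 * r + 1)) * φ) := by gcongr
          _ = δ ^ 2 * (b ^ 2 * (u i ^ (2 * (2 * r + 1)) * φ)) := by ring
          _ ≤ _ := mul_le_mul_of_nonneg_left (hFu i) (by positivity)
      linarith
    have s2e : ∀ (c c' : ℝ), ∑ i, (c * (φ * F i ^ 2) + c') = c * ∑ i, φ * F i ^ 2 + m * c' := by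
      intro c c'
      rw [Finset.sum_add_distrib, ← Finset.mul_sum, Finset.sum_const, Finset.card_univ,
        Fintype.card_fin, nsmul_eq_mul]
    rw [s2e] at s2
    have s3 := mul_le_mul_of_nonneg_left s2 (inv_pos.2 hδ).le
    have s4 := (le_abs_self _).trans s1
    have e5 : δ⁻¹ * (δ ^ 2 * ∑ i, φ * F i ^ 2 + m * (M ^ 2 * (K1 (ε1 δ) * I))) =
      δ * ∑ i, φ * F i ^ 2 + δ⁻¹ * M ^ 2 * (m * K1 (ε1 δ)) * I := by field_simp
    rw [e5] at s3
    have e6 : 0 ≤ B * M * (m * K2 (ε2 δ)) * I := by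
      have := hK2 (ε2 δ) (by simp only [ε2]; positivity)
      positivity
    linarith
  · intro δ hδ
    have hε : 0 < ε2 δ := by simp only [ε2]; positivity
    have s0 : |Φ * φt| ≤ ∑ i, B * M * (u i ^ (2 * r + 2) * ζ ^ (k - 1)) := by
      rw [abs_mul]
      calc _ ≤ (B * ∑ i, u i ^ (2 * r + 2)) * (M * ζ ^ (k - 1)) := by
            gcongr; exact (abs_nonneg _).trans hΦ
        _ = _ := by
            rw [← Finset.mul_sum, ← Finset.sum_mul]; ring
    have s2 : ∑ i, B * M * (u i ^ (2 * r + 2) * ζ ^ (k - 1)) ≤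
        ∑ i, (δ * (φ * F i ^ 2) + B * M * (K2 (ε2 δ) * I)) := by
      refine Finset.sum_le_sum fun i _ => ?_
      have := hY2 (ε2 δ) hε (u i) ζ (hu i) h0 h1
      have t := mul_le_mul_of_nonneg_left this (mul_nonneg hB hM)
      have t2 : B * M * (ε2 δ * (u i ^ (2 * (2 * r + 1)) * ζ ^ k)) ≤ δ * (φ * F i ^ 2) := by
        have q : B * M * ε2 δ ≤ δ * b ^ 2 := by
          simp only [ε2]
          rw [← mul_div_assoc, div_le_iff₀ (by positivity)]
          have : 0 ≤ δ * b ^ 2 := by positivity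
          linarith
        have w : 0 ≤ u i ^ (2 * (2 * r + 1)) * φ := by have := hu i; positivity
        calc _ = (B * M * ε2 δ) * (u i ^ (2 * (2 * r + 1)) * φ) := by rw [hφ]; ring
          _ ≤ (δ * b ^ 2) * (u i ^ (2 * (2 * r + 1)) * φ) := by gcongr
          _ = δ * (b ^ 2 * (u i ^ (2 * (2 * r + 1)) * φ)) := by ring
          _ ≤ _ := mul_le_mul_of_nonneg_left (hFu i) (by positivity)
      linarith
    have s2e : ∀ (c c' : ℝ), ∑ i, (c * (φ * F i ^ 2) + c') = c * ∑ i, φ * F i ^ 2 + m * c' := by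
      intro c c'
      rw [Finset.sum_add_distrib, ← Finset.mul_sum, Finset.sum_const, Finset.card_univ,
        Fintype.card_fin, nsmul_eq_mul]
    rw [s2e] at s2
    have e6 : 0 ≤ δ⁻¹ * M ^ 2 * (m * K1 (ε1 δ)) * I := by
      have := hK1 (ε1 δ) (by simp only [ε1]; positivity)
      positivity
    linarith

section DivergenceIdentities
variable {A : Type*} [CommRing A] [Algebra ℝ A] {N : ℕ} (D : Fin N → Derivation ℝ A A)

lemma bochner_divergence (hD : ∀ a b f, D a (D b f) = D b (D a f)) (φ u : A) :
    ∑ a, D a (φ * D a (∑ b, D b u * D b u) - 2 * (φ * (∑ b, D b (D b u)) * D a u)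
      - (∑ b, D b u * D b u) * D a φ) =
    2 * (φ * ∑ a, ∑ b, D a (D b u) * D a (D b u)) - 2 * (φ * (∑ b, D b (D b u)) * ∑ b, D b (D b u))
      - 2 * ((∑ b, D b (D b u)) * ∑ a, D a u * D a φ) - (∑ b, D b u * D b u) * ∑ a, D a (D a φ) := by
  set g := ∑ b, D b u * D b u with hg
  set Δ := ∑ b, D b (D b u) with hΔ
  have two : ∀ a, D a (2 : A) = 0 := fun a => by
    rw [show (2 : A) = 1 + 1 by norm_num, map_add, Derivation.map_one_eq_zero, add_zero]
  have hDDg : ∑ a, D a (D a g) = 2 * ∑ a, ∑ b, D a (D b u) * D a (D b u)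
      + 2 * ∑ a, D a u * D a Δ := by
    have e1 : ∀ a, D a (D a g) = ∑ b, (2 * (D a (D b u) * D a (D b u))
        + 2 * (D b u * D a (D a (D b u)))) := by
      intro a
      rw [hg, map_sum, map_sum]
      refine Finset.sum_congr rfl fun b _ => ?_
      simp only [Derivation.leibniz, map_add, smul_eq_mul]; ring
    simp only [e1, Finset.sum_add_distrib, ← Finset.mul_sum]
    congr 2
    rw [Finset.sum_comm]
    refine Finset.sum_congr rfl fun b _ => ?_
    rw [← Finset.mul_sum, hΔ, map_sum]
    congr 1
    exact Finset.sum_congr rfl fun a _ => by rw [hD a b u, hD a b (D a u)]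
  have e : ∀ a, D a (φ * D a g - 2 * (φ * Δ * D a u) - g * D a φ) =
      φ * D a (D a g) - 2 * (Δ * (D a u * D a φ)) - 2 * (φ * (D a u * D a Δ))
        - 2 * (φ * Δ * D a (D a u)) - g * D a (D a φ) := by
    intro a
    simp only [map_sub, Derivation.leibniz, smul_eq_mul, two]; ring
  simp only [e, Finset.sum_sub_distrib, ← Finset.mul_sum, hDDg]
  rw [← hΔ]
  ring

lemma weighted_gradient_divergence (φ u q : A)
    (hq : q * u = 1) :
    ∑ a, D a (φ * q * (∑ b, D b u * D b u) * D a u) =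
    φ * q * (∑ b, D b u * D b u) * (∑ b, D b (D b u))
      + q * (∑ b, D b u * D b u) * (∑ a, D a u * D a φ)
      - φ * (q * ∑ b, D b u * D b u) * (q * ∑ b, D b u * D b u)
      + 2 * (φ * (q * ∑ a, ∑ b, D a (D b u) * D a u * D b u)) := by
  set g := ∑ b, D b u * D b u with hg
  have hDq : ∀ a, D a q = - (q * q * D a u) := by
    intro a
    have h1 : D a (q * u) = 0 := by rw [hq]; simp
    rw [Derivation.leibniz] at h1
    simp only [smul_eq_mul] at h1
    linear_combination q * h1 - D a q * hq
  have hDg : ∀ a, D a g = 2 * ∑ b, D a (D b u) * D b u := by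
    intro a
    rw [hg, map_sum, Finset.mul_sum]
    refine Finset.sum_congr rfl fun b _ => ?_
    simp only [Derivation.leibniz, smul_eq_mul]; ring
  have e : ∀ a, D a (φ * q * g * D a u) = φ * q * g * D a (D a u) + q * g * (D a u * D a φ)
      - φ * (q * g) * (q * (D a u * D a u))
      + 2 * (φ * (q * ∑ b, D a (D b u) * D a u * D b u)) := by
    intro a
    have : D a u * D a g = 2 * ∑ b, D a (D b u) * D a u * D b u := by
      rw [hDg, Finset.mul_sum, Finset.mul_sum, Finset.mul_sum]
      exact Finset.sum_congr rfl fun b _ => by ring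
    simp only [Derivation.leibniz, smul_eq_mul, hDq]
    linear_combination φ * q * this
  simp only [e, Finset.sum_sub_distrib, Finset.sum_add_distrib, ← Finset.mul_sum]
  rw [← hg]

lemma flux_divergence (φ u F : A) :
    ∑ a, D a (φ * F * D a u) = φ * F * (∑ b, D b (D b u)) + φ * (∑ a, D a F * D a u)
      + F * (∑ a, D a u * D a φ) := by
  have e : ∀ a, D a (φ * F * D a u) = φ * F * (D a (D a u)) + φ * (D a F * D a u)
      + F * (D a u * D a φ) := by
    intro a; simp only [Derivation.leibniz, smul_eq_mul]; ring
  simp only [e, Finset.sum_add_distrib, ← Finset.mul_sum]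

lemma energy_divergence (T : Derivation ℝ A A) (hT : ∀ a f, D a (T f) = T (D a f)) (φ u : A) :
    2 * ∑ a, D a (φ * T u * D a u) - T (φ * ∑ b, D b u * D b u) =
    2 * (φ * T u * (∑ b, D b (D b u))) + 2 * (T u * (∑ a, D a u * D a φ))
      - T φ * ∑ b, D b u * D b u := by
  rw [flux_divergence, Derivation.leibniz, map_sum]
  have : ∑ b, T (D b u * D b u) = 2 * ∑ a, D a (T u) * D a u := by
    rw [Finset.mul_sum]
    refine Finset.sum_congr rfl fun b _ => ?_
    simp only [Derivation.leibniz, smul_eq_mul, hT]; ring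
  rw [this]; simp only [smul_eq_mul]; ring

end DivergenceIdentities

section SmoothAlgebra
variable {V : Type*} [NormedAddCommGroup V] [NormedSpace ℝ V]

/-- The algebra of smooth real functions. -/
def smoothAlg (V : Type*) [NormedAddCommGroup V] [NormedSpace ℝ V] : Subalgebra ℝ (V → ℝ) where
  carrier := {f | ContDiff ℝ ∞ f}
  mul_mem' := fun {a b} (ha : ContDiff ℝ ∞ a) (hb : ContDiff ℝ ∞ b) =>
    show ContDiff ℝ ∞ (fun x => a x * b x) from ha.mul hb
  add_mem' := fun {a b} (ha : ContDiff ℝ ∞ a) (hb : ContDiff ℝ ∞ b) =>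
    show ContDiff ℝ ∞ (fun x => a x + b x) from ha.add hb
  algebraMap_mem' := fun c => show ContDiff ℝ ∞ (fun _ : V => c) from contDiff_const

lemma smoothAlg.contDiff (f : smoothAlg V) : ContDiff ℝ ∞ (f : V → ℝ) := f.2

/-- Directional derivative as a derivation of the algebra of smooth functions. -/
noncomputable def smoothD (v : V) : Derivation ℝ (smoothAlg V) (smoothAlg V) where
  toFun f := ⟨dd v f, (smoothAlg.contDiff f).dd_smooth v⟩
  map_add' f g := by
    ext x
    exact dd_add ((smoothAlg.contDiff f).differentiable (by simp) x)
      ((smoothAlg.contDiff g).differentiable (by simp) x) v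
  map_smul' c f := by
    ext x
    exact dd_const_mul c ((smoothAlg.contDiff f).differentiable (by simp) x) v
  map_one_eq_zero' := by
    ext x
    exact congrFun (dd_const 1 v) x
  leibniz' f g := by
    ext x
    have := dd_mul ((smoothAlg.contDiff f).differentiable (by simp) x)
      ((smoothAlg.contDiff g).differentiable (by simp) x) v
    change dd v (fun y => (f : V → ℝ) y * (g : V → ℝ) y) x =
      (f : V → ℝ) x * dd v g x + (g : V → ℝ) x * dd v f x
    rw [this]; ring

@[simp] lemma smoothD_apply (v : V) (f : smoothAlg V) (x : V) :
    (smoothD v f : V → ℝ) x = dd v f x := rfl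

@[simp] lemma coe_smoothD (v : V) (f : smoothAlg V) :
    (smoothD v f : V → ℝ) = dd v f := rfl

lemma smoothD_comm (v w : V) (f : smoothAlg V) : smoothD v (smoothD w f) = smoothD w (smoothD v f) := by
  ext x
  exact dd_comm (contDiff_infty.1 (smoothAlg.contDiff f) 2).contDiffAt v w

end SmoothAlgebra

section Algebra
variable {m N : ℕ}

/-- The nonlinearity of the system. -/
noncomputable def sysF (β : Fin m → Fin m → ℝ) (r : ℝ) (u : Fin m → ℝ) (i : Fin m) : ℝ :=
  ∑ j, β i j * u i ^ r * u j ^ (r + 1)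

lemma sum_swap_symm {β : Fin m → Fin m → ℝ} (hsym : ∀ i j, β i j = β j i) (f : Fin m → Fin m → ℝ) :
    ∑ i, ∑ j, β i j * f i j = ∑ i, ∑ j, β i j * f j i := by
  rw [Finset.sum_comm]
  exact Finset.sum_congr rfl fun i _ => Finset.sum_congr rfl fun j _ => by rw [hsym]

lemma sum_grad_sysF_le {β : Fin m → Fin m → ℝ} {r : ℝ} (hr : 0 < r) (hsym : ∀ i j, β i j = β j i)
    (hβ : ∀ i j, 0 ≤ β i j) {u : Fin m → ℝ} (hu : ∀ i, 0 < u i) (v : Fin m → Fin N → ℝ) :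
    ∑ i, ∑ a, (∑ j, β i j * (r * u i ^ (r - 1) * v i a * u j ^ (r + 1)
        + u i ^ r * ((r + 1) * u j ^ r * v j a))) * v i a ≤
      (2 * r + 1) * ∑ i, sysF β r u i * ((∑ a, v i a ^ 2) / u i) := by
  have h1 : ∀ i, ∑ a, (∑ j, β i j * (r * u i ^ (r - 1) * v i a * u j ^ (r + 1)
        + u i ^ r * ((r + 1) * u j ^ r * v j a))) * v i a ≤
      ∑ j, β i j * (r * (u i ^ r * u j ^ (r + 1) * ((∑ a, v i a ^ 2) / u i))
        + (r + 1) / 2 * (u i ^ r * u j ^ (r + 1) * ((∑ a, v i a ^ 2) / u i)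
          + u j ^ r * u i ^ (r + 1) * ((∑ a, v j a ^ 2) / u j))) := by
    intro i
    simp only [Finset.sum_mul]
    rw [Finset.sum_comm]
    refine Finset.sum_le_sum fun j _ => ?_
    simp only [mul_assoc]
    rw [← Finset.mul_sum]
    refine mul_le_mul_of_nonneg_left ?_ (hβ i j)
    simp only [Finset.sum_div, Finset.mul_sum, ← Finset.sum_add_distrib]
    refine Finset.sum_le_sum fun a _ => ?_
    have hi := hu i
    have hj := hu j
    rw [rpow_sub_one hi.ne', rpow_add_one hi.ne', rpow_add_one hj.ne']
    have key : v j a * v i a ≤ 1 / 2 * (u j * (v i a ^ 2 / u i) + u i * (v j a ^ 2 / u j)) := by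
      have : 1 / 2 * (u j * (v i a ^ 2 / u i) + u i * (v j a ^ 2 / u j)) - v j a * v i a
        = (u j * v i a - u i * v j a) ^ 2 / (2 * (u i * u j)) := by field_simp; ring
      have : 0 ≤ (u j * v i a - u i * v j a) ^ 2 / (2 * (u i * u j)) := by positivity
      linarith
    have k2 := mul_le_mul_of_nonneg_left key
      (show 0 ≤ (r + 1) * (u i ^ r * u j ^ r) by positivity)
    have e : u i ^ r / u i * (v i a * (u j ^ r * u j)) * v i a
      = u i ^ r * (u j ^ r * u j) * (v i a ^ 2 / u i) := by field_simp
    nlinarith [e, k2]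
  refine (Finset.sum_le_sum fun i _ => h1 i).trans (le_of_eq ?_)
  have h2 := sum_swap_symm hsym fun i j => u i ^ r * u j ^ (r + 1) * ((∑ a, v i a ^ 2) / u i)
  have h3 : ∑ i, sysF β r u i * ((∑ a, v i a ^ 2) / u i) = ∑ i, ∑ j, β i j *
      (u i ^ r * u j ^ (r + 1) * ((∑ a, v i a ^ 2) / u i)) := by
    refine Finset.sum_congr rfl fun i _ => ?_
    rw [sysF, Finset.sum_mul]
    exact Finset.sum_congr rfl fun j _ => by ring
  rw [h3]
  simp only [mul_add, Finset.sum_add_distrib]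
  simp only [mul_left_comm (β _ _), ← Finset.mul_sum]
  simp only [mul_left_comm (β _ _)] at h2
  rw [← h2]; ring

lemma le_sysF {β : Fin m → Fin m → ℝ} {r : ℝ} (hβ : ∀ i j, 0 ≤ β i j) {u : Fin m → ℝ}
    (hu : ∀ i, 0 < u i) {b : ℝ} (i : Fin m) (hb : b ≤ β i i) :
    b * u i ^ (2 * r + 1) ≤ sysF β r u i := by
  calc b * u i ^ (2 * r + 1) ≤ β i i * u i ^ (2 * r + 1) := by gcongr; exact (rpow_pos_of_pos (hu i) _).le
    _ = β i i * u i ^ r * u i ^ (r + 1) := by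
      rw [mul_assoc, ← rpow_add (hu i)]; congr 2; ring
    _ ≤ sysF β r u i := by
      apply Finset.single_le_sum (f := fun j => β i j * u i ^ r * u j ^ (r + 1)) _ (Finset.mem_univ i)
      intro j _
      exact mul_nonneg (mul_nonneg (hβ i j) (rpow_nonneg (hu i).le _)) (rpow_nonneg (hu j).le _)

lemma sysF_nonneg {β : Fin m → Fin m → ℝ} {r : ℝ} (hβ : ∀ i j, 0 ≤ β i j) {u : Fin m → ℝ}
    (hu : ∀ i, 0 ≤ u i) (i : Fin m) : 0 ≤ sysF β r u i :=
  Finset.sum_nonneg fun j _ =>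
    mul_nonneg (mul_nonneg (hβ i j) (rpow_nonneg (hu i) _)) (rpow_nonneg (hu j) _)

/-- The potential of the nonlinearity. -/
noncomputable def sysPot (β : Fin m → Fin m → ℝ) (r : ℝ) (u : Fin m → ℝ) : ℝ :=
  (2 * (r + 1))⁻¹ * ∑ i, ∑ j, β i j * (u i ^ (r + 1) * u j ^ (r + 1))

lemma abs_sysPot_le {β : Fin m → Fin m → ℝ} {r : ℝ} (hr : 0 < r) (hβ : ∀ i j, 0 ≤ β i j)
    {u : Fin m → ℝ} (hu : ∀ i, 0 < u i) :
    |sysPot β r u| ≤ (∑ i, ∑ j, β i j) * ∑ i, u i ^ (2 * r + 2) := by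
  have h0 : 0 ≤ sysPot β r u := by
    refine mul_nonneg (by positivity) (Finset.sum_nonneg fun i _ => Finset.sum_nonneg fun j _ => ?_)
    have := hu i; have := hu j; have := hβ i j
    positivity
  rw [abs_of_nonneg h0, sysPot]
  have hS : 0 ≤ ∑ i, u i ^ (2 * r + 2) := Finset.sum_nonneg fun i _ => (rpow_pos_of_pos (hu i) _).le
  have h1 : ∑ i, ∑ j, β i j * (u i ^ (r + 1) * u j ^ (r + 1)) ≤
      (∑ i, ∑ j, β i j) * ∑ i, u i ^ (2 * r + 2) := by
    rw [Finset.sum_mul]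
    refine Finset.sum_le_sum fun i _ => ?_
    rw [Finset.sum_mul]
    refine Finset.sum_le_sum fun j _ => mul_le_mul_of_nonneg_left ?_ (hβ i j)
    have hs : ∀ l, (u l ^ (r + 1)) ^ 2 ≤ ∑ i, u i ^ (2 * r + 2) := by
      intro l
      have : (u l ^ (r + 1)) ^ 2 = u l ^ (2 * r + 2) := by
        rw [← rpow_natCast, ← rpow_mul (hu l).le]; congr 1; push_cast; ring
      rw [this]
      exact Finset.single_le_sum (f := fun i => u i ^ (2 * r + 2))
        (fun i _ => (rpow_pos_of_pos (hu i) _).le) (Finset.mem_univ l)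
    nlinarith [hs i, hs j, sq_nonneg (u i ^ (r + 1) - u j ^ (r + 1))]
  calc _ ≤ 1 * ∑ i, ∑ j, β i j * (u i ^ (r + 1) * u j ^ (r + 1)) := by
        apply mul_le_mul_of_nonneg_right
        · apply inv_le_one_of_one_le₀; linarith
        · refine Finset.sum_nonneg fun i _ => Finset.sum_nonneg fun j _ => ?_
          have := hu i; have := hu j; have := hβ i j
          positivity
    _ ≤ _ := by rw [one_mul]; exact h1

lemma sum_sysF_mul {β : Fin m → Fin m → ℝ} {r : ℝ} (hr : 0 < r) (hsym : ∀ i j, β i j = β j i)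
    (u t : Fin m → ℝ) :
    (2 * (r + 1))⁻¹ * ∑ i, ∑ j, β i j * ((r + 1) * u i ^ r * t i * u j ^ (r + 1)
      + u i ^ (r + 1) * ((r + 1) * u j ^ r * t j)) = ∑ i, sysF β r u i * t i := by
  have h2 := sum_swap_symm hsym fun i j => u i ^ r * u j ^ (r + 1) * t i
  have h3 : ∑ i, sysF β r u i * t i = ∑ i, ∑ j, β i j * (u i ^ r * u j ^ (r + 1) * t i) := by
    refine Finset.sum_congr rfl fun i _ => ?_
    rw [sysF, Finset.sum_mul]
    exact Finset.sum_congr rfl fun j _ => by ring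
  have h4 : ∑ i, ∑ j, β i j * ((r + 1) * u i ^ r * t i * u j ^ (r + 1)
      + u i ^ (r + 1) * ((r + 1) * u j ^ r * t j)) =
      (r + 1) * ∑ i, ∑ j, β i j * (u i ^ r * u j ^ (r + 1) * t i)
      + (r + 1) * ∑ i, ∑ j, β i j * (u j ^ r * u i ^ (r + 1) * t j) := by
    simp only [Finset.mul_sum, ← Finset.sum_add_distrib]
    exact Finset.sum_congr rfl fun i _ => Finset.sum_congr rfl fun j _ => by ring
  rw [h4, ← h2, h3]
  field_simp; ring

lemma exists_sigma {N : ℕ} (hN : 1 ≤ N) {p : ℝ} (hp : 0 < p)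
    (hpB : N = 1 ∨ (2 ≤ N ∧ p < ((N : ℝ) * (N + 2)) / ((N : ℝ) - 1) ^ 2)) :
    ∃ σ : ℝ, 0 ≤ σ ∧ 0 < σ * (1 - σ * (((N : ℝ) - 1) / N)) ∧
      0 < σ * (N + 2) / N - ((N : ℝ) - 1) / N * p := by
  rcases hpB with rfl | ⟨h2, h⟩
  · exact ⟨1, by norm_num⟩
  · have h1 : (1 : ℝ) < N := by exact_mod_cast h2
    have h0 : 0 < (N : ℝ) - 1 := by linarith
    have : p * (N - 1) / (N + 2) < N / ((N : ℝ) - 1) := by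
      rw [lt_div_iff₀ (by positivity)] at h
      rw [div_lt_div_iff₀ (by positivity) h0]; nlinarith
    obtain ⟨σ, ha, hb⟩ := exists_between this
    have hσ : 0 < σ := lt_of_le_of_lt (by positivity) ha
    rw [div_lt_iff₀ (by positivity)] at ha
    rw [lt_div_iff₀ h0] at hb
    refine ⟨σ, hσ.le, mul_pos hσ ?_, ?_⟩
    · rw [← mul_div_assoc, sub_pos, div_lt_one (by positivity)]; exact hb
    · rw [← mul_div_right_comm, ← sub_div]; apply div_pos _ (by positivity); linarith
end Algebra

section NullIntegral
/-- Integrable functions with vanishing integral. -/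
def NullInt {V : Type*} [MeasurableSpace V] (μ : Measure V) (f : V → ℝ) : Prop := Integrable f μ ∧ ∫ x, f x ∂μ = 0

variable {V : Type*} [MeasurableSpace V] {μ : Measure V}

lemma NullInt.add {f g : V → ℝ} (hf : NullInt μ f) (hg : NullInt μ g) :
    NullInt μ (fun x => f x + g x) :=
  ⟨hf.1.add hg.1, by rw [integral_add hf.1 hg.1, hf.2, hg.2, add_zero]⟩

lemma NullInt.const_mul {f : V → ℝ} (c : ℝ) (hf : NullInt μ f) :
    NullInt μ (fun x => c * f x) :=
  ⟨hf.1.const_mul c, by rw [integral_const_mul, hf.2, mul_zero]⟩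

lemma NullInt.sum {ι : Type*} (s : Finset ι) {f : ι → V → ℝ} (hf : ∀ i ∈ s, NullInt μ (f i)) :
    NullInt μ (fun x => ∑ i ∈ s, f i x) :=
  ⟨integrable_finsetSum _ fun i hi => (hf i hi).1, by
    rw [integral_finsetSum _ fun i hi => (hf i hi).1]
    exact Finset.sum_eq_zero fun i hi => (hf i hi).2⟩

end NullIntegral

section CoreIntegral
variable {V : Type*} [NormedAddCommGroup V] [NormedSpace ℝ V]

/-- Evaluation at a point, as an algebra homomorphism. -/
noncomputable def smoothEv (x : V) : smoothAlg V →ₐ[ℝ] ℝ :=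
  (Pi.evalAlgHom ℝ (fun _ : V => ℝ) x).comp (smoothAlg V).val

lemma smoothEv_apply (x : V) (f : smoothAlg V) : smoothEv x f = (f : V → ℝ) x := rfl

/-- Real powers of positive smooth functions. -/
noncomputable def smoothRpow (f : smoothAlg V) (hf : ∀ x, 0 < (f : V → ℝ) x) (s : ℝ) : smoothAlg V :=
  ⟨fun x => (f : V → ℝ) x ^ s, (smoothAlg.contDiff f).rpow_const_of_ne fun x => (hf x).ne'⟩

lemma smoothEv_smoothRpow (f : smoothAlg V) (hf : ∀ x, 0 < (f : V → ℝ) x) (s : ℝ) (x : V) :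
    smoothEv x (smoothRpow f hf s) = smoothEv x f ^ s := rfl

lemma smoothEv_smoothD_smoothRpow (f : smoothAlg V) (hf : ∀ x, 0 < (f : V → ℝ) x) (s : ℝ) (x v : V) :
    smoothEv x (smoothD v (smoothRpow f hf s)) =
      s * smoothEv x f ^ (s - 1) * smoothEv x (smoothD v f) := by
  have := dd_comp (h := fun y => y ^ s) (f := (f : V → ℝ)) (x := x)
    ((smoothAlg.contDiff f).differentiable (by simp) x)
    (Real.hasDerivAt_rpow_const (Or.inl (hf x).ne')) v
  exact this

/-- Smooth functions vanishing outside a compact set. -/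
def CptSupp (f : smoothAlg V) : Prop := HasCompactSupport (f : V → ℝ)

lemma CptSupp.mul_right {f : smoothAlg V} (hf : CptSupp f) (g : smoothAlg V) : CptSupp (f * g) :=
  HasCompactSupport.mul_right (f := (f : V → ℝ)) (f' := (g : V → ℝ)) hf

lemma CptSupp.mul_left {f : smoothAlg V} (hf : CptSupp f) (g : smoothAlg V) : CptSupp (g * f) := by
  rw [mul_comm]; exact hf.mul_right g

lemma CptSupp.smoothD {f : smoothAlg V} (hf : CptSupp f) (v : V) : CptSupp (smoothD v f) :=
  HasCompactSupport.dd hf v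

lemma CptSupp.sub {f g : smoothAlg V} (hf : CptSupp f) (hg : CptSupp g) : CptSupp (f - g) := by
  change HasCompactSupport ((f : V → ℝ) - (g : V → ℝ))
  rw [sub_eq_add_neg]
  exact HasCompactSupport.add hf (HasCompactSupport.neg hg)

lemma CptSupp.bounded {f : smoothAlg V} (hf : CptSupp f) :
    ∃ C : ℝ, ∀ x, |smoothEv x f| ≤ C := by
  obtain ⟨C, hC⟩ := (smoothAlg.contDiff f).continuous.bounded_above_of_compact_support hf
  exact ⟨C, fun x => by simpa [smoothEv_apply] using hC x⟩

variable [MeasurableSpace V] [BorelSpace V] [FiniteDimensional ℝ V] {μ : Measure V}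
  [μ.IsAddHaarMeasure]

lemma CptSupp.nullInt {f : smoothAlg V} (hf : CptSupp f) (v : V) :
    NullInt μ (fun x => smoothEv x (_root_.smoothD v f)) :=
  ⟨(smoothAlg.contDiff _).continuous.integrable_of_hasCompactSupport (hf.smoothD v),
    integral_dd_eq_zero ((smoothAlg.contDiff f).of_le (by simp)) hf v⟩

omit [MeasurableSpace V] [BorelSpace V] [FiniteDimensional ℝ V] in
lemma cutoff_bounds {N : ℕ} (e : Fin N → V) (τ : V) (ζ : smoothAlg V) (hζ : CptSupp ζ)
    (h0 : ∀ x, 0 ≤ (ζ : V → ℝ) x) (h1 : ∀ x, (ζ : V → ℝ) x ≤ 1) (k : ℕ) (hk : 2 ≤ k) :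
    ∃ M : ℝ, 0 ≤ M ∧ ∀ x,
      |∑ a, smoothEv x (smoothD (e a) (smoothD (e a) (ζ ^ k)))| ≤ M * (smoothEv x ζ) ^ (k - 2) ∧
      |smoothEv x (smoothD τ (ζ ^ k))| ≤ M * (smoothEv x ζ) ^ (k - 1) ∧
      ∑ a, smoothEv x (smoothD (e a) (ζ ^ k)) ^ 2 ≤ M * (smoothEv x ζ) ^ (2 * k - 2) := by
  obtain ⟨A, hA⟩ := (hζ.smoothD τ).bounded
  choose Bd hBd using fun a => (hζ.smoothD (e a)).bounded
  choose Cd hCd using fun a => ((hζ.smoothD (e a)).smoothD (e a)).bounded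
  obtain ⟨l, rfl⟩ : ∃ l, k = l + 2 := ⟨k - 2, by omega⟩
  have hB2 : ∀ a x, smoothEv x (smoothD (e a) ζ) ^ 2 ≤ Bd a ^ 2 := fun a x => by
    rw [← sq_abs]; exact pow_le_pow_left₀ (abs_nonneg _) (hBd a x) 2
  let K : ℝ := l + 2
  have hK : 0 ≤ K := by positivity
  let M1 := ∑ a, (K * K * Bd a ^ 2 + K * |Cd a|)
  let M3 := ∑ a, K ^ 2 * Bd a ^ 2
  have hM1 : 0 ≤ M1 := Finset.sum_nonneg fun a _ => by positivity
  have hM3 : 0 ≤ M3 := Finset.sum_nonneg fun a _ => by positivity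
  have d1 : ∀ v x, smoothEv x (smoothD v (ζ ^ (l + 2))) =
      K * (smoothEv x ζ ^ (l + 1) * smoothEv x (smoothD v ζ)) := by
    intro v x
    simp only [Derivation.leibniz_pow, map_mul, map_pow, smul_eq_mul, nsmul_eq_mul,
      map_natCast, K]
    push_cast; simp
  have d2 : ∀ v x, smoothEv x (smoothD v (smoothD v (ζ ^ (l + 2)))) =
      K * ((l + 1) * (smoothEv x ζ ^ l * smoothEv x (smoothD v ζ) ^ 2)
        + smoothEv x ζ ^ (l + 1) * smoothEv x (smoothD v (smoothD v ζ))) := by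
    intro v x
    simp only [Derivation.leibniz_pow, Derivation.leibniz, map_mul, map_pow, smul_eq_mul, nsmul_eq_mul,
      map_natCast, map_add, Derivation.map_natCast, K]
    push_cast; simp only [map_zero]; ring
  refine ⟨M1 + K * |A| + M3, by positivity, fun x => ?_⟩
  have z0 : 0 ≤ smoothEv x ζ := h0 x
  have z1 : smoothEv x ζ ≤ 1 := h1 x
  refine ⟨?_, ?_, ?_⟩
  · calc _ ≤ ∑ a, |smoothEv x (smoothD (e a) (smoothD (e a) (ζ ^ (l+2))))| :=
          Finset.abs_sum_le_sum_abs _ _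
      _ ≤ ∑ a, (K * K * Bd a ^ 2 + K * |Cd a|) * smoothEv x ζ ^ l := by
          refine Finset.sum_le_sum fun a _ => ?_
          rw [d2, abs_mul, abs_of_nonneg hK, add_mul _ _ (smoothEv x ζ ^ l)]
          refine (mul_le_mul_of_nonneg_left (abs_add_le _ _) hK).trans ?_
          rw [mul_add]
          apply add_le_add
          · rw [mul_assoc, mul_assoc]
            apply mul_le_mul_of_nonneg_left _ hK
            rw [abs_of_nonneg (by positivity), mul_comm (Bd a ^ 2)]
            have : (l : ℝ) + 1 ≤ K := by simp only [K]; linarith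
            have := hB2 a x
            gcongr
          · rw [mul_assoc]
            apply mul_le_mul_of_nonneg_left _ hK
            rw [abs_mul, abs_of_nonneg (by positivity), mul_comm]
            apply mul_le_mul ((hCd a x).trans (le_abs_self _)) _ (by positivity) (abs_nonneg _)
            rw [pow_succ]; exact mul_le_of_le_one_right (by positivity) z1
      _ = M1 * smoothEv x ζ ^ l := by rw [Finset.sum_mul]
      _ ≤ _ := by
          rw [Nat.add_sub_cancel]
          gcongr
          have : 0 ≤ K * |A| := by positivity
          linarith
  · rw [d1, abs_mul, abs_of_nonneg hK, abs_mul, abs_of_nonneg (by positivity : 0 ≤ smoothEv x ζ ^ (l+1))]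
    rw [show l + 2 - 1 = l + 1 by omega]
    calc _ ≤ K * (smoothEv x ζ ^ (l + 1) * |A|) := by
          exact mul_le_mul_of_nonneg_left (mul_le_mul_of_nonneg_left
            ((hA x).trans (le_abs_self _)) (by positivity)) hK
      _ = K * |A| * smoothEv x ζ ^ (l + 1) := by ring
      _ ≤ _ := by gcongr; linarith
  · rw [show 2 * (l + 2) - 2 = 2 * (l + 1) by omega]
    calc _ ≤ ∑ a, K ^ 2 * Bd a ^ 2 * smoothEv x ζ ^ (2 * (l + 1)) := by
          refine Finset.sum_le_sum fun a _ => ?_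
          rw [d1, mul_pow, mul_pow, ← pow_mul, mul_comm (l+1) 2, mul_assoc, mul_comm (Bd a ^ 2)]
          have := hB2 a x
          gcongr
      _ = M3 * smoothEv x ζ ^ (2 * (l + 1)) := by rw [Finset.sum_mul]
      _ ≤ _ := by
        gcongr
        have : 0 ≤ K * |A| := by positivity
        linarith
end CoreIntegral

section
variable {V : Type*} [NormedAddCommGroup V] [NormedSpace ℝ V]
  [MeasurableSpace V] [BorelSpace V] [FiniteDimensional ℝ V] {μ : Measure V}
  [μ.IsAddHaarMeasure]

/-- The nonlinearity as a smooth function. -/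
noncomputable def smoothF {m : ℕ} (β : Fin m → Fin m → ℝ) (r : ℝ) (u : Fin m → smoothAlg V)
    (hu : ∀ i x, 0 < (u i : V → ℝ) x) (i : Fin m) : smoothAlg V :=
  ∑ j, β i j • (smoothRpow (u i) (hu i) r * smoothRpow (u j) (hu j) (r + 1))

/-- The potential as a smooth function. -/
noncomputable def smoothPot {m : ℕ} (β : Fin m → Fin m → ℝ) (r : ℝ) (u : Fin m → smoothAlg V)
    (hu : ∀ i x, 0 < (u i : V → ℝ) x) : smoothAlg V :=
  (2 * (r + 1))⁻¹ • ∑ i, ∑ j, β i j • (smoothRpow (u i) (hu i) (r + 1) * smoothRpow (u j) (hu j) (r + 1))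

omit [MeasurableSpace V] [BorelSpace V] [FiniteDimensional ℝ V] in
lemma smoothEv_smoothF {m : ℕ} (β : Fin m → Fin m → ℝ) (r : ℝ) (u : Fin m → smoothAlg V)
    (hu : ∀ i x, 0 < (u i : V → ℝ) x) (i : Fin m) (x : V) :
    smoothEv x (smoothF β r u hu i) = sysF β r (fun j => smoothEv x (u j)) i := by
  simp only [smoothF, sysF, map_sum, map_smul, map_mul, smoothEv_smoothRpow, smul_eq_mul, mul_assoc]

omit [MeasurableSpace V] [BorelSpace V] [FiniteDimensional ℝ V] in
lemma smoothEv_smoothPot {m : ℕ} (β : Fin m → Fin m → ℝ) (r : ℝ) (u : Fin m → smoothAlg V)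
    (hu : ∀ i x, 0 < (u i : V → ℝ) x) (x : V) :
    smoothEv x (smoothPot β r u hu) = sysPot β r (fun j => smoothEv x (u j)) := by
  simp only [smoothPot, sysPot, map_sum, map_smul, map_mul, smoothEv_smoothRpow, smul_eq_mul]

omit [MeasurableSpace V] [BorelSpace V] [FiniteDimensional ℝ V] in
lemma smoothEv_smoothD_smoothF {m : ℕ} (β : Fin m → Fin m → ℝ) (r : ℝ) (u : Fin m → smoothAlg V)
    (hu : ∀ i x, 0 < (u i : V → ℝ) x) (i : Fin m) (x v : V) :
    smoothEv x (smoothD v (smoothF β r u hu i)) =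
      ∑ j, β i j * (r * smoothEv x (u i) ^ (r - 1) * smoothEv x (smoothD v (u i)) *
        smoothEv x (u j) ^ (r + 1) + smoothEv x (u i) ^ r * ((r + 1) * smoothEv x (u j) ^ r *
          smoothEv x (smoothD v (u j)))) := by
  simp only [smoothF, map_sum, map_smul, Derivation.leibniz, Derivation.map_smul, map_add, map_mul,
    smoothEv_smoothRpow, smul_eq_mul, smoothEv_smoothD_smoothRpow, add_sub_cancel_right]
  exact Finset.sum_congr rfl fun j _ => by ring

omit [MeasurableSpace V] [BorelSpace V] [FiniteDimensional ℝ V] in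
lemma smoothEv_smoothD_smoothPot {m : ℕ} {β : Fin m → Fin m → ℝ} {r : ℝ} (hr : 0 < r)
    (hsym : ∀ i j, β i j = β j i) (u : Fin m → smoothAlg V)
    (hu : ∀ i x, 0 < (u i : V → ℝ) x) (x v : V) :
    smoothEv x (smoothD v (smoothPot β r u hu)) =
      ∑ i, sysF β r (fun j => smoothEv x (u j)) i * smoothEv x (smoothD v (u i)) := by
  rw [← sum_sysF_mul hr hsym]
  simp only [smoothPot, map_sum, map_smul, Derivation.leibniz, Derivation.map_smul, map_add, map_mul,
    smoothEv_smoothRpow, smul_eq_mul, smoothEv_smoothD_smoothRpow, add_sub_cancel_right]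
  congr 1
  exact Finset.sum_congr rfl fun i _ => Finset.sum_congr rfl fun j _ => by ring

set_option maxHeartbeats 1000000 in
/-- The integral estimate for positive smooth functions which solve the system up to an error. -/
lemma core_integral {N m : ℕ} (hN : 1 ≤ N) (hm : 0 < m) {r : ℝ} (hr : 0 < r)
    {β : Fin m → Fin m → ℝ} (hsym : ∀ i j, β i j = β j i) (hβ : ∀ i j, 0 ≤ β i j)
    (hdiag : ∀ i, 0 < β i i)
    (hpB : N = 1 ∨ (2 ≤ N ∧ 2 * r + 1 < ((N : ℝ) * (N + 2)) / ((N : ℝ) - 1) ^ 2))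
    (e : Fin N → V) (τ : V) (ζ : smoothAlg V) (hζ : CptSupp ζ)
    (h0 : ∀ x, 0 ≤ (ζ : V → ℝ) x) (h1 : ∀ x, (ζ : V → ℝ) x ≤ 1) (k : ℕ)
    (hk : 2 * (2 * r + 1) / r ≤ k) :
    ∃ C : ℝ, 0 ≤ C ∧ ∀ u : Fin m → smoothAlg V, (∀ i x, 0 < (u i : V → ℝ) x) →
      ∫ x, ∑ i, (ζ : V → ℝ) x ^ k * sysF β r (fun j => (u j : V → ℝ) x) i ^ 2 ∂μ ≤
        C * (1 + ∫ x, ∑ i, (ζ : V → ℝ) x ^ k * ((smoothD τ (u i) : V → ℝ) x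
          - ∑ a, (smoothD (e a) (smoothD (e a) (u i)) : V → ℝ) x
          - sysF β r (fun j => (u j : V → ℝ) x) i) ^ 2 ∂μ) := by
  have hk4 : 4 < k := by
    have : (4 : ℝ) < 2 * (2 * r + 1) / r := by rw [lt_div_iff₀ hr]; linarith
    exact_mod_cast this.trans_le hk
  obtain ⟨σ, hσ, hκ, hω⟩ := exists_sigma hN (show 0 < 2 * r + 1 by linarith) hpB
  obtain ⟨M, hM, hMb⟩ := cutoff_bounds e τ ζ hζ h0 h1 k (by omega)
  have hb : ∃ b, 0 < b ∧ ∀ i, b ≤ β i i := by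
    have : Nonempty (Fin m) := ⟨⟨0, hm⟩⟩
    obtain ⟨i0, hi0⟩ := Finite.exists_min fun i => β i i
    exact ⟨_, hdiag i0, hi0⟩
  obtain ⟨b, hb, hbβ⟩ := hb
  have hB : 0 ≤ ∑ i, ∑ j, β i j := Finset.sum_nonneg fun i _ => Finset.sum_nonneg fun j _ => hβ i j
  have hθ : 0 ≤ ((N : ℝ) - 1) / N := by
    have : (1 : ℝ) ≤ N := by exact_mod_cast hN
    apply div_nonneg <;> linarith
  obtain ⟨C, l1, l2, l4, l5, l6, hC, H⟩ := core_pointwise (σ := σ) hκ hθ hσ hr hω hb hB hM m k hk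
  set W : ℝ := ∫ x, (if smoothEv x ζ = 0 then 0 else 1) ∂μ with hW
  have hWi : Integrable (fun x => if smoothEv x ζ = 0 then (0:ℝ) else 1) μ := by
    have hms : MeasurableSet (Function.support (ζ : V → ℝ)) :=
      (smoothAlg.contDiff ζ).continuous.isOpen_support.measurableSet
    have hfin : μ (Function.support (ζ : V → ℝ)) < ⊤ :=
      (measure_mono (subset_tsupport _)).trans_lt (IsCompact.measure_lt_top hζ)
    have : (fun x => if smoothEv x ζ = 0 then (0:ℝ) else 1) =
        (Function.support (ζ : V → ℝ)).indicator 1 := by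
      ext x
      by_cases hx : smoothEv x ζ = 0
      · rw [if_pos hx, indicator_of_notMem]; simpa [smoothEv_apply] using hx
      · rw [if_neg hx, indicator_of_mem, Pi.one_apply]; simpa [smoothEv_apply] using hx
    rw [this]
    exact (integrable_indicator_iff hms).2 (integrableOn_const hfin.ne)
  have hW0 : 0 ≤ W := integral_nonneg fun x => by dsimp only; split_ifs <;> norm_num
  refine ⟨C * (W + 1), by positivity, fun u hu => ?_⟩
  let φ : smoothAlg V := ζ ^ k
  have hφ : CptSupp φ := by
    obtain ⟨l, rfl⟩ : ∃ l, k = l + 1 := ⟨k - 1, by omega⟩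
    change CptSupp (ζ ^ (l + 1))
    rw [pow_succ]; exact hζ.mul_left _
  let D : Fin N → Derivation ℝ (smoothAlg V) (smoothAlg V) := fun a => smoothD (e a)
  let T : Derivation ℝ (smoothAlg V) (smoothAlg V) := smoothD τ
  have hDD : ∀ a b f, D a (D b f) = D b (D a f) := fun a b f => smoothD_comm _ _ _
  have hDT : ∀ a f, D a (T f) = T (D a f) := fun a f => smoothD_comm _ _ _
  let F : Fin m → smoothAlg V := smoothF β r u hu
  let Φ : smoothAlg V := smoothPot β r u hu
  let q : Fin m → smoothAlg V := fun i => smoothRpow (u i) (hu i) (-1)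
  have hq : ∀ i, q i * u i = 1 := by
    intro i; ext x
    change (u i : V → ℝ) x ^ (-1 : ℝ) * (u i : V → ℝ) x = 1
    rw [rpow_neg_one, inv_mul_cancel₀ (hu i x).ne']
  have hqe : ∀ i x, smoothEv x (q i) = (smoothEv x (u i))⁻¹ := by
    intro i x
    exact rpow_neg_one _
  -- values at a point
  let z1 : Fin m → smoothAlg V := fun i => ∑ a, D a (φ * D a (∑ b, D b (u i) * D b (u i))
    - 2 * (φ * (∑ b, D b (D b (u i))) * D a (u i)) - (∑ b, D b (u i) * D b (u i)) * D a φ)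
  let z2 : Fin m → smoothAlg V := fun i => ∑ a, D a (φ * q i * (∑ b, D b (u i) * D b (u i)) * D a (u i))
  let z4 : Fin m → smoothAlg V := fun i => ∑ a, D a (φ * F i * D a (u i))
  let z6 : Fin m → smoothAlg V := fun i =>
    2 * ∑ a, D a (φ * T (u i) * D a (u i)) - T (φ * ∑ b, D b (u i) * D b (u i))
  let z5 : smoothAlg V := T (φ * Φ)
  have two : ∀ x : V, smoothEv x (2 : smoothAlg V) = 2 := fun x => map_ofNat _ 2
  have n1 : ∀ i, NullInt μ fun x => smoothEv x (z1 i) := by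
    intro i
    simp only [z1, map_sum]
    refine NullInt.sum _ fun a _ => CptSupp.nullInt ?_ _
    exact ((hφ.mul_right _).sub (((hφ.mul_right _).mul_right _).mul_left _)).sub
      ((hφ.smoothD _).mul_left _)
  have n2 : ∀ i, NullInt μ fun x => smoothEv x (z2 i) := by
    intro i
    simp only [z2, map_sum]
    exact NullInt.sum _ fun a _ => CptSupp.nullInt (((hφ.mul_right _).mul_right _).mul_right _) _
  have n4 : ∀ i, NullInt μ fun x => smoothEv x (z4 i) := by
    intro i
    simp only [z4, map_sum]
    exact NullInt.sum _ fun a _ => CptSupp.nullInt ((hφ.mul_right _).mul_right _) _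
  have n5 : NullInt μ fun x => smoothEv x z5 := CptSupp.nullInt (hφ.mul_right _) _
  have n6 : ∀ i, NullInt μ fun x => smoothEv x (z6 i) := by
    intro i
    have h := ((NullInt.sum Finset.univ fun a (_ : a ∈ Finset.univ) => CptSupp.nullInt (μ := μ)
      ((hφ.mul_right (T (u i))).mul_right (D a (u i))) (e a)).const_mul 2).add
      ((CptSupp.nullInt (μ := μ) (hφ.mul_right (∑ b, D b (u i) * D b (u i))) τ).const_mul (-1))
    convert h using 2 with x
    simp only [z6, map_sub, map_mul, two, map_sum]
    simp only [D, T]; ring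
  have hpt : ∀ x, ∑ i, smoothEv x ζ ^ k * sysF β r (fun j => smoothEv x (u j)) i ^ 2 ≤
      (l1 / 2 * ∑ i, smoothEv x (z1 i) + (l2 / 2 * ∑ i, smoothEv x (z2 i)
        + (l4 * ∑ i, smoothEv x (z4 i) + (l5 * smoothEv x z5 + l6 / 2 * ∑ i, smoothEv x (z6 i)))))
      + C * (∑ i, smoothEv x ζ ^ k * (smoothEv x (T (u i)) - ∑ a, smoothEv x (D a (D a (u i)))
          - sysF β r (fun j => smoothEv x (u j)) i) ^ 2 + if smoothEv x ζ = 0 then 0 else 1) := by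
    intro x
    have hux : ∀ i, 0 < smoothEv x (u i) := fun i => hu i x
    have hζx : 0 ≤ smoothEv x ζ := h0 x
    obtain ⟨hb1, hb2, hb3⟩ := hMb x
    let v : Fin m → Fin N → ℝ := fun i a => smoothEv x (D a (u i))
    let g : Fin m → ℝ := fun i => ∑ a, v i a ^ 2
    let Δ : Fin m → ℝ := fun i => ∑ a, smoothEv x (D a (D a (u i)))
    let c : Fin N → ℝ := fun a => smoothEv x (D a φ)
    let d : Fin m → ℝ := fun i => ∑ a, v i a * c a
    let H2 : Fin m → Fin N → Fin N → ℝ := fun i a b => smoothEv x (D a (D b (u i)))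
    let Lφ : ℝ := ∑ a, smoothEv x (D a (D a φ))
    let ut : Fin m → ℝ := fun i => smoothEv x (T (u i))
    let Fx : Fin m → ℝ := fun i => sysF β r (fun j => smoothEv x (u j)) i
    let P : Fin m → ℝ := fun i => ∑ a, smoothEv x (D a (F i)) * v i a
    have hgg : ∀ i, ∑ b, smoothEv x (D b (u i)) * smoothEv x (D b (u i)) = g i := fun i =>
      Finset.sum_congr rfl fun a _ => by simp only [v, sq]
    have e1 : ∀ i, smoothEv x (z1 i) = 2 * (smoothEv x ζ ^ k * (∑ a, ∑ b, H2 i a b ^ 2)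
        - smoothEv x ζ ^ k * Δ i ^ 2 - Δ i * d i - g i * Lφ / 2) := by
      intro i
      have := congrArg (smoothEv x) (bochner_divergence D hDD φ (u i))
      simp only [z1]
      rw [this]
      simp only [map_sub, map_mul, two, map_sum, hgg]
      simp only [φ, map_pow, ← sq, Δ, d, Lφ, v, c, H2]; ring
    have e2 : ∀ i, smoothEv x (z2 i) = 2 * (smoothEv x ζ ^ k *
        ((∑ a, ∑ b, H2 i a b * v i a * v i b) / smoothEv x (u i))
        + smoothEv x ζ ^ k * (g i / smoothEv x (u i)) * Δ i / 2
        - smoothEv x ζ ^ k * (g i / smoothEv x (u i)) ^ 2 / 2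
        + (g i / smoothEv x (u i)) * d i / 2) := by
      intro i
      have := congrArg (smoothEv x) (weighted_gradient_divergence D φ (u i) (q i) (hq i))
      simp only [z2]
      rw [this]
      simp only [map_add, map_sub, map_mul, two, map_sum, hgg, hqe]
      simp only [φ, map_pow, Δ, d, v, c, H2]; ring
    have e4 : ∀ i, smoothEv x (z4 i) = smoothEv x ζ ^ k * (Fx i * Δ i) + smoothEv x ζ ^ k * P i
        + Fx i * d i := by
      intro i
      have := congrArg (smoothEv x) (flux_divergence D φ (u i) (F i))
      simp only [z4]
      rw [this]
      simp only [map_add, map_mul, map_sum]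
      rw [show smoothEv x (F i) = Fx i from smoothEv_smoothF β r u hu i x]
      simp only [φ, map_pow, Δ, d, v, c, P]; ring
    have e5 : smoothEv x z5 = ∑ i, smoothEv x ζ ^ k * (Fx i * ut i)
        + sysPot β r (fun j => smoothEv x (u j)) * smoothEv x (T φ) := by
      simp only [z5, Derivation.leibniz, map_add, smul_eq_mul, map_mul]
      rw [show smoothEv x (T Φ) = _ from smoothEv_smoothD_smoothPot hr hsym u hu x τ,
        show smoothEv x Φ = _ from smoothEv_smoothPot β r u hu x, ← Finset.mul_sum]
      simp only [φ, map_pow, Fx, ut, T]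
    have e6 : ∀ i, smoothEv x (z6 i) = 2 * (smoothEv x ζ ^ k * (ut i * Δ i) + ut i * d i
        - g i * smoothEv x (T φ) / 2) := by
      intro i
      have := congrArg (smoothEv x) (energy_divergence D T hDT φ (u i))
      simp only [z6]
      rw [this]
      simp only [map_add, map_sub, map_mul, two, map_sum, hgg]
      simp only [φ, map_pow, Δ, d, v, c, ut]; ring
    have key := H (smoothEv x ζ) (smoothEv x (T φ)) Lφ (sysPot β r (fun j => smoothEv x (u j)))
      (fun i => smoothEv x (u i)) g Δ d ut Fx P
      (fun i => smoothEv x ζ ^ k * (∑ a, ∑ b, H2 i a b ^ 2)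
        - smoothEv x ζ ^ k * Δ i ^ 2 - Δ i * d i - g i * Lφ / 2)
      (fun i => smoothEv x ζ ^ k *
        ((∑ a, ∑ b, H2 i a b * v i a * v i b) / smoothEv x (u i))
        + smoothEv x ζ ^ k * (g i / smoothEv x (u i)) * Δ i / 2
        - smoothEv x ζ ^ k * (g i / smoothEv x (u i)) ^ 2 / 2
        + (g i / smoothEv x (u i)) * d i / 2) hζx (h1 x) hb1 hb2 hux
      (fun i => Finset.sum_nonneg fun a _ => sq_nonneg _)
      (fun i => (Finset.sum_mul_sq_le_sq_mul_sq Finset.univ _ _).trans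
        (mul_le_mul_of_nonneg_left hb3 (Finset.sum_nonneg fun a _ => sq_nonneg _)))
      (fun i => le_sysF hβ hux i (hbβ i)) (abs_sysPot_le hr hβ hux)
      (by
        simp only [P, F]
        have := sum_grad_sysF_le hr hsym hβ hux v
        refine le_trans (le_of_eq ?_) this
        refine Finset.sum_congr rfl fun i _ => Finset.sum_congr rfl fun a _ => ?_
        congr 1
        exact smoothEv_smoothD_smoothF β r u hu i x (e a))
      (fun i => bernstein_pointwise hN (pow_nonneg hζx k) (u := (u i).1 x) (H2 i) (v i) c Lφ)
    refine key.trans (le_of_eq ?_)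
    simp only [e1, e2, e4, e5, e6, ← Finset.mul_sum]
    simp only [Fx, ut, Δ]
    ring
  have nZ := ((NullInt.sum Finset.univ fun i _ => n1 i).const_mul (l1 / 2)).add
    (((NullInt.sum Finset.univ fun i _ => n2 i).const_mul (l2 / 2)).add
    (((NullInt.sum Finset.univ fun i _ => n4 i).const_mul l4).add
    ((n5.const_mul l5).add ((NullInt.sum Finset.univ fun i _ => n6 i).const_mul (l6 / 2)))))
  let eA : Fin m → smoothAlg V := fun i => T (u i) - ∑ a, D a (D a (u i)) - F i
  have hcs : ∀ f : Fin m → smoothAlg V,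
      Integrable (fun x => ∑ i, smoothEv x ζ ^ k * smoothEv x (f i) ^ 2) μ := by
    intro f
    have : (fun x => ∑ i, smoothEv x ζ ^ k * smoothEv x (f i) ^ 2) =
        fun x => ∑ i, ((φ * f i ^ 2 : smoothAlg V) : V → ℝ) x := by
      ext x
      refine Finset.sum_congr rfl fun i _ => ?_
      rw [← smoothEv_apply, map_mul, map_pow, map_pow]
    rw [this]
    exact integrable_finsetSum _ fun i _ =>
      (smoothAlg.contDiff _).continuous.integrable_of_hasCompactSupport (hφ.mul_right _)
  have i1 := hcs F
  have i2 := hcs eA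
  have eF : ∀ i x, smoothEv x (F i) = sysF β r (fun j => smoothEv x (u j)) i := fun i x =>
    smoothEv_smoothF β r u hu i x
  simp only [eF] at i1
  simp only [eA, map_sub, map_sum, eF] at i2
  have i3 := (i2.fun_add hWi).const_mul C
  have hint := integral_mono i1 (nZ.1.fun_add i3) hpt
  rw [integral_add nZ.1 i3, nZ.2, zero_add, integral_const_mul, integral_add i2 hWi] at hint
  refine hint.trans ?_
  change _ ≤ C * (W + 1) * (1 + ∫ x, ∑ i, smoothEv x ζ ^ k * (smoothEv x (T (u i))
    - ∑ a, smoothEv x (D a (D a (u i))) - sysF β r (fun j => smoothEv x (u j)) i) ^ 2 ∂μ)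
  have hE : 0 ≤ ∫ x, ∑ i, smoothEv x ζ ^ k * (smoothEv x (T (u i))
    - ∑ a, smoothEv x (D a (D a (u i))) - sysF β r (fun j => smoothEv x (u j)) i) ^ 2 ∂μ :=
    integral_nonneg fun x => Finset.sum_nonneg fun i _ =>
      mul_nonneg (pow_nonneg (h0 x) _) (sq_nonneg _)
  rw [← hW, mul_assoc]
  apply mul_le_mul_of_nonneg_left _ hC
  nlinarith [mul_nonneg hW0 hE]
end

open scoped Topology
open Filter (Tendsto)

section WeakFormulation
variable {N : ℕ}
local notation "𝔼" => EuclideanSpace ℝ (Fin N)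

/-- Functions on `closedBall x₀ ρ × J` which are bounded and separately continuous. -/
structure SepCont (f : 𝔼 → ℝ → ℝ) (x₀ : 𝔼) (ρ : ℝ) (J : Set ℝ) : Prop where
  bdd : ∃ K, ∀ y ∈ closedBall x₀ ρ, ∀ t ∈ J, |f y t| ≤ K
  space : ∀ t ∈ J, ContinuousOn (fun y => f y t) (closedBall x₀ ρ)
  time : ∀ y ∈ closedBall x₀ ρ, ContinuousOn (f y) J

lemma SepCont.mono {f : 𝔼 → ℝ → ℝ} {x₀ x₁ : 𝔼} {ρ ρ' : ℝ} {J J' : Set ℝ} (h : SepCont f x₀ ρ J)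
    (hρ : closedBall x₁ ρ' ⊆ closedBall x₀ ρ) (hJ : J' ⊆ J) : SepCont f x₁ ρ' J' := by
  obtain ⟨K, hK⟩ := h.bdd
  exact ⟨⟨K, fun y hy t ht => hK y (hρ hy) t (hJ ht)⟩,
    fun t ht => (h.space t (hJ ht)).mono hρ, fun y hy => (h.time y (hρ hy)).mono hJ⟩

/-- Nonnegative test functions with support in `closedBall x₀ ρ`, together with their time
derivative and Laplacian. -/
structure IsTest (x₀ : 𝔼) (ρ t₁ t₂ : ℝ) (η ηt ηL : 𝔼 → ℝ → ℝ) : Prop where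
  cont : ContinuousOn (Function.uncurry η) (univ ×ˢ Icc t₁ t₂)
  cont_t : ContinuousOn (Function.uncurry ηt) (univ ×ˢ Icc t₁ t₂)
  cont_L : ContinuousOn (Function.uncurry ηL) (univ ×ˢ Icc t₁ t₂)
  nonneg : ∀ y, ∀ t ∈ Icc t₁ t₂, 0 ≤ η y t
  supp : ∀ y ∉ closedBall x₀ ρ, ∀ t ∈ Icc t₁ t₂, η y t = 0
  supp_t : ∀ y ∉ closedBall x₀ ρ, ∀ t ∈ Icc t₁ t₂, ηt y t = 0
  supp_L : ∀ y ∉ closedBall x₀ ρ, ∀ t ∈ Icc t₁ t₂, ηL y t = 0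
  hasDeriv : ∀ y, ∀ t ∈ Icc t₁ t₂, HasDerivAt (η y) (ηt y t) t
  smooth : ∀ t ∈ Icc t₁ t₂, ContDiff ℝ 2 fun y => η y t
  lap_eq : ∀ t ∈ Icc t₁ t₂, ∀ y, lap (fun y => η y t) y = ηL y t

lemma IsTest.mono {x₀ : 𝔼} {ρ t₁ t₂ s₁ s₂ : ℝ} {η ηt ηL : 𝔼 → ℝ → ℝ}
    (h : IsTest x₀ ρ t₁ t₂ η ηt ηL) (hs : Icc s₁ s₂ ⊆ Icc t₁ t₂) : IsTest x₀ ρ s₁ s₂ η ηt ηL where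
  cont := h.cont.mono (prod_mono_right hs)
  cont_t := h.cont_t.mono (prod_mono_right hs)
  cont_L := h.cont_L.mono (prod_mono_right hs)
  nonneg y t ht := h.nonneg y t (hs ht)
  supp y hy t ht := h.supp y hy t (hs ht)
  supp_t y hy t ht := h.supp_t y hy t (hs ht)
  supp_L y hy t ht := h.supp_L y hy t (hs ht)
  hasDeriv y t ht := h.hasDeriv y t (hs ht)
  smooth t ht := h.smooth t (hs ht)
  lap_eq t ht := h.lap_eq t (hs ht)

lemma integrable_of_continuousOn_closedBall {f : 𝔼 → ℝ} {x₀ : 𝔼} {ρ : ℝ}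
    (hf : ContinuousOn f (closedBall x₀ ρ)) (h0 : ∀ y ∉ closedBall x₀ ρ, f y = 0) :
    Integrable f := by
  have := hf.integrableOn_compact (μ := volume) (isCompact_closedBall x₀ ρ)
  refine (integrableOn_iff_integrable_of_support_subset fun y hy => ?_).1 this
  by_contra h
  exact hy (h0 y h)

lemma SepCont.integrable_mul {f η : 𝔼 → ℝ → ℝ} {x₀ : 𝔼} {ρ : ℝ} {J : Set ℝ}
    (hf : SepCont f x₀ ρ J) (hη : ContinuousOn (Function.uncurry η) (univ ×ˢ J))
    (hs : ∀ y ∉ closedBall x₀ ρ, ∀ t ∈ J, η y t = 0) {t : ℝ} (ht : t ∈ J) :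
    Integrable fun y => f y t * η y t := by
  refine integrable_of_continuousOn_closedBall (x₀ := x₀) (ρ := ρ) ((hf.space t ht).mul ?_)
    fun y hy => by rw [hs y hy t ht, mul_zero]
  exact (hη.comp (f := fun y : 𝔼 => (y, t)) (by fun_prop) (s := univ)
    (fun y _ => ⟨mem_univ _, ht⟩)).mono (subset_univ _)

lemma exists_bound_of_continuousOn {η : 𝔼 → ℝ → ℝ} {x₀ : 𝔼} {ρ : ℝ} {J : Set ℝ} (hJ : IsCompact J)
    (hη : ContinuousOn (Function.uncurry η) (univ ×ˢ J))
    (hs : ∀ y ∉ closedBall x₀ ρ, ∀ t ∈ J, η y t = 0) :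
    ∃ K, 0 ≤ K ∧ ∀ y, ∀ t ∈ J, |η y t| ≤ (closedBall x₀ ρ).indicator (fun _ => K) y := by
  obtain ⟨K, hK⟩ := ((isCompact_closedBall x₀ ρ).prod hJ).exists_bound_of_continuousOn
    (hη.mono (prod_mono_left (subset_univ _)))
  refine ⟨|K|, abs_nonneg _, fun y t ht => ?_⟩
  by_cases hy : y ∈ closedBall x₀ ρ
  · rw [indicator_of_mem hy]
    exact (hK (y, t) ⟨hy, ht⟩).trans (le_abs_self _)
  · rw [indicator_of_notMem hy, hs y hy t ht, abs_zero]

lemma integrable_indicator_closedBall (x₀ : 𝔼) (ρ K : ℝ) :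
    Integrable ((closedBall x₀ ρ).indicator (fun _ => K)) :=
  (integrable_indicator_iff isClosed_closedBall.measurableSet).2
    (integrableOn_const (isCompact_closedBall x₀ ρ).measure_lt_top.ne)

lemma continuousOn_snd_of_uncurry {η : 𝔼 → ℝ → ℝ} {J : Set ℝ}
    (hη : ContinuousOn (Function.uncurry η) (univ ×ˢ J)) (y : 𝔼) : ContinuousOn (η y) J :=
  hη.comp (f := fun t : ℝ => (y, t)) (by fun_prop) (fun t ht => ⟨mem_univ _, ht⟩)

lemma SepCont.continuousOn_integral {f η : 𝔼 → ℝ → ℝ} {x₀ : 𝔼} {ρ : ℝ} {J : Set ℝ}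
    (hJ : IsCompact J)
    (hf : SepCont f x₀ ρ J) (hη : ContinuousOn (Function.uncurry η) (univ ×ˢ J))
    (hs : ∀ y ∉ closedBall x₀ ρ, ∀ t ∈ J, η y t = 0) :
    ContinuousOn (fun t => ∫ y, f y t * η y t) J := by
  obtain ⟨K, hK⟩ := hf.bdd
  obtain ⟨L, hL0, hL⟩ := exists_bound_of_continuousOn hJ hη hs
  intro t ht
  refine continuousWithinAt_of_dominated
    (bound := fun y => (closedBall x₀ ρ).indicator (fun _ => |K| * L) y) ?_ ?_
    (integrable_indicator_closedBall _ _ _) ?_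
  · filter_upwards [self_mem_nhdsWithin] with s hsJ
    exact (hf.integrable_mul hη hs hsJ).aestronglyMeasurable
  · filter_upwards [self_mem_nhdsWithin] with s hsJ
    refine Filter.Eventually.of_forall fun y => ?_
    by_cases hy : y ∈ closedBall x₀ ρ
    · have := hL y s hsJ
      rw [indicator_of_mem hy] at this ⊢
      rw [norm_mul]
      exact mul_le_mul ((hK y hy s hsJ).trans (le_abs_self _)) this (abs_nonneg _) (abs_nonneg _)
    · rw [indicator_of_notMem hy, hs y hy s hsJ]; simp
  · refine Filter.Eventually.of_forall fun y => ?_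
    by_cases hy : y ∈ closedBall x₀ ρ
    · exact (hf.time y hy t ht).mul (continuousOn_snd_of_uncurry hη y t ht)
    · have : ContinuousWithinAt (fun _ : ℝ => (0 : ℝ)) J t := continuousWithinAt_const
      refine this.congr (fun s hsJ => ?_) ?_ <;> rw [hs y hy _ (by assumption), mul_zero]

/-- The density in the weak formulation. -/
noncomputable def weakDensity (v g η ηt ηL : 𝔼 → ℝ → ℝ) (t : ℝ) : ℝ :=
  (∫ y, v y t * (ηt y t + ηL y t)) + ∫ y, g y t * η y t

lemma continuousOn_weakDensity {v g η ηt ηL : 𝔼 → ℝ → ℝ} {x₀ : 𝔼} {ρ t₁ t₂ : ℝ}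
    (hv : SepCont v x₀ ρ (Icc t₁ t₂)) (hg : SepCont g x₀ ρ (Icc t₁ t₂))
    (hη : IsTest x₀ ρ t₁ t₂ η ηt ηL) : ContinuousOn (weakDensity v g η ηt ηL) (Icc t₁ t₂) := by
  refine ContinuousOn.add ?_ (hg.continuousOn_integral isCompact_Icc hη.cont hη.supp)
  exact hv.continuousOn_integral (η := fun y t => ηt y t + ηL y t) isCompact_Icc
    (hη.cont_t.add hη.cont_L) fun y hy t ht => by rw [hη.supp_t y hy t ht, hη.supp_L y hy t ht, add_zero]

lemma le_of_forall_slope {f : ℝ → ℝ} {a b : ℝ} (hab : a ≤ b) (hf : ContinuousOn f (Icc a b))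
    (h : ∀ t ∈ Ico a b, ∀ ε > 0, ∀ᶠ s in 𝓝[>] t, -ε * (s - t) ≤ f s - f t) : f a ≤ f b := by
  have key : ∀ ε > 0, f a - ε * (b - a) ≤ f b := by
    intro ε hε
    have := image_le_of_liminf_slope_right_lt_deriv_boundary' (f := fun t => - f t) (f' := fun _ => ε / 2)
      (a := a) (b := b) (B := fun t => - f a + ε * (t - a)) (B' := fun _ => ε) hf.neg
      (fun t ht r hr => ?_) (by simp) (by fun_prop) (fun t _ => ?_) (fun t _ _ => by linarith)
      (right_mem_Icc.2 hab)
    · linarith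
    · refine Filter.Eventually.frequently ?_
      filter_upwards [h t ht (ε / 2) (by linarith), self_mem_nhdsWithin] with s hs hst
      have hst' : 0 < s - t := sub_pos.2 hst
      rw [slope_def_field]
      refine lt_of_le_of_lt ?_ hr
      rw [div_le_iff₀ hst']; linarith
    · have : HasDerivAt (fun t => - f a + ε * (t - a)) ε t := by
        simpa using (((hasDerivAt_id t).sub_const a).const_mul ε).const_add (-f a)
      exact this.hasDerivWithinAt
  by_contra hlt
  push Not at hlt
  have h1 : 0 < b - a + 1 := by linarith
  have := key ((f a - f b) / (b - a + 1)) (div_pos (by linarith) h1)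
  have h2 : (f a - f b) / (b - a + 1) * (b - a) < f a - f b := by
    rw [div_mul_eq_mul_div, div_lt_iff₀ h1]; nlinarith
  linarith

end WeakFormulation

section WeakFormulation
variable {N : ℕ}
local notation "𝔼" => EuclideanSpace ℝ (Fin N)

lemma slope_lower_bound {v g η ηt ηL : 𝔼 → ℝ → ℝ} {x₀ : 𝔼} {ρ ρ₂ t₁ t₂ t₀ C : ℝ}
    (ht₀ : t₀ ∈ Ico t₁ t₂) (hv : SepCont v x₀ ρ (Icc t₁ t₂)) (hg : SepCont g x₀ ρ (Icc t₁ t₂))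
    (hρ : ρ < ρ₂) (hs : ContDiffOn ℝ 2 (fun y => v y t₀) (ball x₀ ρ₂))
    (hd : ∀ y ∈ closedBall x₀ ρ, ∃ w, HasDerivAt (v y) w t₀ ∧ lap (fun y => v y t₀) y + g y t₀ ≤ w)
    (hC : ∀ y ∈ closedBall x₀ ρ, ∀ s ∈ Ioc t₀ t₂, -C * (s - t₀) ≤ v y s - v y t₀)
    (hη : IsTest x₀ ρ t₁ t₂ η ηt ηL) {ε : ℝ} (hε : 0 < ε) :
    ∀ᶠ s in 𝓝[>] t₀, (weakDensity v g η ηt ηL t₀ - ε) * (s - t₀) ≤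
      (∫ y, v y s * η y s) - ∫ y, v y t₀ * η y t₀ := by
  have ht₀' : t₀ ∈ Icc t₁ t₂ := Ico_subset_Icc_self ht₀
  have hsub : closedBall x₀ ρ ⊆ ball x₀ ρ₂ := closedBall_subset_ball hρ
  let G : 𝔼 → ℝ := fun y => lap (fun y => v y t₀) y + g y t₀
  have hG : ContinuousOn G (closedBall x₀ ρ) :=
    ((continuousOn_lap isOpen_ball hs).mono hsub).add (hg.space t₀ ht₀')
  let l : ℝ → 𝔼 → ℝ := fun s y =>
    min ((v y s - v y t₀) / (s - t₀)) (G y) * η y t₀ + v y s * ((η y s - η y t₀) / (s - t₀))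
  have hIoc : ∀ᶠ s in 𝓝[>] t₀, s ∈ Ioc t₀ t₂ := Ioc_mem_nhdsGT ht₀.2
  obtain ⟨KG, hKG⟩ := (isCompact_closedBall x₀ ρ).exists_bound_of_continuousOn hG
  obtain ⟨Kv, hKv⟩ := hv.bdd
  obtain ⟨Kη, hKη0, hKη⟩ := exists_bound_of_continuousOn isCompact_Icc hη.cont hη.supp
  obtain ⟨Kt, hKt0, hKt⟩ := exists_bound_of_continuousOn isCompact_Icc hη.cont_t hη.supp_t
  have hmem : ∀ s ∈ Ioc t₀ t₂, s ∈ Icc t₁ t₂ := fun s hs => ⟨ht₀.1.trans hs.1.le, hs.2⟩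
  have ηc : ∀ s ∈ Icc t₁ t₂, Continuous fun y => η y s := fun s hs => (hη.smooth s hs).continuous
  have lint : ∀ s ∈ Ioc t₀ t₂, Integrable (l s) := by
    intro s hs
    refine integrable_of_continuousOn_closedBall (x₀ := x₀) (ρ := ρ) ?_ fun y hy => ?_
    · have h1 := hv.space s (hmem s hs)
      have h2 := hv.space t₀ ht₀'
      have h3 := ηc s (hmem s hs)
      have h4 := ηc t₀ ht₀'
      exact ((((h1.sub h2).div_const _).inf hG).mul h4.continuousOn).add
        (h1.mul ((h3.sub h4).div_const _).continuousOn)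
    · simp only [l, hη.supp y hy t₀ ht₀', hη.supp y hy s (hmem s hs)]; simp
  have lim : Tendsto (fun s => ∫ y, l s y) (𝓝[>] t₀) (𝓝 (∫ y, (G y * η y t₀ + v y t₀ * ηt y t₀))) := by
    refine tendsto_integral_filter_of_dominated_convergence
      (fun y => (closedBall x₀ ρ).indicator (fun _ => (max |C| |KG|) * Kη + |Kv| * Kt) y) ?_ ?_
      (integrable_indicator_closedBall _ _ _) ?_
    · filter_upwards [hIoc] with s hs using (lint s hs).aestronglyMeasurable
    · filter_upwards [hIoc] with s hs
      refine Filter.Eventually.of_forall fun y => ?_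
      have hst : 0 < s - t₀ := sub_pos.2 hs.1
      by_cases hy : y ∈ closedBall x₀ ρ
      · rw [indicator_of_mem hy]
        have a1 := hKη y t₀ ht₀'
        rw [indicator_of_mem hy] at a1
        have a2 : |min ((v y s - v y t₀) / (s - t₀)) (G y)| ≤ max |C| |KG| := by
          have b1 : |G y| ≤ |KG| := (hKG y hy).trans (le_abs_self _)
          have b2 : -C ≤ (v y s - v y t₀) / (s - t₀) := by
            rw [le_div_iff₀ hst]; exact hC y hy s hs
          rw [abs_le]
          constructor
          · apply le_min
            · have := le_max_left |C| |KG|; have := le_abs_self C; linarith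
            · have := le_max_right |C| |KG|; have := neg_abs_le (G y); linarith
          · exact (min_le_right _ _).trans ((le_abs_self _).trans (b1.trans (le_max_right _ _)))
        have a3 : |(η y s - η y t₀) / (s - t₀)| ≤ Kt := by
          rw [abs_div, abs_of_pos hst, div_le_iff₀ hst]
          have := (convex_Icc t₁ t₂).norm_image_sub_le_of_norm_hasDerivWithin_le (f := η y)
            (f' := ηt y) (C := Kt) (fun t ht => (hη.hasDeriv y t ht).hasDerivWithinAt)
            (fun t ht => by have := hKt y t ht; rwa [indicator_of_mem hy] at this) ht₀' (hmem s hs)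
          rwa [Real.norm_eq_abs, Real.norm_eq_abs, abs_of_pos hst] at this
        have a4 : |v y s| ≤ |Kv| := (hKv y hy s (hmem s hs)).trans (le_abs_self _)
        refine (norm_add_le _ _).trans ?_
        rw [norm_mul, norm_mul]
        exact add_le_add (mul_le_mul a2 a1 (abs_nonneg _) ((abs_nonneg _).trans (le_max_left _ _)))
          (mul_le_mul a4 a3 (abs_nonneg _) (abs_nonneg _))
      · rw [indicator_of_notMem hy]
        simp only [l, hη.supp y hy t₀ ht₀', hη.supp y hy s (hmem s hs)]; simp
    · refine Filter.Eventually.of_forall fun y => ?_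
      by_cases hy : y ∈ closedBall x₀ ρ
      · obtain ⟨w, hw, hwG⟩ := hd y hy
        have h1 : Tendsto (fun s => (v y s - v y t₀) / (s - t₀)) (𝓝[>] t₀) (𝓝 w) := by
          have := (hasDerivAt_iff_tendsto_slope.1 hw).mono_left
            (nhdsWithin_mono t₀ (fun s hs => ne_of_gt hs : Ioi t₀ ⊆ {t₀}ᶜ))
          simpa only [slope_fun_def_field] using this
        have h2 : Tendsto (fun s => (η y s - η y t₀) / (s - t₀)) (𝓝[>] t₀) (𝓝 (ηt y t₀)) := by
          have := (hasDerivAt_iff_tendsto_slope.1 (hη.hasDeriv y t₀ ht₀')).mono_left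
            (nhdsWithin_mono t₀ (fun s hs => ne_of_gt hs : Ioi t₀ ⊆ {t₀}ᶜ))
          simpa only [slope_fun_def_field] using this
        have h3 : Tendsto (v y) (𝓝[>] t₀) (𝓝 (v y t₀)) :=
          hw.continuousAt.tendsto.mono_left nhdsWithin_le_nhds
        have h4 := ((h1.min (tendsto_const_nhds (x := G y))).mul_const (η y t₀)).add (h3.mul h2)
        rwa [min_eq_right hwG] at h4
      · have : ∀ᶠ s in 𝓝[>] t₀, G y * η y t₀ + v y t₀ * ηt y t₀ = l s y := by
          filter_upwards [hIoc] with s hs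
          simp only [l, hη.supp y hy t₀ ht₀', hη.supp y hy s (hmem s hs), hη.supp_t y hy t₀ ht₀']; simp
        exact tendsto_const_nhds.congr' this
  have hq : ∫ y, (G y * η y t₀ + v y t₀ * ηt y t₀) = weakDensity v g η ηt ηL t₀ := by
    have i1 : Integrable fun y => v y t₀ * ηt y t₀ := hv.integrable_mul hη.cont_t hη.supp_t ht₀'
    have i2 : Integrable fun y => v y t₀ * ηL y t₀ := hv.integrable_mul hη.cont_L hη.supp_L ht₀'
    have i3 : Integrable fun y => g y t₀ * η y t₀ := hg.integrable_mul hη.cont hη.supp ht₀'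
    have i4 : Integrable fun y => lap (fun y => v y t₀) y * η y t₀ :=
      integrable_of_continuousOn_closedBall
        (((continuousOn_lap isOpen_ball hs).mono hsub).mul (ηc t₀ ht₀').continuousOn)
        fun y hy => by rw [hη.supp y hy t₀ ht₀', mul_zero]
    have hts : tsupport (fun y => η y t₀) ⊆ closedBall x₀ ρ := by
      refine closure_minimal (fun y hy => ?_) isClosed_closedBall
      by_contra h
      exact hy (hη.supp y h t₀ ht₀')
    have green := integral_mul_lap isOpen_ball hs (hη.smooth t₀ ht₀')
      (HasCompactSupport.intro (isCompact_closedBall x₀ ρ) fun y hy => hη.supp y hy t₀ ht₀')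
      (hts.trans hsub)
    simp only [hη.lap_eq t₀ ht₀'] at green
    simp only [weakDensity, mul_add, G, add_mul]
    rw [integral_add (i4.fun_add i3) i1, integral_add i4 i3, integral_add i1 i2, green]; ring
  rw [hq] at lim
  filter_upwards [hIoc, lim.eventually (lt_mem_nhds (sub_lt_self _ hε))] with s hs hlt
  have hst : 0 < s - t₀ := sub_pos.2 hs.1
  have j1 := hv.integrable_mul hη.cont hη.supp (hmem s hs)
  have j0 := hv.integrable_mul hη.cont hη.supp ht₀'
  have h1 : ∫ y, l s y ≤ ∫ y, (v y s * η y s - v y t₀ * η y t₀) / (s - t₀) := by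
    refine integral_mono (lint s hs) ((j1.sub j0).div_const _) fun y => ?_
    have : min ((v y s - v y t₀) / (s - t₀)) (G y) * η y t₀ ≤
        (v y s - v y t₀) / (s - t₀) * η y t₀ :=
      mul_le_mul_of_nonneg_right (min_le_left _ _) (hη.nonneg y t₀ ht₀')
    simp only [l]
    have e : (v y s * η y s - v y t₀ * η y t₀) / (s - t₀) = (v y s - v y t₀) / (s - t₀) * η y t₀
      + v y s * ((η y s - η y t₀) / (s - t₀)) := by field_simp; ring
    rw [e]; linarith
  rw [integral_div, integral_sub j1 j0] at h1
  have := hlt.le.trans h1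
  rwa [le_div_iff₀ hst] at this

/-- `v` is a weak supersolution of `v_t - Δ v ≥ g` on `ball x₀ ρ₁ × [t₁, t₂]`. -/
def WeakSuper (v g : 𝔼 → ℝ → ℝ) (x₀ : 𝔼) (ρ₁ t₁ t₂ : ℝ) : Prop :=
  ∀ ρ < ρ₁, ∀ η ηt ηL : 𝔼 → ℝ → ℝ, IsTest x₀ ρ t₁ t₂ η ηt ηL →
    (∫ y, v y t₁ * η y t₁) + ∫ t in t₁..t₂, weakDensity v g η ηt ηL t ≤ ∫ y, v y t₂ * η y t₂

/-- If right slopes are at least the weak density at every time then the weak inequality holds. -/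
lemma weak_of_slopes {v g η ηt ηL : 𝔼 → ℝ → ℝ} {x₀ : 𝔼} {ρ t₁ t₂ : ℝ} (h12 : t₁ ≤ t₂)
    (hv : SepCont v x₀ ρ (Icc t₁ t₂)) (hg : SepCont g x₀ ρ (Icc t₁ t₂))
    (hη : IsTest x₀ ρ t₁ t₂ η ηt ηL)
    (h : ∀ t ∈ Ico t₁ t₂, ∀ ε > 0, ∀ᶠ s in 𝓝[>] t, (weakDensity v g η ηt ηL t - ε) * (s - t) ≤
      (∫ y, v y s * η y s) - ∫ y, v y t * η y t) :
    (∫ y, v y t₁ * η y t₁) + ∫ t in t₁..t₂, weakDensity v g η ηt ηL t ≤ ∫ y, v y t₂ * η y t₂ := by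
  set q := weakDensity v g η ηt ηL
  have hq : ContinuousOn q (Icc t₁ t₂) := continuousOn_weakDensity hv hg hη
  have hqi : IntervalIntegrable q volume t₁ t₂ := hq.intervalIntegrable_of_Icc h12
  have hM := hv.continuousOn_integral isCompact_Icc hη.cont hη.supp
  have hP : ContinuousOn (fun t => ∫ s in t₁..t, q s) (Icc t₁ t₂) := by
    have := intervalIntegral.continuousOn_primitive_interval (μ := volume) (f := q) (a := t₁) (b := t₂)
      (by rw [uIcc_of_le h12]; exact hq.integrableOn_Icc)
    rwa [uIcc_of_le h12] at this
  have := le_of_forall_slope (f := fun t => (∫ y, v y t * η y t) - ∫ s in t₁..t, q s) h12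
    (hM.sub hP) ?_
  · simp only [intervalIntegral.integral_same] at this; linarith
  intro t ht ε hε
  have htI : t ∈ Icc t₁ t₂ := Ico_subset_Icc_self ht
  have hnear : ∀ᶠ s in 𝓝[>] t, q s ≤ q t + ε / 2 := by
    have h1 : Tendsto q (𝓝[>] t) (𝓝 (q t)) := by
      refine (hq t htI).mono_left ?_
      rw [nhdsWithin_le_iff]
      exact Filter.mem_of_superset (Ioc_mem_nhdsGT ht.2) fun s hs => ⟨ht.1.trans hs.1.le, hs.2⟩
    exact h1.eventually (ge_mem_nhds (by linarith))
  obtain ⟨u, hu, hus⟩ := (mem_nhdsGT_iff_exists_Ioo_subset).1 hnear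
  filter_upwards [h t ht (ε / 2) (by linarith), Ioo_mem_nhdsGT (hu : t < u), Ioc_mem_nhdsGT ht.2]
    with s hs hsu hs2
  have hts : t ≤ s := hs2.1.le
  have hqts : IntervalIntegrable q volume t s :=
    (hq.mono (Icc_subset_Icc ht.1 hs2.2)).intervalIntegrable_of_Icc hts
  have hq1 : IntervalIntegrable q volume t₁ t :=
    (hq.mono (Icc_subset_Icc le_rfl htI.2)).intervalIntegrable_of_Icc ht.1
  have hadd := intervalIntegral.integral_add_adjacent_intervals hq1 hqts
  have hle : ∫ x in t..s, q x ≤ (q t + ε / 2) * (s - t) := by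
    have := intervalIntegral.integral_mono_on hts hqts (intervalIntegrable_const (c := q t + ε / 2))
      (fun x hx => ?_)
    · rw [intervalIntegral.integral_const, smul_eq_mul] at this; linarith
    · rcases hx.1.eq_or_lt with rfl | hx1
      · linarith
      · exact hus ⟨hx1, hx.2.trans_lt hsu.2⟩
  nlinarith

end WeakFormulation

section HeatKernel

/-- The heat kernel on `ℝ^N` as a function of time and of the squared distance. -/
noncomputable def heatKer (N : ℕ) (τ s : ℝ) : ℝ := (4 * π * τ) ^ (-((N : ℝ) / 2)) * exp (-s / (4 * τ))

lemma heatKer_nonneg (N : ℕ) {τ : ℝ} (hτ : 0 < τ) (s : ℝ) : 0 ≤ heatKer N τ s := by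
  unfold heatKer; positivity

lemma hasDerivAt_heatKer_time (N : ℕ) {τ : ℝ} (hτ : 0 < τ) (s : ℝ) :
    HasDerivAt (fun τ => heatKer N τ s) (heatKer N τ s * (-(N / (2 * τ)) + s / (4 * τ ^ 2))) τ := by
  have hb : (0 : ℝ) < 4 * π * τ := by positivity
  have h1 : HasDerivAt (fun τ : ℝ => (4 * π * τ) ^ (-((N : ℝ) / 2)))
      ((4 * π * 1) * (-((N : ℝ) / 2)) * (4 * π * τ) ^ (-((N : ℝ) / 2) - 1)) τ :=
    ((hasDerivAt_id τ).const_mul (4 * π)).rpow_const (Or.inl hb.ne')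
  have h2 : HasDerivAt (fun τ : ℝ => exp (-s / (4 * τ))) (exp (-s / (4 * τ)) * (s / (4 * τ ^ 2))) τ := by
    have h3 : HasDerivAt (fun τ : ℝ => -s / (4 * τ)) (s / (4 * τ ^ 2)) τ := by
      have := (hasDerivAt_const τ (-s)).fun_div ((hasDerivAt_id' τ).const_mul 4) (by positivity : 4 * τ ≠ 0)
      convert! this using 1
      field_simp; ring
    exact h3.exp
  convert! h1.mul h2 using 1
  rw [Real.rpow_sub_one hb.ne']
  unfold heatKer
  field_simp

lemma hasDerivAt_heatKer_space (N : ℕ) (τ s : ℝ) :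
    HasDerivAt (heatKer N τ) (heatKer N τ s * (-1 / (4 * τ))) s := by
  have h3 : HasDerivAt (fun s : ℝ => -s / (4 * τ)) (-1 / (4 * τ)) s := (hasDerivAt_neg s).div_const _
  have := h3.exp.const_mul ((4 * π * τ) ^ (-((N : ℝ) / 2)))
  convert! this using 1
  unfold heatKer; ring

/-- A nonnegative `C²` radial profile supported in `s ≤ ρ ^ 2`, with its two derivatives. -/
structure Profile (h h₁ h₂ : ℝ → ℝ) (ρ : ℝ) : Prop where
  d₁ : ∀ s, HasDerivAt h (h₁ s) s
  d₂ : ∀ s, HasDerivAt h₁ (h₂ s) s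
  cont : Continuous h₂
  nonneg : ∀ s, 0 ≤ h s
  zero : ∀ s, ρ ^ 2 ≤ s → h s = 0 ∧ h₁ s = 0 ∧ h₂ s = 0

lemma Profile.contDiff {h h₁ h₂ : ℝ → ℝ} {ρ : ℝ} (hp : Profile h h₁ h₂ ρ) : ContDiff ℝ 2 h := by
  have e1 : deriv h = h₁ := funext fun s => (hp.d₁ s).deriv
  have e2 : deriv h₁ = h₂ := funext fun s => (hp.d₂ s).deriv
  rw [show (2 : WithTop ℕ∞) = 1 + 1 by norm_num, contDiff_succ_iff_deriv]
  refine ⟨fun s => (hp.d₁ s).differentiableAt, by simp, ?_⟩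
  rw [e1, contDiff_one_iff_deriv, e2]
  exact ⟨fun s => (hp.d₂ s).differentiableAt, hp.cont⟩

variable {N : ℕ}
local notation "𝔼" => EuclideanSpace ℝ (Fin N)

lemma dd_norm_sq (x₀ x v : 𝔼) : dd v (fun y => ‖y - x₀‖ ^ 2) x = 2 * inner ℝ (x - x₀) v := by
  have : HasFDerivAt (fun y : 𝔼 => y - x₀) (ContinuousLinearMap.id ℝ 𝔼) x :=
    (hasFDerivAt_id x).sub_const x₀
  have := this.norm_sq.fderiv
  simp [dd, this, inner_sub_left]

lemma contDiff_norm_sub_sq (x₀ : 𝔼) : ContDiff ℝ 2 fun y : 𝔼 => ‖y - x₀‖ ^ 2 :=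
  (contDiff_id.sub contDiff_const).norm_sq ℝ

lemma lap_norm_sq (x₀ x : 𝔼) : lap (fun y => ‖y - x₀‖ ^ 2) x = 2 * N := by
  rw [lap_eq_sum_dd (contDiff_norm_sub_sq x₀).contDiffAt]
  have : ∀ i : Fin N, dd (ev i) (dd (ev i) fun y : 𝔼 => ‖y - x₀‖ ^ 2) x = 2 := by
    intro i
    have e : (dd (ev i) fun y : 𝔼 => ‖y - x₀‖ ^ 2) = fun y => 2 * (y i - x₀ i) := by
      funext y
      rw [dd_norm_sq, ev, EuclideanSpace.inner_single_right]; simp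
    rw [e]
    have : HasFDerivAt (fun y : 𝔼 => 2 * (y i - x₀ i)) ((2 : ℝ) • (EuclideanSpace.proj i : 𝔼 →L[ℝ] ℝ)) x :=
      (((EuclideanSpace.proj i : 𝔼 →L[ℝ] ℝ).hasFDerivAt).sub_const (x₀ i)).const_mul 2
    simp only [dd]; rw [this.fderiv]
    simp [ev]
  simp [this, mul_comm]

lemma gradSq_norm_sq (x₀ x : 𝔼) : gradSq (fun y => ‖y - x₀‖ ^ 2) x = 4 * ‖x - x₀‖ ^ 2 := by
  unfold gradSq
  have : ∀ i : Fin N, dd (ev i) (fun y : 𝔼 => ‖y - x₀‖ ^ 2) x ^ 2 = 4 * ‖(x - x₀) i‖ ^ 2 := by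
    intro i
    rw [dd_norm_sq, ev, EuclideanSpace.inner_single_right]
    simp; ring
  rw [Finset.sum_congr rfl fun i _ => this i, ← Finset.mul_sum, EuclideanSpace.norm_sq_eq]

/-- Truncated backward heat kernel with pole at `(x₀, t₂ + ε)`. -/
noncomputable def kerTest (x₀ : 𝔼) (l ε t₂ : ℝ) (h : ℝ → ℝ) (y : 𝔼) (t : ℝ) : ℝ :=
  exp (-l * (t₂ - t)) * heatKer N (t₂ + ε - t) (‖y - x₀‖ ^ 2) * h (‖y - x₀‖ ^ 2)

noncomputable def kerTestT (x₀ : 𝔼) (l ε t₂ : ℝ) (h : ℝ → ℝ) (y : 𝔼) (t : ℝ) : ℝ :=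
  exp (-l * (t₂ - t)) * heatKer N (t₂ + ε - t) (‖y - x₀‖ ^ 2) *
    ((l + N / (2 * (t₂ + ε - t)) - ‖y - x₀‖ ^ 2 / (4 * (t₂ + ε - t) ^ 2)) * h (‖y - x₀‖ ^ 2))

noncomputable def kerTestL (x₀ : 𝔼) (l ε t₂ : ℝ) (h h₁ h₂ : ℝ → ℝ) (y : 𝔼) (t : ℝ) : ℝ :=
  exp (-l * (t₂ - t)) * heatKer N (t₂ + ε - t) (‖y - x₀‖ ^ 2) *
    (4 * ‖y - x₀‖ ^ 2 * (h₂ (‖y - x₀‖ ^ 2) - h₁ (‖y - x₀‖ ^ 2) / (2 * (t₂ + ε - t))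
      + h (‖y - x₀‖ ^ 2) / (16 * (t₂ + ε - t) ^ 2))
     + 2 * N * (h₁ (‖y - x₀‖ ^ 2) - h (‖y - x₀‖ ^ 2) / (4 * (t₂ + ε - t))))

lemma kerTest_add (x₀ : 𝔼) {l ε t₂ t : ℝ} (h h₁ h₂ : ℝ → ℝ) (y : 𝔼) (hτ : 0 < t₂ + ε - t) :
    kerTestT x₀ l ε t₂ h y t + kerTestL x₀ l ε t₂ h h₁ h₂ y t =
      exp (-l * (t₂ - t)) * heatKer N (t₂ + ε - t) (‖y - x₀‖ ^ 2) *
        (l * h (‖y - x₀‖ ^ 2) + 4 * ‖y - x₀‖ ^ 2 * h₂ (‖y - x₀‖ ^ 2) + 2 * N * h₁ (‖y - x₀‖ ^ 2)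
          - 2 * ‖y - x₀‖ ^ 2 * h₁ (‖y - x₀‖ ^ 2) / (t₂ + ε - t)) := by
  unfold kerTestT kerTestL
  rw [← mul_add]
  congr 1
  field_simp
  ring

lemma isTest_ker (x₀ : 𝔼) {l ε t₁ t₂ ρ : ℝ} (hε : 0 < ε) (hρ : 0 ≤ ρ) {h h₁ h₂ : ℝ → ℝ}
    (hp : Profile h h₁ h₂ ρ) :
    IsTest x₀ ρ t₁ t₂ (kerTest x₀ l ε t₂ h) (kerTestT x₀ l ε t₂ h) (kerTestL x₀ l ε t₂ h h₁ h₂) := by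
  have hτ : ∀ t ∈ Icc t₁ t₂, 0 < t₂ + ε - t := fun t ht => by linarith [ht.2]
  have c0 : Continuous h := hp.contDiff.continuous
  have c1 : Continuous h₁ := continuous_iff_continuousAt.2 fun s => (hp.d₂ s).continuousAt
  have c2 : Continuous h₂ := hp.cont
  have hz : ∀ y ∉ closedBall x₀ ρ, ρ ^ 2 ≤ ‖y - x₀‖ ^ 2 := fun y hy => by
    rw [mem_closedBall, dist_eq_norm, not_le] at hy
    gcongr
  have hker : ContinuousOn (fun z : 𝔼 × ℝ => exp (-l * (t₂ - z.2)) *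
      heatKer N (t₂ + ε - z.2) (‖z.1 - x₀‖ ^ 2)) (univ ×ˢ Icc t₁ t₂) := by
    refine ContinuousOn.mul (by fun_prop) ?_
    unfold heatKer
    refine ContinuousOn.mul (ContinuousOn.rpow_const (by fun_prop) fun z hz => Or.inl ?_) ?_
    · have := hτ z.2 hz.2; positivity
    · refine ContinuousOn.rexp (ContinuousOn.div (by fun_prop) (by fun_prop) fun z hz => ?_)
      have := hτ z.2 hz.2; positivity
  have hn : ∀ z ∈ (univ ×ˢ Icc t₁ t₂ : Set (𝔼 × ℝ)), t₂ + ε - z.2 ≠ 0 := fun z hz => (hτ z.2 hz.2).ne'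
  refine ⟨?_, ?_, ?_, ?_, ?_, ?_, ?_, ?_, ?_, ?_⟩
  · exact hker.mul (by fun_prop)
  · refine hker.mul (ContinuousOn.mul (ContinuousOn.sub (ContinuousOn.add (by fun_prop)
      (ContinuousOn.div (by fun_prop) (by fun_prop) ?_)) (ContinuousOn.div (by fun_prop) (by fun_prop) ?_))
      (by fun_prop)) <;> intro z hz <;> have := hn z hz <;> positivity
  · refine hker.mul (ContinuousOn.add (ContinuousOn.mul (by fun_prop) (ContinuousOn.add (ContinuousOn.sub
      (by fun_prop) (ContinuousOn.div (by fun_prop) (by fun_prop) ?_))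
      (ContinuousOn.div (by fun_prop) (by fun_prop) ?_))) (ContinuousOn.mul (by fun_prop) (ContinuousOn.sub
      (by fun_prop) (ContinuousOn.div (by fun_prop) (by fun_prop) ?_))))
      <;> intro z hz <;> have := hn z hz <;> positivity
  · intro y t ht
    exact mul_nonneg (mul_nonneg (exp_pos _).le (heatKer_nonneg N (hτ t ht) _)) (hp.nonneg _)
  · intro y hy t _
    simp [kerTest, (hp.zero _ (hz y hy)).1]
  · intro y hy t _
    simp [kerTestT, (hp.zero _ (hz y hy)).1]
  · intro y hy t _
    obtain ⟨z0, z1, z2⟩ := hp.zero _ (hz y hy)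
    simp [kerTestL, z0, z1, z2]
  · intro y t ht
    have h1 : HasDerivAt (fun t => exp (-l * (t₂ - t))) (exp (-l * (t₂ - t)) * l) t := by
      have : HasDerivAt (fun t => -l * (t₂ - t)) l t := by
        simpa using ((hasDerivAt_id' t).const_sub t₂).const_mul (-l)
      exact this.exp
    have h2 := (hasDerivAt_heatKer_time N (hτ t ht) (‖y - x₀‖ ^ 2)).comp t
      ((hasDerivAt_id' t).const_sub (t₂ + ε))
    have := (h1.mul h2).mul_const (h (‖y - x₀‖ ^ 2))
    convert! this using 1
    simp only [kerTestT, Function.comp]; ring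
  · intro t ht
    have : ContDiff ℝ 2 fun s => exp (-l * (t₂ - t)) * heatKer N (t₂ + ε - t) s * h s := by
      unfold heatKer
      exact (contDiff_const.mul (contDiff_const.mul ((contDiff_neg.div_const _).exp))).mul hp.contDiff
    exact this.comp (contDiff_norm_sub_sq x₀)
  · intro t ht y
    have hsm : ContDiff ℝ 2 fun s => exp (-l * (t₂ - t)) * heatKer N (t₂ + ε - t) s * h s := by
      unfold heatKer
      exact (contDiff_const.mul (contDiff_const.mul ((contDiff_neg.div_const _).exp))).mul hp.contDiff
    have hd : ∀ s, HasDerivAt (fun s => exp (-l * (t₂ - t)) * heatKer N (t₂ + ε - t) s * h s)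
        (exp (-l * (t₂ - t)) * heatKer N (t₂ + ε - t) s * (h₁ s - h s / (4 * (t₂ + ε - t)))) s := by
      intro s
      have := ((hasDerivAt_heatKer_space N (t₂ + ε - t) s).const_mul (exp (-l * (t₂ - t)))).mul (hp.d₁ s)
      convert! this using 1
      ring
    have hd2 : ∀ s, HasDerivAt
        (fun s => exp (-l * (t₂ - t)) * heatKer N (t₂ + ε - t) s * (h₁ s - h s / (4 * (t₂ + ε - t))))
        (exp (-l * (t₂ - t)) * heatKer N (t₂ + ε - t) s * (h₂ s - h₁ s / (2 * (t₂ + ε - t))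
          + h s / (16 * (t₂ + ε - t) ^ 2))) s := by
      intro s
      have := ((hasDerivAt_heatKer_space N (t₂ + ε - t) s).const_mul (exp (-l * (t₂ - t)))).mul
        ((hp.d₂ s).sub ((hp.d₁ s).div_const (4 * (t₂ + ε - t))))
      convert! this using 1
      have := (hτ t ht).ne'
      simp only [Pi.sub_apply]
      field_simp; ring
    have := lap_comp (x := y) (contDiff_norm_sub_sq x₀).contDiffAt hsm.contDiffAt
      (Filter.Eventually.of_forall hd) (hd2 _)
    simp only [kerTest]
    rw [this, lap_norm_sq, gradSq_norm_sq, kerTestL]; ring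

end HeatKernel

section HeatKernel

lemma rpow_neg_mul_exp_le {κ c τ : ℝ} (hκ : 0 < κ) (hc : 0 < c) (hτ : 0 < τ) :
    τ ^ (-κ) * exp (-c / τ) ≤ (κ / c) ^ κ := by
  have h1 : c / (κ * τ) ≤ exp (c / (κ * τ)) := by
    have := add_one_le_exp (c / (κ * τ)); linarith
  have h2 : (c / (κ * τ)) ^ κ ≤ exp (c / τ) := by
    calc (c / (κ * τ)) ^ κ ≤ exp (c / (κ * τ)) ^ κ := by gcongr
      _ = exp (c / τ) := by rw [← exp_mul]; congr 1; field_simp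
  have h3 : τ ^ (-κ) = (κ / c) ^ κ * (c / (κ * τ)) ^ κ := by
    rw [← mul_rpow (by positivity) (by positivity), rpow_neg hτ.le, ← inv_rpow hτ.le]
    congr 1; field_simp
  rw [h3, neg_div, exp_neg, mul_assoc]
  have : (c / (κ * τ)) ^ κ * (exp (c / τ))⁻¹ ≤ 1 := by
    rw [← div_eq_mul_inv, div_le_one (exp_pos _)]; exact h2
  exact mul_le_of_le_one_right (by positivity) this

lemma exists_heatKer_bound {N : ℕ} (hN : 1 ≤ N) {c : ℝ} (hc : 0 < c) :
    ∃ C, 0 ≤ C ∧ ∀ τ > 0, ∀ s ≥ c, heatKer N τ s ≤ C ∧ heatKer N τ s / τ ≤ C := by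
  have hN' : (0 : ℝ) < (N : ℝ) / 2 := by positivity
  have base : ∀ τ > 0, ∀ s ≥ c, heatKer N τ s ≤ τ ^ (-((N : ℝ) / 2)) * exp (-(c / 4) / τ) := by
    intro τ hτ s hs
    unfold heatKer
    have h1 : (4 * π * τ) ^ (-((N : ℝ) / 2)) ≤ τ ^ (-((N : ℝ) / 2)) := by
      refine rpow_le_rpow_of_nonpos hτ ?_ (by linarith)
      nlinarith [pi_gt_three]
    have h2 : exp (-s / (4 * τ)) ≤ exp (-(c / 4) / τ) := by
      refine exp_le_exp.2 ?_
      rw [div_le_div_iff₀ (by positivity) hτ]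
      nlinarith
    gcongr
  refine ⟨max (((N : ℝ) / 2 / (c / 4)) ^ ((N : ℝ) / 2)) ((((N : ℝ) / 2 + 1) / (c / 4)) ^ ((N : ℝ) / 2 + 1)),
    by positivity, fun τ hτ s hs => ⟨?_, ?_⟩⟩
  · exact (base τ hτ s hs).trans
      ((rpow_neg_mul_exp_le hN' (by linarith) hτ).trans (le_max_left _ _))
  · refine le_trans ?_ ((rpow_neg_mul_exp_le (κ := (N : ℝ) / 2 + 1) (c := c / 4) (by linarith)
      (by linarith) hτ).trans (le_max_right _ _))
    rw [neg_add', rpow_sub_one hτ.ne', div_mul_eq_mul_div]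
    exact div_le_div_of_nonneg_right (base τ hτ s hs) hτ.le

lemma hasDerivAt_max_pow (n : ℕ) (z : ℝ) :
    HasDerivAt (fun z : ℝ => max z 0 ^ (n + 2)) ((n + 2 : ℝ) * max z 0 ^ (n + 1)) z := by
  have hp : ∀ z : ℝ, HasDerivAt (fun z : ℝ => z ^ (n + 2)) ((n + 2 : ℝ) * z ^ (n + 1)) z := by
    intro z; simpa using hasDerivAt_pow (n + 2) z
  rcases lt_trichotomy z 0 with hz | rfl | hz
  · have : HasDerivAt (fun _ : ℝ => (0 : ℝ)) ((n + 2 : ℝ) * max z 0 ^ (n + 1)) z := by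
      rw [max_eq_right hz.le]; simpa using hasDerivAt_const z (0 : ℝ)
    refine this.congr_of_eventuallyEq ?_
    filter_upwards [Iio_mem_nhds hz] with y hy
    rw [max_eq_right (le_of_lt hy)]; simp
  · have h1 : HasDerivWithinAt (fun z : ℝ => max z 0 ^ (n + 2)) ((n + 2 : ℝ) * max 0 0 ^ (n + 1)) (Ici 0) 0 := by
      refine HasDerivWithinAt.congr (f := fun z : ℝ => z ^ (n + 2)) ?_ (fun y hy => ?_) (by simp)
      · simpa using (hp 0).hasDerivWithinAt
      · rw [max_eq_left (mem_Ici.1 hy)]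
    have h2 : HasDerivWithinAt (fun z : ℝ => max z 0 ^ (n + 2)) ((n + 2 : ℝ) * max 0 0 ^ (n + 1)) (Iic 0) 0 := by
      refine HasDerivWithinAt.congr (f := fun _ : ℝ => (0 : ℝ)) ?_ (fun y hy => ?_) (by simp)
      · simpa using hasDerivWithinAt_const (0 : ℝ) (Iic 0) (0 : ℝ)
      · rw [max_eq_right (mem_Iic.1 hy)]; simp
    have := h2.union h1
    rwa [Iic_union_Ici, hasDerivWithinAt_univ] at this
  · have : HasDerivAt (fun z : ℝ => z ^ (n + 2)) ((n + 2 : ℝ) * max z 0 ^ (n + 1)) z := by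
      rw [max_eq_left hz.le]; exact hp z
    refine this.congr_of_eventuallyEq ?_
    filter_upwards [Ioi_mem_nhds hz] with y hy
    rw [max_eq_left (le_of_lt hy)]

/-- The profile `(1 - s / R²)₊³`. -/
noncomputable def cubeProf (R s : ℝ) : ℝ := max (1 - s / R ^ 2) 0 ^ 3

lemma profile_cube {R : ℝ} (hR : 0 < R) : Profile (cubeProf R)
    (fun s => -3 / R ^ 2 * max (1 - s / R ^ 2) 0 ^ 2) (fun s => 6 / R ^ 4 * max (1 - s / R ^ 2) 0) R := by
  have hl : ∀ s : ℝ, HasDerivAt (fun s : ℝ => 1 - s / R ^ 2) (-(1 / R ^ 2)) s := fun s =>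
    ((hasDerivAt_id' s).div_const _).const_sub 1
  refine ⟨fun s => ?_, fun s => ?_, by fun_prop, fun s => ?_, fun s hs => ?_⟩
  · have := (hasDerivAt_max_pow 1 (1 - s / R ^ 2)).comp s (hl s)
    convert! this using 1
    norm_num; ring
  · have := ((hasDerivAt_max_pow 0 (1 - s / R ^ 2)).comp s (hl s)).const_mul (-3 / R ^ 2)
    convert! this using 1
    norm_num; field_simp; ring
  · unfold cubeProf; positivity
  · have : max (1 - s / R ^ 2) 0 = 0 := by
      apply max_eq_right
      rw [sub_nonpos, le_div_iff₀ (by positivity)]; linarith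
    simp [cubeProf, this]

/-- A smooth profile equal to `1` for `s ≤ R² / 4` and vanishing for `s ≥ 9 R² / 16`. -/
noncomputable def flatProf (R s : ℝ) : ℝ := smoothTransition ((9 * R ^ 2 / 16 - s) * (16 / (5 * R ^ 2)))

lemma flatProf_contDiff (R : ℝ) {n : ℕ∞} : ContDiff ℝ n (flatProf R) :=
  smoothTransition.contDiff.comp (by fun_prop)

lemma flatProf_le_one (R s : ℝ) : flatProf R s ≤ 1 := smoothTransition.le_one _

lemma flatProf_nonneg (R s : ℝ) : 0 ≤ flatProf R s := smoothTransition.nonneg _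

lemma flatProf_eq_one {R : ℝ} (hR : 0 < R) {s : ℝ} (hs : s ≤ R ^ 2 / 4) : flatProf R s = 1 := by
  refine smoothTransition.one_of_one_le ?_
  rw [mul_div_assoc', le_div_iff₀ (by positivity)]; nlinarith

lemma flatProf_eq_zero {R : ℝ} (hR : 0 < R) {s : ℝ} (hs : 9 * R ^ 2 / 16 ≤ s) : flatProf R s = 0 := by
  refine smoothTransition.zero_of_nonpos ?_
  exact mul_nonpos_of_nonpos_of_nonneg (by linarith) (by positivity)

lemma profile_flat {R : ℝ} (hR : 0 < R) :
    Profile (flatProf R) (deriv (flatProf R)) (deriv (deriv (flatProf R))) R := by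
  have h3 : ContDiff ℝ 2 (flatProf R) := flatProf_contDiff R (n := 2)
  rw [show (2 : WithTop ℕ∞) = 1 + 1 by norm_num, contDiff_succ_iff_deriv] at h3
  obtain ⟨h1, -, h2⟩ := h3
  obtain ⟨h2, h3⟩ := contDiff_one_iff_deriv.1 h2
  refine ⟨fun s => (h1 s).hasDerivAt, fun s => (h2 s).hasDerivAt, h3, flatProf_nonneg R, fun s hs => ?_⟩
  have hz : ∀ s, 9 * R ^ 2 / 16 < s → deriv (flatProf R) s = 0 := by
    intro s hs
    have : flatProf R =ᶠ[𝓝 s] fun _ => 0 := by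
      filter_upwards [Ioi_mem_nhds hs] with y hy using flatProf_eq_zero hR (le_of_lt hy)
    rw [this.deriv_eq]; simp
  have hs' : 9 * R ^ 2 / 16 < s := by nlinarith [sq_pos_of_pos hR]
  refine ⟨flatProf_eq_zero hR hs'.le, hz s hs', ?_⟩
  have : deriv (flatProf R) =ᶠ[𝓝 s] fun _ => 0 := by
    filter_upwards [Ioi_mem_nhds hs'] with y hy using hz y hy
  rw [this.deriv_eq]; simp

lemma flatProf_deriv_eq_zero {R : ℝ} (hR : 0 < R) {s : ℝ} (hs : s < R ^ 2 / 4) :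
    deriv (flatProf R) s = 0 ∧ deriv (deriv (flatProf R)) s = 0 := by
  have hz : ∀ s, s < R ^ 2 / 4 → deriv (flatProf R) s = 0 := by
    intro s hs
    have : flatProf R =ᶠ[𝓝 s] fun _ => 1 := by
      filter_upwards [Iio_mem_nhds hs] with y hy using flatProf_eq_one hR (le_of_lt hy)
    rw [this.deriv_eq]; simp
  refine ⟨hz s hs, ?_⟩
  have : deriv (flatProf R) =ᶠ[𝓝 s] fun _ => 0 := by
    filter_upwards [Iio_mem_nhds hs] with y hy using hz y hy
  rw [this.deriv_eq]; simp

variable {N : ℕ}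
local notation "𝔼" => EuclideanSpace ℝ (Fin N)

lemma integral_heatKer {τ : ℝ} (hτ : 0 < τ) (x₀ : 𝔼) : ∫ y : 𝔼, heatKer N τ (‖y - x₀‖ ^ 2) = 1 := by
  rw [integral_sub_right_eq_self (fun y : 𝔼 => heatKer N τ (‖y‖ ^ 2)) x₀]
  unfold heatKer
  rw [integral_const_mul]
  have := GaussianFourier.integral_rexp_neg_mul_sq_norm (V := 𝔼) (b := 1 / (4 * τ)) (by positivity)
  have e : ∀ y : 𝔼, -‖y‖ ^ 2 / (4 * τ) = -(1 / (4 * τ)) * ‖y‖ ^ 2 := fun y => by ring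
  simp only [e, this, finrank_euclideanSpace, Fintype.card_fin]
  rw [show π / (1 / (4 * τ)) = 4 * π * τ by field_simp, ← rpow_add (by positivity)]
  simp

lemma integrable_heatKer {τ : ℝ} (hτ : 0 < τ) (x₀ : 𝔼) :
    Integrable fun y : 𝔼 => heatKer N τ (‖y - x₀‖ ^ 2) := by
  by_contra h
  have := integral_undef h
  rw [integral_heatKer hτ] at this
  norm_num at this

lemma tendsto_integral_heatKer {f : 𝔼 → ℝ} {x₀ : 𝔼} (hf : Integrable f) (hc : ContinuousAt f x₀) :
    Tendsto (fun c : ℝ => ∫ y, heatKer N (c⁻¹ ^ 2) (‖y - x₀‖ ^ 2) * f y) Filter.atTop (𝓝 (f x₀)) := by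
  have h1 : ∫ z : 𝔼, heatKer N 1 (‖z‖ ^ 2) = 1 := by
    have := integral_heatKer one_pos (0 : 𝔼)
    simpa using this
  have h2 : Tendsto (fun z : 𝔼 => ‖z‖ ^ Module.finrank ℝ 𝔼 * heatKer N 1 (‖z‖ ^ 2))
      (Bornology.cobounded 𝔼) (𝓝 0) := by
    have a1 : Tendsto (fun z : 𝔼 => ‖z‖ ^ 2) (Bornology.cobounded 𝔼) Filter.atTop :=
      (Filter.tendsto_pow_atTop two_ne_zero).comp tendsto_norm_cobounded_atTop
    have a2 := ((tendsto_rpow_mul_exp_neg_mul_atTop_nhds_zero ((N : ℝ) / 2) (1 / 4) (by norm_num)).comp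
      a1).const_mul ((4 * π * 1) ^ (-((N : ℝ) / 2)))
    rw [mul_zero] at a2
    refine a2.congr fun z => ?_
    simp only [Function.comp, heatKer, finrank_euclideanSpace, Fintype.card_fin]
    have : (‖z‖ ^ 2) ^ ((N : ℝ) / 2) = ‖z‖ ^ N := by
      rw [← rpow_natCast ‖z‖ 2, ← rpow_mul (norm_nonneg _), ← rpow_natCast ‖z‖ N]
      congr 1; push_cast; ring
    rw [this, show -‖z‖ ^ 2 / (4 * 1) = -(1 / 4) * ‖z‖ ^ 2 by ring]; ring
  have := tendsto_integral_comp_smul_smul_of_integrable' (F := 𝔼) (μ := volume)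
    (fun z => heatKer_nonneg N one_pos (‖z‖ ^ 2)) h1 h2 hf hc
  refine this.congr' ?_
  filter_upwards [Filter.eventually_gt_atTop 0] with c hc0
  refine integral_congr_ae (Filter.Eventually.of_forall fun y => ?_)
  simp only [smul_eq_mul, finrank_euclideanSpace, Fintype.card_fin]
  congr 1
  unfold heatKer
  rw [norm_smul, mul_pow, norm_sub_rev, Real.norm_eq_abs, sq_abs, ← mul_assoc]
  congr 1
  · have e : c ^ N = (c⁻¹ ^ 2) ^ (-((N : ℝ) / 2)) := by
      rw [← rpow_natCast (c⁻¹) 2, ← rpow_mul (by positivity), inv_rpow hc0.le, ← rpow_neg hc0.le,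
        ← rpow_natCast]
      congr 1; push_cast; ring
    rw [e, mul_one, ← mul_rpow (by positivity) (by positivity), mul_comm]
  · congr 1; field_simp

lemma le_of_forall_kernel {v : 𝔼 → ℝ} {x₀ : 𝔼} {R l t A : ℝ} {h h₁ h₂ : ℝ → ℝ} (hR : 0 < R)
    (hp : Profile h h₁ h₂ R) (hv : ContinuousOn v (closedBall x₀ R))
    (hA : ∀ ε ∈ Ioc (0 : ℝ) 1, A ≤ ∫ y, v y * kerTest x₀ l ε t h y t) : A ≤ v x₀ * h 0 := by
  have hc : Continuous fun y : 𝔼 => h (‖y - x₀‖ ^ 2) :=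
    hp.contDiff.continuous.comp (contDiff_norm_sub_sq x₀).continuous
  have hi : Integrable fun y => v y * h (‖y - x₀‖ ^ 2) := by
    refine integrable_of_continuousOn_closedBall (x₀ := x₀) (ρ := R) (hv.mul hc.continuousOn) fun y hy => ?_
    rw [mem_closedBall, dist_eq_norm, not_le] at hy
    rw [(hp.zero _ (by gcongr)).1, mul_zero]
  have hat : ContinuousAt (fun y => v y * h (‖y - x₀‖ ^ 2)) x₀ :=
    (hv.continuousAt (closedBall_mem_nhds _ hR)).mul hc.continuousAt
  have := tendsto_integral_heatKer hi hat
  simp only [sub_self, norm_zero, ne_eq, OfNat.ofNat_ne_zero, not_false_eq_true, zero_pow] at this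
  refine ge_of_tendsto this ?_
  filter_upwards [Filter.eventually_ge_atTop 1] with c hc1
  have h0 : 0 < c := by linarith
  refine (hA (c⁻¹ ^ 2) ⟨by positivity, pow_le_one₀ (by positivity) (inv_le_one_of_one_le₀ hc1)⟩).trans_eq ?_
  refine integral_congr_ae (Filter.Eventually.of_forall fun y => ?_)
  simp only [kerTest, sub_self, mul_zero, exp_zero, one_mul, add_sub_cancel_left]; ring

end HeatKernel

section HeatKernel
variable {N : ℕ}
local notation "𝔼" => EuclideanSpace ℝ (Fin N)

/-- Lower bound through the truncated heat kernel, flat cutoff. -/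
lemma heat_lower_flat (hN : 1 ≤ N) {R : ℝ} (hR : 0 < R) : ∃ C, 0 ≤ C ∧
    ∀ (v g : 𝔼 → ℝ → ℝ) (x₀ : 𝔼) (ρ₁ t₁ t₂ G A : ℝ) (m : ℝ → ℝ), R < ρ₁ → t₁ ≤ t₂ →
      SepCont v x₀ R (Icc t₁ t₂) → SepCont g x₀ R (Icc t₁ t₂) → WeakSuper v g x₀ ρ₁ t₁ t₂ → 0 ≤ G →
      (∀ y ∈ closedBall x₀ R, ∀ t ∈ Icc t₁ t₂, -G ≤ g y t) →
      ContinuousOn m (Icc t₁ t₂) → (∀ t ∈ Icc t₁ t₂, ∫ y in closedBall x₀ R, |v y t| ≤ m t) →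
      (∀ ε ∈ Ioc (0 : ℝ) 1, A ≤ ∫ y, v y t₁ * kerTest x₀ 0 ε t₂ (flatProf R) y t₁) →
      A - C * (∫ t in t₁..t₂, m t) - G * (t₂ - t₁) ≤ v x₀ t₂ := by
  obtain ⟨C1, hC10, hC1⟩ := exists_heatKer_bound hN (show (0 : ℝ) < R ^ 2 / 4 by positivity)
  have hp := profile_flat hR
  have c1 : Continuous (deriv (flatProf R)) :=
    continuous_iff_continuousAt.2 fun s => (hp.d₂ s).continuousAt
  obtain ⟨K1, hK1⟩ := (isCompact_Icc (a := (0 : ℝ)) (b := R ^ 2)).exists_bound_of_continuousOn c1.continuousOn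
  obtain ⟨K2, hK2⟩ := (isCompact_Icc (a := (0 : ℝ)) (b := R ^ 2)).exists_bound_of_continuousOn hp.cont.continuousOn
  have hK10 : 0 ≤ K1 := (norm_nonneg _).trans (hK1 0 ⟨le_rfl, by positivity⟩)
  have hK20 : 0 ≤ K2 := (norm_nonneg _).trans (hK2 0 ⟨le_rfl, by positivity⟩)
  set C := C1 * (4 * R ^ 2 * K2 + 2 * N * K1 + 2 * R ^ 2 * K1) with hC
  have hC0 : 0 ≤ C := by positivity
  refine ⟨C, hC0, ?_⟩
  intro v g x₀ ρ₁ t₁ t₂ G A m hRρ h12 hv hg hW hG hgG hm hmv hA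
  have hmi : IntervalIntegrable m volume t₁ t₂ := hm.intervalIntegrable_of_Icc h12
  suffices h : ∀ ε ∈ Ioc (0 : ℝ) 1, A - C * (∫ t in t₁..t₂, m t) - G * (t₂ - t₁) ≤
      ∫ y, v y t₂ * kerTest x₀ 0 ε t₂ (flatProf R) y t₂ by
    have := le_of_forall_kernel hR hp (hv.space t₂ (right_mem_Icc.2 h12)) h
    rwa [flatProf_eq_one hR (by positivity), mul_one] at this
  intro ε hε
  have hT := isTest_ker (N := N) (l := 0) (t₁ := t₁) (t₂ := t₂) x₀ hε.1 hR.le hp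
  have h1 := hW R hRρ _ _ _ hT
  have h2 := hA ε hε
  set ηt := kerTestT (N := N) x₀ 0 ε t₂ (flatProf R)
  set ηL := kerTestL (N := N) x₀ 0 ε t₂ (flatProf R) (deriv (flatProf R)) (deriv (deriv (flatProf R)))
  set η := kerTest (N := N) x₀ 0 ε t₂ (flatProf R)
  have hq := continuousOn_weakDensity hv hg hT
  have hqi : IntervalIntegrable (weakDensity v g η ηt ηL) volume t₁ t₂ := hq.intervalIntegrable_of_Icc h12
  have h3 : ∫ t in t₁..t₂, (-C * m t - G) ≤ ∫ t in t₁..t₂, weakDensity v g η ηt ηL t := by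
    refine intervalIntegral.integral_mono_on h12
      ((hmi.const_mul (-C)).sub intervalIntegrable_const) hqi fun t ht => ?_
    have hτ : 0 < t₂ + ε - t := by linarith [ht.2, hε.1]
    have b1 : ∀ y ∈ closedBall x₀ R, |ηt y t + ηL y t| ≤ C := by
      intro y hy
      rw [mem_closedBall, dist_eq_norm] at hy
      have hs0 : (0 : ℝ) ≤ ‖y - x₀‖ ^ 2 := by positivity
      have hs : ‖y - x₀‖ ^ 2 ≤ R ^ 2 := by gcongr
      have := kerTest_add x₀ (l := 0) (flatProf R) (deriv (flatProf R)) (deriv (deriv (flatProf R))) y hτ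
      rw [show ηt y t + ηL y t = _ from this]
      generalize ‖y - x₀‖ ^ 2 = s at hs0 hs
      rcases lt_or_ge s (R ^ 2 / 4) with hlt | hge
      · obtain ⟨z1, z2⟩ := flatProf_deriv_eq_zero hR hlt
        simp [z1, z2, hC0]
      · obtain ⟨k1, k2⟩ := hC1 _ hτ s hge
        have a1 := hK1 s ⟨hs0, hs⟩
        have a2 := hK2 s ⟨hs0, hs⟩
        have hk := heatKer_nonneg N hτ s
        rw [Real.norm_eq_abs] at a1 a2
        generalize heatKer N (t₂ + ε - t) s = H at k1 k2 hk
        generalize deriv (flatProf R) s = d1 at a1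
        generalize deriv (deriv (flatProf R)) s = d2 at a2
        have e : exp (-0 * (t₂ - t)) * H * (0 * flatProf R s + 4 * s * d2 + 2 * N * d1
            - 2 * s * d1 / (t₂ + ε - t)) = H * (4 * s * d2) + H * (2 * N * d1)
              - (H / (t₂ + ε - t)) * (2 * s * d1) := by
          simp; ring
        rw [e, hC]
        have hk' : 0 ≤ H / (t₂ + ε - t) := by positivity
        have q1 : |H * (4 * s * d2)| ≤ C1 * (4 * R ^ 2 * K2) := by
          rw [abs_mul, abs_mul, abs_of_nonneg hk, abs_of_nonneg (by positivity : 0 ≤ 4 * s)]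
          gcongr
        have q2 : |H * (2 * N * d1)| ≤ C1 * (2 * N * K1) := by
          rw [abs_mul, abs_mul, abs_of_nonneg hk, abs_of_nonneg (by positivity : (0 : ℝ) ≤ 2 * N)]
          gcongr
        have q3 : |(H / (t₂ + ε - t)) * (2 * s * d1)| ≤ C1 * (2 * R ^ 2 * K1) := by
          rw [abs_mul, abs_mul, abs_of_nonneg hk', abs_of_nonneg (by positivity : 0 ≤ 2 * s)]
          gcongr
        have p1 := abs_sub (H * (4 * s * d2) + H * (2 * N * d1)) ((H / (t₂ + ε - t)) * (2 * s * d1))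
        have p2 := abs_add_le (H * (4 * s * d2)) (H * (2 * N * d1))
        linarith
    have b2 : -(C * m t) ≤ ∫ y, v y t * (ηt y t + ηL y t) := by
      have e : ∫ y, v y t * (ηt y t + ηL y t) = ∫ y in closedBall x₀ R, v y t * (ηt y t + ηL y t) := by
        refine (setIntegral_eq_integral_of_forall_compl_eq_zero fun y hy => ?_).symm
        rw [hT.supp_t y hy t ht, hT.supp_L y hy t ht]; simp
      have hvi : IntegrableOn (fun y => |v y t|) (closedBall x₀ R) :=
        ((hv.space t ht).abs).integrableOn_compact (isCompact_closedBall _ _)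
      have : ‖∫ y in closedBall x₀ R, v y t * (ηt y t + ηL y t)‖ ≤ ∫ y in closedBall x₀ R, C * |v y t| := by
        refine norm_integral_le_of_norm_le (hvi.const_mul C) ?_
        refine (ae_restrict_iff' isClosed_closedBall.measurableSet).2 (Filter.Eventually.of_forall fun y hy => ?_)
        rw [norm_mul, mul_comm C]
        exact mul_le_mul_of_nonneg_left (b1 y hy) (abs_nonneg _)
      rw [integral_const_mul, Real.norm_eq_abs, abs_le] at this
      have := mul_le_mul_of_nonneg_left (hmv t ht) hC0
      rw [e]; linarith
    have b3 : -G ≤ ∫ y, g y t * η y t := by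
      have i1 := integrable_heatKer hτ x₀
      have i2 := hg.integrable_mul hT.cont hT.supp ht
      have : ∫ y : 𝔼, -G * heatKer N (t₂ + ε - t) (‖y - x₀‖ ^ 2) ≤ ∫ y, g y t * η y t := by
        refine integral_mono (i1.const_mul _) i2 fun y => ?_
        have hk := heatKer_nonneg N hτ (‖y - x₀‖ ^ 2)
        by_cases hy : y ∈ closedBall x₀ R
        · have n0 := hT.nonneg y t ht
          have n1 : η y t ≤ heatKer N (t₂ + ε - t) (‖y - x₀‖ ^ 2) := by
            have := mul_le_mul_of_nonneg_left (flatProf_le_one R (‖y - x₀‖ ^ 2)) hk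
            simpa [η, kerTest] using this
          have := hgG y hy t ht
          change _ ≤ g y t * η y t
          have n0' : 0 ≤ η y t := n0
          nlinarith
        · change _ ≤ g y t * η y t
          rw [show η y t = 0 from hT.supp y hy t ht]
          nlinarith
      rw [integral_const_mul, integral_heatKer hτ] at this
      linarith
    change _ ≤ (∫ y, v y t * (ηt y t + ηL y t)) + ∫ y, g y t * η y t
    linarith
  rw [intervalIntegral.integral_sub (hmi.const_mul (-C)) intervalIntegrable_const,
    intervalIntegral.integral_const_mul, intervalIntegral.integral_const,
    smul_eq_mul] at h3
  linarith

/-- Lower bound through a truncated heat kernel which is a subsolution. -/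
lemma heat_lower_pos {R l : ℝ} (hR : 0 < R) (hl : (6 * N + 24) ^ 2 / (96 * R ^ 2) ≤ l)
    {v g : 𝔼 → ℝ → ℝ} {x₀ : 𝔼} {ρ₁ t₁ t₂ A : ℝ} (hRρ : R < ρ₁) (h12 : t₁ ≤ t₂)
    (hv : SepCont v x₀ R (Icc t₁ t₂)) (hW : WeakSuper v g x₀ ρ₁ t₁ t₂)
    (hv0 : ∀ y ∈ closedBall x₀ R, ∀ t ∈ Icc t₁ t₂, 0 ≤ v y t)
    (hg0 : ∀ y ∈ closedBall x₀ R, ∀ t ∈ Icc t₁ t₂, 0 ≤ g y t)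
    (hA : ∀ ε ∈ Ioc (0 : ℝ) 1, A ≤ ∫ y, v y t₁ * kerTest x₀ l ε t₂ (cubeProf R) y t₁) : A ≤ v x₀ t₂ := by
  have hp := profile_cube hR
  suffices h : ∀ ε ∈ Ioc (0 : ℝ) 1, A ≤ ∫ y, v y t₂ * kerTest x₀ l ε t₂ (cubeProf R) y t₂ by
    have := le_of_forall_kernel hR hp (hv.space t₂ (right_mem_Icc.2 h12)) h
    simpa [cubeProf] using this
  intro ε hε
  have hT := isTest_ker (N := N) (l := l) (t₁ := t₁) (t₂ := t₂) x₀ hε.1 hR.le hp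
  have h1 := hW R hRρ _ _ _ hT
  refine (hA ε hε).trans (le_trans ?_ h1)
  refine le_add_of_nonneg_right (intervalIntegral.integral_nonneg h12 fun t ht => add_nonneg ?_ ?_)
  · refine integral_nonneg fun y => ?_
    by_cases hy : y ∈ closedBall x₀ R
    · refine mul_nonneg (hv0 y hy t ht) ?_
      have hτ : 0 < t₂ + ε - t := by linarith [ht.2, hε.1]
      rw [kerTest_add x₀ _ _ _ y hτ]
      refine mul_nonneg (mul_nonneg (exp_pos _).le (heatKer_nonneg N hτ _)) ?_
      rw [mem_closedBall, dist_eq_norm] at hy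
      have hs0 : (0 : ℝ) ≤ ‖y - x₀‖ ^ 2 := by positivity
      have hs : ‖y - x₀‖ ^ 2 ≤ R ^ 2 := by gcongr
      generalize ‖y - x₀‖ ^ 2 = s at hs0 hs
      have hz : 0 ≤ 1 - s / R ^ 2 := by
        rw [sub_nonneg, div_le_one (by positivity)]; exact hs
      obtain ⟨z, rfl⟩ : ∃ z, s = R ^ 2 * (1 - z) := ⟨1 - s / R ^ 2, by field_simp; ring⟩
      have e : 1 - R ^ 2 * (1 - z) / R ^ 2 = z := by field_simp; ring
      rw [e] at hz
      simp only [cubeProf, e, max_eq_left hz]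
      have k1 : l * z ^ 3 + 4 * (R ^ 2 * (1 - z)) * (6 / R ^ 4 * z) + 2 * N * (-3 / R ^ 2 * z ^ 2)
          - 2 * (R ^ 2 * (1 - z)) * (-3 / R ^ 2 * z ^ 2) / (t₂ + ε - t) =
          z / R ^ 2 * (l * R ^ 2 * z ^ 2 - (6 * N + 24) * z + 24)
            + 6 * (R ^ 2 * (1 - z)) / R ^ 2 * z ^ 2 / (t₂ + ε - t) := by
        field_simp; ring
      rw [k1]
      rw [div_le_iff₀ (by positivity)] at hl
      have k2 : 0 ≤ l * R ^ 2 * z ^ 2 - (6 * N + 24) * z + 24 := by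
        nlinarith [sq_nonneg ((6 * N + 24) * z - 48), mul_le_mul_of_nonneg_right hl (sq_nonneg z)]
      positivity
    · rw [hT.supp_t y hy t ht, hT.supp_L y hy t ht]; simp
  · refine integral_nonneg fun y => ?_
    by_cases hy : y ∈ closedBall x₀ R
    · exact mul_nonneg (hg0 y hy t ht) (hT.nonneg y t ht)
    · rw [hT.supp y hy t ht]; simp

end HeatKernel

lemma exists_local_subset_of_baire {X : Type*} [TopologicalSpace X] [T2Space X] [LocallyCompactSpace X]
    {S : Set X} (hS : IsLocallyClosed S) (hne : S.Nonempty) (A : ℕ → Set X) (hcov : S ⊆ ⋃ n, A n)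
    (hcl : ∀ n, ∀ x ∈ S, x ∈ closure (A n ∩ S) → x ∈ A n) :
    ∃ n, ∃ P ∈ S, ∃ V ∈ 𝓝 P, S ∩ V ⊆ A n := by
  have : LocallyCompactSpace S := hS.locallyCompactSpace
  have : Nonempty S := hne.to_subtype
  have hc : ∀ n, IsClosed ((Subtype.val : S → X) ⁻¹' A n) := by
    intro n
    refine isClosed_of_closure_subset fun x hx => ?_
    rw [closure_subtype] at hx
    refine hcl n x x.2 (closure_mono ?_ hx)
    rintro _ ⟨y, hy, rfl⟩
    exact ⟨hy, y.2⟩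
  have hu : ⋃ n, (Subtype.val : S → X) ⁻¹' A n = univ := by
    rw [← preimage_iUnion]
    exact eq_univ_of_forall fun x => hcov x.2
  obtain ⟨n, P, hP⟩ := nonempty_interior_of_iUnion_of_closed hc hu
  have hP' := mem_interior_iff_mem_nhds.1 hP
  rw [nhds_subtype_eq_comap, Filter.mem_comap] at hP'
  obtain ⟨V, hV, hVA⟩ := hP'
  exact ⟨n, P, P.2, V, hV, fun x hx => hVA (show (⟨x, hx.1⟩ : S).1 ∈ V from hx.2)⟩

lemma le_of_gap_of_slope {f : ℝ → ℝ} {a b : ℝ} {T : Set ℝ} (hT : IsClosed T) (ha : a ∈ T)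
    (hf : ContinuousOn f (Icc a b))
    (hgap : ∀ c ∈ T ∩ Icc a b, ∀ s ∈ Ioc c b, (∀ u ∈ Ioc c s, u ∉ T) → f c ≤ f s)
    (hslope : ∀ c ∈ T ∩ Ico a b, ∀ᶠ s in 𝓝[>] c, f c ≤ f s) : ∀ s ∈ Icc a b, f a ≤ f s := by
  let A : Set ℝ := {s | ∀ u ∈ Icc a s, f a ≤ f u}
  rcases lt_or_ge b a with hba | hab
  · intro s hs; linarith [hs.1, hs.2]
  have hcl : IsClosed (A ∩ Icc a b) := by
    refine isClosed_of_closure_subset fun s hs => ?_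
    have hsI : s ∈ Icc a b := isClosed_Icc.closure_subset_iff.2 inter_subset_right hs
    refine ⟨fun u hu => ?_, hsI⟩
    by_cases h : ∃ s' ∈ A ∩ Icc a b, u ≤ s'
    · obtain ⟨s', hs', hus⟩ := h
      exact hs'.1 u ⟨hu.1, hus⟩
    · push Not at h
      have hus : u = s := by
        refine le_antisymm hu.2 ?_
        exact closure_minimal (s := A ∩ Icc a b) (t := Iic u) (fun s' hs' => (h s' hs').le) isClosed_Iic hs
      subst hus
      have h1 : ContinuousWithinAt f (A ∩ Icc a b) u := (hf u hsI).mono inter_subset_right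
      have := mem_closure_iff_nhdsWithin_neBot.1 hs
      refine ge_of_tendsto h1 ?_
      filter_upwards [self_mem_nhdsWithin] with s' hs'
      exact hs'.1 s' ⟨hs'.2.1, le_rfl⟩
  have haA : a ∈ A := fun u hu => by rw [le_antisymm hu.2 hu.1]
  have := hcl.Icc_subset_of_forall_exists_gt haA ?_
  · intro s hs; exact this hs s ⟨hs.1, le_rfl⟩
  intro x hx y hy
  suffices h : ∀ᶠ s in 𝓝[>] x, f a ≤ f s by
    obtain ⟨u, hu, hus⟩ := (mem_nhdsGT_iff_exists_Ioo_subset).1 h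
    have hxu : x < u := hu
    have hxy : x < y := hy
    obtain ⟨z, hz1, hz2⟩ := exists_between (lt_min hxu hxy)
    refine ⟨z, fun w hw => ?_, hz1, (hz2.trans_le (min_le_right _ _)).le⟩
    rcases le_or_gt w x with hwx | hwx
    · exact hx.1 w ⟨hw.1, hwx⟩
    · exact hus ⟨hwx, hw.2.trans_lt (hz2.trans_le (min_le_left _ _))⟩
  have hfx : f a ≤ f x := hx.1 x ⟨hx.2.1, le_rfl⟩
  by_cases hxT : x ∈ T
  · filter_upwards [hslope x ⟨hxT, hx.2⟩] with s hs using hfx.trans hs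
  · have hnear : ∀ᶠ s in 𝓝[≥] x, s ∉ T := nhdsWithin_le_nhds (hT.isOpen_compl.mem_nhds hxT)
    obtain ⟨u, hu, hus⟩ := (mem_nhdsGE_iff_exists_Ico_subset).1 hnear
    filter_upwards [Ioo_mem_nhdsGT (hu : x < u), Ioc_mem_nhdsGT hx.2.2] with s hs hsb
    have hcomp : IsCompact (T ∩ Icc a x) := isCompact_Icc.inter_left hT
    obtain ⟨c, hc, hmax⟩ := hcomp.exists_isGreatest ⟨a, ha, le_rfl, hx.2.1⟩
    refine (hx.1 c hc.2).trans (hgap c ⟨hc.1, hc.2.1, hc.2.2.trans hx.2.2.le⟩ s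
      ⟨hc.2.2.trans_lt hs.1, hsb.2⟩ fun w hw hwT => ?_)
    rcases lt_or_ge w x with hwx | hwx
    · exact absurd (hmax ⟨hwT, hc.2.1.trans hw.1.le, hwx.le⟩) (not_le.2 hw.1)
    · exact hus ⟨hwx, hw.2.trans_lt hs.2⟩ hwT

section WeakFormulation
variable {N : ℕ}
local notation "𝔼" => EuclideanSpace ℝ (Fin N)

lemma IsTest.recenter {x₀ x₁ : 𝔼} {ρ ρ' t₁ t₂ : ℝ} {η ηt ηL : 𝔼 → ℝ → ℝ}
    (h : IsTest x₀ ρ t₁ t₂ η ηt ηL) (hs : closedBall x₀ ρ ⊆ closedBall x₁ ρ') :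
    IsTest x₁ ρ' t₁ t₂ η ηt ηL where
  cont := h.cont
  cont_t := h.cont_t
  cont_L := h.cont_L
  nonneg := h.nonneg
  supp y hy t ht := h.supp y (fun hh => hy (hs hh)) t ht
  supp_t y hy t ht := h.supp_t y (fun hh => hy (hs hh)) t ht
  supp_L y hy t ht := h.supp_L y (fun hh => hy (hs hh)) t ht
  hasDeriv := h.hasDeriv
  smooth := h.smooth
  lap_eq := h.lap_eq

lemma WeakSuper.recenter {v g : 𝔼 → ℝ → ℝ} {x₀ x₁ : 𝔼} {ρ ρ' t₁ t₂ : ℝ}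
    (h : WeakSuper v g x₀ ρ t₁ t₂) (hs : dist x₁ x₀ + ρ' ≤ ρ) : WeakSuper v g x₁ ρ' t₁ t₂ := by
  intro r hr η ηt ηL hη
  refine h (dist x₁ x₀ + r) (by linarith) η ηt ηL (hη.recenter ?_)
  exact closedBall_subset_closedBall' (by linarith)

lemma WeakSuper.add {v g v' g' : 𝔼 → ℝ → ℝ} {x₀ : 𝔼} {ρ₁ t₁ t₂ : ℝ} (h12 : t₁ ≤ t₂)
    (h : WeakSuper v g x₀ ρ₁ t₁ t₂) (h' : WeakSuper v' g' x₀ ρ₁ t₁ t₂)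
    (hv : SepCont v x₀ ρ₁ (Icc t₁ t₂)) (hg : SepCont g x₀ ρ₁ (Icc t₁ t₂))
    (hv' : SepCont v' x₀ ρ₁ (Icc t₁ t₂)) (hg' : SepCont g' x₀ ρ₁ (Icc t₁ t₂)) :
    WeakSuper (fun y t => v y t + v' y t) (fun y t => g y t + g' y t) x₀ ρ₁ t₁ t₂ := by
  intro ρ hρ η ηt ηL hη
  have hb : closedBall x₀ ρ ⊆ closedBall x₀ ρ₁ := closedBall_subset_closedBall hρ.le
  replace hv := hv.mono hb subset_rfl
  replace hg := hg.mono hb subset_rfl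
  replace hv' := hv'.mono hb subset_rfl
  replace hg' := hg'.mono hb subset_rfl
  have e1 := h ρ hρ η ηt ηL hη
  have e2 := h' ρ hρ η ηt ηL hη
  have l1 := left_mem_Icc.2 h12
  have l2 := right_mem_Icc.2 h12
  have hd : ∀ t ∈ Icc t₁ t₂, weakDensity (fun y t => v y t + v' y t) (fun y t => g y t + g' y t) η ηt ηL t
      = weakDensity v g η ηt ηL t + weakDensity v' g' η ηt ηL t := by
    intro t ht
    have hs := fun y hy t (ht : t ∈ Icc t₁ t₂) => show ηt y t + ηL y t = 0 by
      rw [hη.supp_t y hy t ht, hη.supp_L y hy t ht, add_zero]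
    have a1 := hv.integrable_mul (η := fun y t => ηt y t + ηL y t) (hη.cont_t.add hη.cont_L) hs ht
    have a2 := hv'.integrable_mul (η := fun y t => ηt y t + ηL y t) (hη.cont_t.add hη.cont_L) hs ht
    have a3 := hg.integrable_mul hη.cont hη.supp ht
    have a4 := hg'.integrable_mul hη.cont hη.supp ht
    simp only [weakDensity, add_mul (v _ _), add_mul (g _ _)]
    rw [integral_add a1 a2, integral_add a3 a4]; ring
  have q1 : IntervalIntegrable (weakDensity v g η ηt ηL) volume t₁ t₂ :=
    (continuousOn_weakDensity hv hg hη).intervalIntegrable_of_Icc h12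
  have q2 : IntervalIntegrable (weakDensity v' g' η ηt ηL) volume t₁ t₂ :=
    (continuousOn_weakDensity hv' hg' hη).intervalIntegrable_of_Icc h12
  rw [intervalIntegral.integral_congr (g := fun t => weakDensity v g η ηt ηL t + weakDensity v' g' η ηt ηL t)
    (fun t ht => hd t (by rwa [uIcc_of_le h12] at ht)), intervalIntegral.integral_add q1 q2]
  simp only [add_mul]
  rw [integral_add (hv.integrable_mul hη.cont hη.supp l1) (hv'.integrable_mul hη.cont hη.supp l1),
    integral_add (hv.integrable_mul hη.cont hη.supp l2) (hv'.integrable_mul hη.cont hη.supp l2)]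
  linarith

/-- A weak inequality on short intervals to the right of `t` bounds the right slope at `t`. -/
lemma slope_of_local {v g η ηt ηL : 𝔼 → ℝ → ℝ} {x₀ : 𝔼} {ρ ρ₁ t₁ t₂ t ε : ℝ} (ht : t ∈ Ico t₁ t₂)
    (hρ : ρ < ρ₁) (hv : SepCont v x₀ ρ (Icc t₁ t₂)) (hg : SepCont g x₀ ρ (Icc t₁ t₂))
    (hη : IsTest x₀ ρ t₁ t₂ η ηt ηL) (hε : 0 < ε)
    (h : ∀ᶠ s in 𝓝[>] t, WeakSuper v g x₀ ρ₁ t s) :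
    ∀ᶠ s in 𝓝[>] t, (weakDensity v g η ηt ηL t - ε) * (s - t) ≤
      (∫ y, v y s * η y s) - ∫ y, v y t * η y t := by
  set q := weakDensity v g η ηt ηL
  have htI : t ∈ Icc t₁ t₂ := Ico_subset_Icc_self ht
  have hq : ContinuousOn q (Icc t₁ t₂) := continuousOn_weakDensity hv hg hη
  have hnear : ∀ᶠ s in 𝓝[>] t, q t - ε ≤ q s := by
    have h1 : Tendsto q (𝓝[>] t) (𝓝 (q t)) := by
      refine (hq t htI).mono_left ?_
      rw [nhdsWithin_le_iff]
      exact Filter.mem_of_superset (Ioc_mem_nhdsGT ht.2) fun s hs => ⟨ht.1.trans hs.1.le, hs.2⟩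
    exact h1.eventually (le_mem_nhds (by linarith))
  obtain ⟨u, hu, hus⟩ := (mem_nhdsGT_iff_exists_Ioo_subset).1 hnear
  filter_upwards [h, Ioo_mem_nhdsGT (hu : t < u), Ioc_mem_nhdsGT ht.2] with s hs hsu hs2
  have hts : t ≤ s := hs2.1.le
  have hqts : IntervalIntegrable q volume t s :=
    (hq.mono (Icc_subset_Icc ht.1 hs2.2)).intervalIntegrable_of_Icc hts
  have hle : (q t - ε) * (s - t) ≤ ∫ x in t..s, q x := by
    have := intervalIntegral.integral_mono_on hts (intervalIntegrable_const (c := q t - ε)) hqts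
      (fun x hx => ?_)
    · rw [intervalIntegral.integral_const, smul_eq_mul] at this; linarith
    · rcases hx.1.eq_or_lt with rfl | hx1
      · linarith
      · exact hus ⟨hx1, hx.2.trans_lt hsu.2⟩
  have := hs ρ hρ η ηt ηL (hη.mono (Icc_subset_Icc ht.1 hs2.2))
  change _ + ∫ x in t..s, q x ≤ _ at this
  linarith

lemma WeakSuper.extend_left {v g : 𝔼 → ℝ → ℝ} {x₀ : 𝔼} {ρ₁ c s : ℝ} (hcs : c < s)
    (hv : SepCont v x₀ ρ₁ (Icc c s)) (hg : SepCont g x₀ ρ₁ (Icc c s))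
    (h : ∀ c' ∈ Ioo c s, WeakSuper v g x₀ ρ₁ c' s) : WeakSuper v g x₀ ρ₁ c s := by
  intro ρ hρ η ηt ηL hη
  have hb : closedBall x₀ ρ ⊆ closedBall x₀ ρ₁ := closedBall_subset_closedBall hρ.le
  replace hv := hv.mono hb subset_rfl
  replace hg := hg.mono hb subset_rfl
  set q := weakDensity v g η ηt ηL
  have hq : ContinuousOn q (Icc c s) := continuousOn_weakDensity hv hg hη
  have hM := hv.continuousOn_integral isCompact_Icc hη.cont hη.supp
  have hP : ContinuousOn (fun t => ∫ x in t..s, q x) (Icc c s) := by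
    have := intervalIntegral.continuousOn_primitive_interval_left (μ := volume) (f := q) (a := c) (b := s)
      (by rw [uIcc_of_le hcs.le]; exact hq.integrableOn_Icc)
    rwa [uIcc_of_le hcs.le] at this
  have h1 := (hM.add hP) c (left_mem_Icc.2 hcs.le)
  have h2 : Tendsto (fun t => (∫ y, v y t * η y t) + ∫ x in t..s, q x) (𝓝[>] c)
      (𝓝 ((∫ y, v y c * η y c) + ∫ x in c..s, q x)) := by
    refine h1.mono_left ?_
    rw [nhdsWithin_le_iff]
    exact Filter.mem_of_superset (Ioc_mem_nhdsGT hcs) fun t ht => ⟨ht.1.le, ht.2⟩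
  refine le_of_tendsto h2 ?_
  filter_upwards [Ioo_mem_nhdsGT hcs] with t ht
  exact h t ht ρ hρ η ηt ηL (hη.mono (Icc_subset_Icc ht.1.le le_rfl))

lemma weakSuper_of_const {φ : 𝔼 → ℝ} {x₀ : 𝔼} {ρ₁ ρ₂ t₁ t₂ : ℝ} (hρ : ρ₁ < ρ₂) (h12 : t₁ ≤ t₂)
    (hφ : ContDiffOn ℝ 2 φ (ball x₀ ρ₂)) :
    WeakSuper (fun y _ => φ y) (fun y _ => -lap φ y) x₀ ρ₁ t₁ t₂ ∧
      SepCont (fun y _ => φ y) x₀ ρ₁ (Icc t₁ t₂) ∧ SepCont (fun y _ => -lap φ y) x₀ ρ₁ (Icc t₁ t₂) := by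
  have hsub : closedBall x₀ ρ₁ ⊆ ball x₀ ρ₂ := closedBall_subset_ball hρ
  have c1 : ContinuousOn φ (closedBall x₀ ρ₁) := hφ.continuousOn.mono hsub
  have c2 : ContinuousOn (fun y => -lap φ y) (closedBall x₀ ρ₁) :=
    ((continuousOn_lap isOpen_ball hφ).mono hsub).neg
  have sc : ∀ f : 𝔼 → ℝ, ContinuousOn f (closedBall x₀ ρ₁) →
      SepCont (fun y _ => f y) x₀ ρ₁ (Icc t₁ t₂) := fun f hf => by
    obtain ⟨K, hK⟩ := (isCompact_closedBall x₀ ρ₁).exists_bound_of_continuousOn hf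
    exact ⟨⟨K, fun y hy t _ => hK y hy⟩, fun t _ => hf, fun y _ => continuousOn_const⟩
  refine ⟨?_, sc _ c1, sc _ c2⟩
  intro ρ hρ' η ηt ηL hη
  have hb : closedBall x₀ ρ ⊆ closedBall x₀ ρ₁ := closedBall_subset_closedBall hρ'.le
  have s1 := (sc _ c1).mono hb subset_rfl
  have s2 := (sc _ c2).mono hb subset_rfl
  refine weak_of_slopes h12 s1 s2 hη fun t ht ε hε => ?_
  exact slope_lower_bound (C := 0) ht s1 s2 (hρ'.trans hρ) hφ
    (fun y _ => ⟨0, hasDerivAt_const _ _, by simp⟩) (fun y _ s _ => by simp) hη hε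

end WeakFormulation

section WeakFormulation
variable {N : ℕ}
local notation "𝔼" => EuclideanSpace ℝ (Fin N)

/-- Pointwise supersolutions `v_t - Δ v ≥ g` on `ball x₀ ρ × I`, with separate regularity. -/
structure PtSuper (v g : 𝔼 → ℝ → ℝ) (x₀ : 𝔼) (ρ : ℝ) (I : Set ℝ) : Prop where
  space : ∀ t ∈ I, ContDiffOn ℝ 2 (fun y => v y t) (ball x₀ ρ)
  time : ∀ y ∈ ball x₀ ρ, ∀ t ∈ I, ∃ w, HasDerivAt (v y) w t ∧ lap (fun y => v y t) y + g y t ≤ w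

lemma gap_lower (hN : 1 ≤ N) {v g : 𝔼 → ℝ → ℝ} {x₀ : 𝔼} {ρ₁ ρ₂ a b R : ℝ} (hρ : ρ₁ < ρ₂)
    (hv : SepCont v x₀ ρ₁ (Icc a b)) (hg : SepCont g x₀ ρ₁ (Icc a b))
    (hpt : PtSuper v g x₀ ρ₂ (Icc a b)) (n : ℕ) (hR : 0 < R) : ∃ C, 0 ≤ C ∧
      ∀ c s, a ≤ c → c < s → s ≤ b → (∀ c' ∈ Ioo c s, WeakSuper v g x₀ ρ₁ c' s) →
        (∀ y ∈ ball x₀ ρ₁, -(n : ℝ) ≤ lap (fun y => v y c) y) →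
        ∀ x, dist x x₀ + R < ρ₁ → v x c - C * (s - c) ≤ v x s := by
  obtain ⟨C1, hC10, hC1⟩ := heat_lower_flat hN hR
  obtain ⟨K', hK'⟩ := hv.bdd
  obtain ⟨L', hL'⟩ := hg.bdd
  obtain ⟨K, hK0, hK⟩ : ∃ K, 0 ≤ K ∧ ∀ y ∈ closedBall x₀ ρ₁, ∀ t ∈ Icc a b, |v y t| ≤ K :=
    ⟨|K'|, abs_nonneg _, fun y hy t ht => (hK' y hy t ht).trans (le_abs_self _)⟩
  obtain ⟨L, hL0, hL⟩ : ∃ K, 0 ≤ K ∧ ∀ y ∈ closedBall x₀ ρ₁, ∀ t ∈ Icc a b, |g y t| ≤ K :=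
    ⟨|L'|, abs_nonneg _, fun y hy t ht => (hL' y hy t ht).trans (le_abs_self _)⟩
  set M := (2 * K) * volume.real (closedBall (0 : 𝔼) R)
  refine ⟨C1 * M + (L + n), by positivity, ?_⟩
  intro c s hac hcs hsb hW hlap x hx
  have hsub : Icc c s ⊆ Icc a b := Icc_subset_Icc hac hsb
  have hc : c ∈ Icc a b := hsub (left_mem_Icc.2 hcs.le)
  have hv' := hv.mono subset_rfl hsub
  have hg' := hg.mono subset_rfl hsub
  have hxb : closedBall x R ⊆ ball x₀ ρ₁ := closedBall_subset_ball' (by linarith)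
  have hxb' : closedBall x R ⊆ closedBall x₀ ρ₁ := hxb.trans ball_subset_closedBall
  obtain ⟨w1, w2, w3⟩ := weakSuper_of_const (φ := fun y => -v y c) hρ hcs.le (hpt.space c hc).neg
  have hWs := (WeakSuper.extend_left hcs hv' hg' hW).add hcs.le w1 hv' hg' w2 w3
  have sD : SepCont (fun y t => v y t + -v y c) x₀ ρ₁ (Icc c s) :=
    ⟨⟨2 * K, fun y hy t ht => by
        have h1 := hK y hy t (hsub ht); have h2 := hK y hy c hc
        have := abs_add_le (v y t) (-v y c); rw [abs_neg] at this; linarith⟩,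
      fun t ht => (hv'.space t ht).add (w2.space t ht), fun y hy => (hv'.time y hy).add (w2.time y hy)⟩
  have sG : SepCont (fun y t => g y t + -lap (fun y => -v y c) y) x₀ ρ₁ (Icc c s) := by
    obtain ⟨Q, hQ⟩ := w3.bdd
    exact ⟨⟨L + Q, fun y hy t ht => (abs_add_le _ _).trans (add_le_add (hL y hy t (hsub ht)) (hQ y hy t ht))⟩,
      fun t ht => (hg'.space t ht).add (w3.space t ht), fun y hy => (hg'.time y hy).add (w3.time y hy)⟩
  have key := hC1 _ _ x (ρ₁ - dist x x₀) c s (L + n) 0 (fun _ => M) (by linarith) hcs.le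
    (sD.mono hxb' subset_rfl) (sG.mono hxb' subset_rfl) (hWs.recenter (by linarith)) (by positivity)
    (fun y hy t ht => by
      have h1 := hlap y (hxb hy)
      have h2 := (abs_le.1 (hL y (hxb' hy) t (hsub ht))).1
      have h3 : lap (fun y => -v y c) y = -lap (fun y => v y c) y :=
        lap_neg ((hpt.space c hc).contDiffAt (isOpen_ball.mem_nhds (ball_subset_ball hρ.le (hxb hy))))
      rw [h3]; linarith)
    continuousOn_const
    (fun t ht => by
      have h1 : ‖∫ y in closedBall x R, |v y t + -v y c|‖ ≤ 2 * K * volume.real (closedBall x R) := by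
        refine norm_setIntegral_le_of_norm_le_const (isCompact_closedBall _ _).measure_lt_top fun y hy => ?_
        have h1 := hK y (hxb' hy) t (hsub ht); have h2 := hK y (hxb' hy) c hc
        have := abs_add_le (v y t) (-v y c)
        rw [abs_neg] at this
        rw [Real.norm_eq_abs, abs_abs]; linarith
      have h2 : volume.real (closedBall x R) = volume.real (closedBall (0 : 𝔼) R) := by
        simp only [measureReal_def, Measure.addHaar_closedBall_center]
      rw [h2] at h1
      exact (le_abs_self _).trans h1)
    (fun ε _ => by simp)
  rw [intervalIntegral.integral_const, smul_eq_mul] at key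
  linarith

/-- Bounded pointwise supersolutions are weak supersolutions. -/
theorem weakSuper_of_ptSuper (hN : 1 ≤ N) {v g : 𝔼 → ℝ → ℝ} {x₀ : 𝔼} {ρ₁ ρ₂ a b : ℝ} (hρ : ρ₁ < ρ₂)
    (hab : a ≤ b) (hv : SepCont v x₀ ρ₁ (Icc a b)) (hg : SepCont g x₀ ρ₁ (Icc a b))
    (hpt : PtSuper v g x₀ ρ₂ (Icc a b)) : WeakSuper v g x₀ ρ₁ a b := by
  let U : Set ℝ := {t | ∃ δ > 0, ∀ t₁ t₂, a ≤ t₁ → t₁ ≤ t₂ → t₂ ≤ b → |t₁ - t| < δ → |t₂ - t| < δ →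
    WeakSuper v g x₀ ρ₁ t₁ t₂}
  have hU : IsOpen U := by
    rw [isOpen_iff]
    rintro t ⟨δ, hδ, h⟩
    refine ⟨δ / 2, by linarith, fun t' ht' => ⟨δ / 2, by linarith, fun t₁ t₂ h1 h2 h3 h4 h5 => ?_⟩⟩
    rw [mem_ball, Real.dist_eq] at ht'
    refine h t₁ t₂ h1 h2 h3 ?_ ?_
    · have := abs_sub_le t₁ t' t; linarith
    · have := abs_sub_le t₂ t' t; linarith
  have hUr : ∀ t ∈ U, ∀ t₂, a ≤ t → t < t₂ → t₂ ≤ b → ∀ᶠ s in 𝓝[>] t, WeakSuper v g x₀ ρ₁ t s := by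
    rintro t ⟨δ, hδ, h⟩ t₂ hat htt₂ htb
    filter_upwards [Ioc_mem_nhdsGT htt₂, Ioo_mem_nhdsGT (show t < t + δ by linarith)] with s hs hs'
    refine h t s hat hs.1.le (hs.2.trans htb) (by simpa) ?_
    rw [abs_of_pos (sub_pos.2 hs.1)]; linarith [hs'.2]
  have hbl : ∀ ρ < ρ₁, closedBall x₀ ρ ⊆ closedBall x₀ ρ₁ := fun ρ h => closedBall_subset_closedBall h.le
  have weakU : ∀ t₁ t₂, a ≤ t₁ → t₁ ≤ t₂ → t₂ ≤ b → (∀ t ∈ Ico t₁ t₂, t ∈ U) →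
      WeakSuper v g x₀ ρ₁ t₁ t₂ := by
    intro t₁ t₂ h1 h2 h3 hin ρ hρ' η ηt ηL hη
    have hv' := hv.mono (hbl ρ hρ') (Icc_subset_Icc h1 h3)
    have hg' := hg.mono (hbl ρ hρ') (Icc_subset_Icc h1 h3)
    refine weak_of_slopes h2 hv' hg' hη fun t ht ε hε => ?_
    exact slope_of_local ht hρ' hv' hg' hη hε (hUr t (hin t ht) t₂ (h1.trans ht.1) ht.2 h3)
  let T : Set ℝ := Icc a b \ U
  have hT : IsClosed T := isClosed_Icc.sdiff hU
  by_cases hTe : T = ∅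
  · exact weakU a b le_rfl hab le_rfl fun t ht => by
      by_contra h
      have : t ∈ T := ⟨Ico_subset_Icc_self ht, h⟩
      rw [hTe] at this; exact this
  exfalso
  have hTne : T.Nonempty := nonempty_iff_ne_empty.2 hTe
  let F : ℕ → Set ℝ := fun n => {t | t ∈ Icc a b ∧ ∀ y₀ : 𝔼, ∀ R > 0, dist y₀ x₀ + R < ρ₁ → ∀ ε ∈ Ioc (0 : ℝ) 1,
    -(n : ℝ) ≤ ∫ y, v y t * kerTestL y₀ 0 ε 0 (flatProf R) (deriv (flatProf R)) (deriv (deriv (flatProf R))) y 0}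
  have hkey : ∀ t ∈ Icc a b, ∀ y₀ : 𝔼, ∀ R > 0, dist y₀ x₀ + R < ρ₁ → ∀ ε ∈ Ioc (0 : ℝ) 1,
      ∫ y, v y t * kerTestL y₀ 0 ε 0 (flatProf R) (deriv (flatProf R)) (deriv (deriv (flatProf R))) y 0 =
        ∫ y, lap (fun y => v y t) y * kerTest y₀ 0 ε 0 (flatProf R) y 0 := by
    intro t ht y₀ R hR hyR ε hε
    have hk := isTest_ker (N := N) (l := 0) (t₁ := 0) (t₂ := 0) y₀ hε.1 hR.le (profile_flat hR)
    have h0 : (0 : ℝ) ∈ Icc (0 : ℝ) 0 := by simp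
    have hts : tsupport (fun y => kerTest y₀ 0 ε 0 (flatProf R) y 0) ⊆ closedBall y₀ R := by
      refine closure_minimal (fun y hy => ?_) isClosed_closedBall
      by_contra h
      exact hy (hk.supp y h 0 h0)
    have green := integral_mul_lap isOpen_ball (hpt.space t ht) (hk.smooth 0 h0)
      (HasCompactSupport.intro (isCompact_closedBall y₀ R) fun y hy => hk.supp y hy 0 h0)
      (hts.trans (closedBall_subset_ball' (by linarith)))
    simpa only [hk.lap_eq 0 h0] using green
  have hFlap : ∀ n, ∀ t ∈ F n, ∀ y ∈ ball x₀ ρ₁, -(n : ℝ) ≤ lap (fun y => v y t) y := by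
    intro n t ht y₀ hy₀
    rw [mem_ball] at hy₀
    have hR : 0 < (ρ₁ - dist y₀ x₀) / 2 := by linarith
    set R := (ρ₁ - dist y₀ x₀) / 2 with hRdef
    have hyR : dist y₀ x₀ + R < ρ₁ := by rw [hRdef]; linarith
    have := le_of_forall_kernel (v := fun y => lap (fun y => v y t) y) (x₀ := y₀) (l := 0) (t := 0)
      (A := -(n : ℝ)) hR (profile_flat hR)
      ((continuousOn_lap isOpen_ball (hpt.space t ht.1)).mono (closedBall_subset_ball' (by linarith)))
      fun ε hε => by rw [← hkey t ht.1 y₀ R hR hyR ε hε]; exact ht.2 y₀ R hR hyR ε hε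
    rwa [flatProf_eq_one hR (by positivity), mul_one] at this
  have hcov : T ⊆ ⋃ n, F n := by
    intro t ht
    have hcl := (continuousOn_lap isOpen_ball (hpt.space t ht.1)).mono (closedBall_subset_ball hρ)
    obtain ⟨K, hK⟩ := (isCompact_closedBall x₀ ρ₁).exists_bound_of_continuousOn hcl
    obtain ⟨n, hn⟩ := exists_nat_ge K
    refine mem_iUnion.2 ⟨n, ht.1, fun y₀ R hR hyR ε hε => ?_⟩
    rw [hkey t ht.1 y₀ R hR hyR ε hε]
    have hk := isTest_ker (N := N) (l := 0) (t₁ := 0) (t₂ := 0) y₀ hε.1 hR.le (profile_flat hR)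
    have h0 : (0 : ℝ) ∈ Icc (0 : ℝ) 0 := by simp
    have hsub : closedBall y₀ R ⊆ closedBall x₀ ρ₁ := closedBall_subset_closedBall' (by linarith)
    have i1 := integrable_heatKer hε.1 y₀
    have := integral_mono (μ := volume) (i1.const_mul (-(n : ℝ)))
      (integrable_of_continuousOn_closedBall
        (f := fun y => lap (fun y => v y t) y * kerTest y₀ 0 ε 0 (flatProf R) y 0) ((hcl.mono hsub).mul (hk.smooth 0 h0).continuous.continuousOn)
        fun y hy => by rw [hk.supp y hy 0 h0, mul_zero]) fun y => ?_
    · rw [integral_const_mul, integral_heatKer hε.1, mul_one] at this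
      exact this
    · have hh := heatKer_nonneg N hε.1 (‖y - y₀‖ ^ 2)
      by_cases hy : y ∈ closedBall y₀ R
      · have n0 := hk.nonneg y 0 h0
        have n1 : kerTest y₀ 0 ε 0 (flatProf R) y 0 ≤ heatKer N ε (‖y - y₀‖ ^ 2) := by
          have := mul_le_mul_of_nonneg_left (flatProf_le_one R (‖y - y₀‖ ^ 2)) hh
          simpa [kerTest] using this
        have := (abs_le.1 (hK y (hsub hy))).1
        nlinarith [(n.cast_nonneg : (0 : ℝ) ≤ n)]
      · rw [hk.supp y hy 0 h0]
        nlinarith [(n.cast_nonneg : (0 : ℝ) ≤ n)]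
  obtain ⟨n, P, hPT, V, hV, hVF⟩ := exists_local_subset_of_baire hT.isLocallyClosed hTne F hcov (by
    intro n t ht htc
    refine ⟨ht.1, fun y₀ R hR hyR ε hε => ?_⟩
    have hk := isTest_ker (N := N) (l := 0) (t₁ := 0) (t₂ := 0) y₀ hε.1 hR.le (profile_flat hR)
    have hsub : closedBall y₀ R ⊆ closedBall x₀ ρ₁ := closedBall_subset_closedBall' (by linarith)
    have h0 : (0 : ℝ) ∈ Icc (0 : ℝ) 0 := by simp
    have hc : ContinuousOn (Function.uncurry fun (y : 𝔼) (_ : ℝ) => kerTestL y₀ 0 ε 0 (flatProf R)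
        (deriv (flatProf R)) (deriv (deriv (flatProf R))) y 0) (univ ×ˢ Icc a b) :=
      hk.cont_L.comp (f := fun z : 𝔼 × ℝ => (z.1, (0 : ℝ))) (by fun_prop) fun z _ => ⟨mem_univ _, h0⟩
    have := (hv.mono hsub subset_rfl).continuousOn_integral isCompact_Icc hc
      fun y hy t _ => hk.supp_L y hy 0 h0
    have h1 : ContinuousWithinAt _ (F n ∩ T) t := (this t ht.1).mono fun s hs => hs.2.1
    have := mem_closure_iff_nhdsWithin_neBot.1 htc
    refine ge_of_tendsto h1 ?_
    filter_upwards [self_mem_nhdsWithin] with s hs using hs.1.2 y₀ R hR hyR ε hε)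
  obtain ⟨δ, hδ, hδV⟩ := Metric.mem_nhds_iff.1 hV
  have hJ : ∀ t ∈ T, |t - P| < δ → ∀ y ∈ ball x₀ ρ₁, -(n : ℝ) ≤ lap (fun y => v y t) y :=
    fun t ht htP => hFlap n t (hVF ⟨ht, hδV (by rwa [mem_ball, Real.dist_eq])⟩)
  obtain ⟨L', hL'⟩ := hg.bdd
  have lip : ∀ R > 0, ∃ C, ∀ t ∈ T, |t - P| < δ → ∀ s, t ≤ s → s ≤ b → |s - P| < δ →
      ∀ x, dist x x₀ + R < ρ₁ → -C * (s - t) ≤ v x s - v x t := by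
    intro R hR
    obtain ⟨C0, hC00, hC0⟩ := gap_lower hN hρ hv hg hpt n hR
    refine ⟨max C0 (n + |L'| + 1), fun t ht htP s hts hsb hsP x hx => ?_⟩
    set C := max C0 (n + |L'| + 1)
    have hxb : x ∈ ball x₀ ρ₁ := by rw [mem_ball]; linarith
    have hJs : ∀ u ∈ Icc t s, |u - P| < δ := by
      intro u hu
      rw [abs_lt] at htP hsP ⊢
      constructor <;> linarith [hu.1, hu.2]
    have hIs : Icc t s ⊆ Icc a b := Icc_subset_Icc ht.1.1 hsb
    have := le_of_gap_of_slope (f := fun u => v x u + C * u) hT ht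
      (((hv.time x (ball_subset_closedBall hxb)).mono hIs).add (by fun_prop)) ?_ ?_ s
      (right_mem_Icc.2 hts)
    · linarith
    · intro c hc u hu hcu
      have := hC0 c u hc.1.1.1 hu.1 (hu.2.trans hsb) (fun c' hc' => weakU c' u (hc.1.1.1.trans hc'.1.le)
        hc'.2.le (hu.2.trans hsb) fun w hw => by
          by_contra hwU
          exact hcu w ⟨hc'.1.trans_le hw.1, hw.2.le⟩ ⟨⟨hc.1.1.1.trans (hc'.1.le.trans hw.1),
            hw.2.le.trans (hu.2.trans hsb)⟩, hwU⟩) (hJ c hc.1 (hJs c hc.2)) x hx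
      have h2 := mul_le_mul_of_nonneg_right (le_max_left C0 (n + |L'| + 1)) (sub_nonneg.2 hu.1.le)
      change v x c + C * c ≤ v x u + C * u
      change C0 * (u - c) ≤ C * (u - c) at h2
      linarith
    · intro c hc
      obtain ⟨w, hw, hwl⟩ := hpt.time x (ball_subset_ball hρ.le hxb) c hc.1.1
      have h1 := hJ c hc.1 (hJs c (Ico_subset_Icc_self hc.2)) x hxb
      have h2 := (abs_le.1 ((hL' x (ball_subset_closedBall hxb) c hc.1.1).trans (le_abs_self _))).1
      have h3 : (n : ℝ) + |L'| + 1 ≤ C := le_max_right _ _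
      have h4 : 0 < w + C := by linarith
      have hd : HasDerivAt (fun u => v x u + C * u) (w + C) c := by
        simpa using hw.fun_add ((hasDerivAt_id c).const_mul C)
      have := (hasDerivAt_iff_tendsto_slope.1 hd).mono_left
        (nhdsWithin_mono c (fun s hs => ne_of_gt hs : Ioi c ⊆ {c}ᶜ))
      filter_upwards [this.eventually (lt_mem_nhds h4), self_mem_nhdsWithin] with u hu hcu
      rw [slope_def_field] at hu
      have hcu' : 0 < u - c := sub_pos.2 hcu
      have := (div_pos_iff_of_pos_right hcu').1 hu
      linarith
  refine hPT.2 ⟨δ, hδ, fun t₁ t₂ h1 h2 h3 h4 h5 ρ hρ' η ηt ηL hη => ?_⟩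
  have hv' := hv.mono (hbl ρ hρ') (Icc_subset_Icc h1 h3)
  have hg' := hg.mono (hbl ρ hρ') (Icc_subset_Icc h1 h3)
  obtain ⟨C, hC⟩ := lip ((ρ₁ - ρ) / 2) (by linarith)
  have hJs : ∀ u ∈ Icc t₁ t₂, |u - P| < δ := by
    intro u hu
    rw [abs_lt] at h4 h5 ⊢
    constructor <;> linarith [hu.1, hu.2]
  refine weak_of_slopes h2 hv' hg' hη fun t ht ε hε => ?_
  have htI : t ∈ Icc a b := ⟨h1.trans ht.1, ht.2.le.trans h3⟩
  by_cases htU : t ∈ U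
  · exact slope_of_local ht hρ' hv' hg' hη hε (hUr t htU t₂ htI.1 ht.2 h3)
  · refine slope_lower_bound (C := C) ht hv' hg' (hρ'.trans hρ) (hpt.space t htI)
      (fun y hy => hpt.time y (closedBall_subset_ball (hρ'.trans hρ) hy) t htI) ?_ hη hε
    intro y hy s hs
    refine hC t ⟨htI, htU⟩ (hJs t (Ico_subset_Icc_self ht)) s hs.1.le (hs.2.trans h3)
      (hJs s ⟨ht.1.trans hs.1.le, hs.2⟩) y ?_
    rw [mem_closedBall] at hy; linarith

end WeakFormulation

section Solutions
variable {N m : ℕ}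
local notation "𝔼" => EuclideanSpace ℝ (Fin N)

/-- Positive solutions of the system on `ball x₀ ρ × I`, with separate regularity. -/
structure Sol (β : Fin m → Fin m → ℝ) (r : ℝ) (u : Fin m → 𝔼 → ℝ → ℝ) (x₀ : 𝔼) (ρ : ℝ) (I : Set ℝ) :
    Prop where
  pos : ∀ i, ∀ x ∈ ball x₀ ρ, ∀ t ∈ I, 0 < u i x t
  space : ∀ i, ∀ t ∈ I, ContDiffOn ℝ 2 (fun x => u i x t) (ball x₀ ρ)
  time : ∀ i, ∀ x ∈ ball x₀ ρ, ∀ t ∈ I,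
    HasDerivAt (u i x) (lap (fun y => u i y t) x + sysF β r (fun j => u j x t) i) t

lemma Sol.mono {β : Fin m → Fin m → ℝ} {r : ℝ} {u : Fin m → 𝔼 → ℝ → ℝ} {x₀ x₁ : 𝔼} {ρ ρ' : ℝ}
    {I I' : Set ℝ} (h : Sol β r u x₀ ρ I) (hb : ball x₁ ρ' ⊆ ball x₀ ρ) (hI : I' ⊆ I) :
    Sol β r u x₁ ρ' I' where
  pos i x hx t ht := h.pos i x (hb hx) t (hI ht)
  space i t ht := (h.space i t (hI ht)).mono hb
  time i x hx t ht := h.time i x (hb hx) t (hI ht)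

lemma sysF_const_mul (β : Fin m → Fin m → ℝ) (r : ℝ) {c : ℝ} (hc : 0 < c) {u : Fin m → ℝ}
    (hu : ∀ j, 0 ≤ u j) (i : Fin m) :
    sysF β r (fun j => c * u j) i = c ^ (2 * r + 1) * sysF β r u i := by
  unfold sysF
  rw [Finset.mul_sum]
  refine Finset.sum_congr rfl fun j _ => ?_
  rw [mul_rpow hc.le (hu i), mul_rpow hc.le (hu j), show 2 * r + 1 = r + (r + 1) by ring,
    rpow_add hc r (r + 1)]
  ring

lemma continuous_sysF (β : Fin m → Fin m → ℝ) {r : ℝ} (hr : 0 < r) (i : Fin m) :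
    Continuous fun u : Fin m → ℝ => sysF β r u i := by
  unfold sysF
  refine continuous_finsetSum _ fun j _ => (continuous_const.mul ?_).mul ?_
  · exact (continuous_apply i).rpow_const fun _ => Or.inr hr.le
  · exact (continuous_apply j).rpow_const fun _ => Or.inr (by linarith)

lemma exists_sysF_bound (β : Fin m → Fin m → ℝ) {r : ℝ} (hr : 0 < r) (K : ℝ) :
    ∃ L, 0 ≤ L ∧ ∀ u : Fin m → ℝ, (∀ j, 0 ≤ u j) → (∀ j, u j ≤ K) → ∀ i, |sysF β r u i| ≤ L := by
  have hc : IsCompact (pi univ fun _ : Fin m => Icc (0 : ℝ) K) := isCompact_univ_pi fun _ => isCompact_Icc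
  choose L hL using fun i => hc.exists_bound_of_continuousOn (continuous_sysF β hr i).continuousOn
  refine ⟨∑ i, |L i|, Finset.sum_nonneg fun i _ => abs_nonneg _, fun u h0 h1 i => ?_⟩
  exact ((hL i u fun j _ => ⟨h0 j, h1 j⟩).trans (le_abs_self _)).trans
    (Finset.single_le_sum (f := fun i => |L i|) (fun i _ => abs_nonneg _) (Finset.mem_univ i))

/-- Parabolic rescaling. -/
noncomputable def rescale (r l : ℝ) (x₁ : 𝔼) (t₁ : ℝ) (u : Fin m → 𝔼 → ℝ → ℝ) : Fin m → 𝔼 → ℝ → ℝ :=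
  fun i y s => l ^ (1 / r) * u i (x₁ + l • y) (t₁ + l ^ 2 * s)

lemma rescale_rpow {r l : ℝ} (hr : 0 < r) (hl : 0 < l) :
    (l ^ (1 / r)) ^ (2 * r + 1) = l ^ 2 * l ^ (1 / r) := by
  rw [← rpow_mul hl.le, ← rpow_natCast l 2, ← rpow_add hl]
  congr 1; field_simp; norm_num

lemma Sol.rescale {β : Fin m → Fin m → ℝ} {r : ℝ} (hr : 0 < r) {u : Fin m → 𝔼 → ℝ → ℝ} {x₀ x₁ y₀ : 𝔼}
    {ρ ρ' l t₁ : ℝ} {I I' : Set ℝ} (h : Sol β r u x₀ ρ I) (hl : 0 < l)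
    (hb : ∀ y ∈ ball y₀ ρ', x₁ + l • y ∈ ball x₀ ρ) (hI : ∀ s ∈ I', t₁ + l ^ 2 * s ∈ I) :
    Sol β r (rescale r l x₁ t₁ u) y₀ ρ' I' where
  pos i y hy s hs := mul_pos (rpow_pos_of_pos hl _) (h.pos i _ (hb y hy) _ (hI s hs))
  space i s hs := by
    refine contDiffOn_const.mul ((h.space i _ (hI s hs)).comp (f := fun y => x₁ + l • y) ?_ hb)
    fun_prop
  time i y hy s hs := by
    have hu : ContDiffAt ℝ 2 (fun y => u i y (t₁ + l ^ 2 * s)) (x₁ + l • y) :=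
      (h.space i _ (hI s hs)).contDiffAt (isOpen_ball.mem_nhds (hb y hy))
    have h1 : ContDiffAt ℝ 2 (fun y => u i (x₁ + l • y) (t₁ + l ^ 2 * s)) y :=
      ContDiffAt.comp y (f := fun y : 𝔼 => x₁ + l • y) hu
        (by fun_prop)
    have h2 := h.time i _ (hb y hy) _ (hI s hs)
    have h3 : HasDerivAt (fun s => t₁ + l ^ 2 * s) (l ^ 2) s := by
      simpa using ((hasDerivAt_id s).const_mul (l ^ 2)).const_add t₁
    have h4 := (HasDerivAt.comp s h2 h3).const_mul (l ^ (1 / r))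
    have h5 : lap (fun y => _root_.rescale r l x₁ t₁ u i y s) y =
        l ^ (1 / r) * (l ^ 2 * lap (fun y => u i y (t₁ + l ^ 2 * s)) (x₁ + l • y)) := by
      unfold _root_.rescale
      rw [lap_const_mul h1, lap_affine x₁ l hu]
    have h6 : sysF β r (fun j => _root_.rescale r l x₁ t₁ u j y s) i =
        l ^ 2 * l ^ (1 / r) * sysF β r (fun j => u j (x₁ + l • y) (t₁ + l ^ 2 * s)) i := by
      unfold _root_.rescale
      rw [sysF_const_mul β r (rpow_pos_of_pos hl _)
        (fun j => (h.pos j _ (hb y hy) _ (hI s hs)).le) i, rescale_rpow hr hl]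
    rw [h5, h6]
    convert! h4 using 1
    ring

section Bounded
variable {β : Fin m → Fin m → ℝ} {r : ℝ} {u : Fin m → EuclideanSpace ℝ (Fin N) → ℝ → ℝ}
  {x₀ : EuclideanSpace ℝ (Fin N)} {ρ ρ₁ a b K : ℝ} {I : Set ℝ}

lemma Sol.sepCont (h : Sol β r u x₀ ρ I) (hρ : ρ₁ < ρ) (hI : Icc a b ⊆ I)
    (hK : ∀ i, ∀ x ∈ closedBall x₀ ρ₁, ∀ t ∈ Icc a b, u i x t ≤ K) (i : Fin m) :
    SepCont (u i) x₀ ρ₁ (Icc a b) where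
  bdd := ⟨K, fun y hy t ht => by
    rw [abs_of_pos (h.pos i y (closedBall_subset_ball hρ hy) t (hI ht))]; exact hK i y hy t ht⟩
  space t ht := (h.space i t (hI ht)).continuousOn.mono (closedBall_subset_ball hρ)
  time y hy t ht := (h.time i y (closedBall_subset_ball hρ hy) t (hI ht)).continuousAt.continuousWithinAt

lemma Sol.sepCont_sysF (hr : 0 < r) (h : Sol β r u x₀ ρ I) (hρ : ρ₁ < ρ) (hI : Icc a b ⊆ I)
    (hK : ∀ i, ∀ x ∈ closedBall x₀ ρ₁, ∀ t ∈ Icc a b, u i x t ≤ K) (i : Fin m) :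
    SepCont (fun x t => sysF β r (fun j => u j x t) i) x₀ ρ₁ (Icc a b) := by
  obtain ⟨L, -, hL⟩ := exists_sysF_bound β hr K
  have hs := fun j => h.sepCont hρ hI hK j
  have hp : ∀ j, ∀ y ∈ closedBall x₀ ρ₁, ∀ t ∈ Icc a b, 0 ≤ u j y t := fun j y hy t ht =>
    (h.pos j y (closedBall_subset_ball hρ hy) t (hI ht)).le
  refine ⟨⟨L, fun y hy t ht => hL (fun j => u j y t) (fun j => hp j y hy t ht)
    (fun j => hK j y hy t ht) i⟩, fun t ht => ?_, fun y hy => ?_⟩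
  · have h1 : ContinuousOn (fun x j => u j x t) (closedBall x₀ ρ₁) :=
      continuousOn_pi.2 fun j => (hs j).space t ht
    exact Continuous.comp_continuousOn' (g := fun v : Fin m → ℝ => sysF β r v i) (continuous_sysF β hr i) h1
  · have h1 : ContinuousOn (fun t j => u j y t) (Icc a b) :=
      continuousOn_pi.2 fun j => (hs j).time y hy
    exact Continuous.comp_continuousOn' (g := fun v : Fin m → ℝ => sysF β r v i) (continuous_sysF β hr i) h1

lemma SepCont.neg {f : 𝔼 → ℝ → ℝ} {J : Set ℝ} (h : SepCont f x₀ ρ J) :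
    SepCont (fun x t => - f x t) x₀ ρ J where
  bdd := by
    obtain ⟨K, hK⟩ := h.bdd
    exact ⟨K, fun y hy t ht => by rw [abs_neg]; exact hK y hy t ht⟩
  space t ht := (h.space t ht).neg
  time y hy := (h.time y hy).neg

lemma SepCont.sum {ι : Type*} {s : Finset ι} {f : ι → 𝔼 → ℝ → ℝ} {J : Set ℝ}
    (h : ∀ i ∈ s, SepCont (f i) x₀ ρ J) : SepCont (fun x t => ∑ i ∈ s, f i x t) x₀ ρ J where
  bdd := by
    choose! K hK using fun i hi => (h i hi).bdd
    exact ⟨∑ i ∈ s, K i, fun y hy t ht => (Finset.abs_sum_le_sum_abs _ _).trans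
      (Finset.sum_le_sum fun i hi => hK i hi y hy t ht)⟩
  space t ht := continuousOn_finsetSum _ fun i hi => (h i hi).space t ht
  time y hy := continuousOn_finsetSum _ fun i hi => (h i hi).time y hy

lemma Sol.weakSuper (hN : 1 ≤ N) (hr : 0 < r) (h : Sol β r u x₀ ρ I) (hρ : ρ₁ < ρ) (hab : a ≤ b)
    (hI : Icc a b ⊆ I)
    (hK : ∀ i, ∀ x ∈ closedBall x₀ ρ₁, ∀ t ∈ Icc a b, u i x t ≤ K) (i : Fin m) :
    WeakSuper (u i) (fun x t => sysF β r (fun j => u j x t) i) x₀ ρ₁ a b :=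
  weakSuper_of_ptSuper hN hρ hab (h.sepCont hρ hI hK i) (h.sepCont_sysF hr hρ hI hK i)
    ⟨fun t ht => h.space i t (hI ht), fun y hy t ht => ⟨_, h.time i y hy t (hI ht), le_rfl⟩⟩

lemma Sol.weakSuper_neg (hN : 1 ≤ N) (hr : 0 < r) (h : Sol β r u x₀ ρ I) (hρ : ρ₁ < ρ) (hab : a ≤ b)
    (hI : Icc a b ⊆ I)
    (hK : ∀ i, ∀ x ∈ closedBall x₀ ρ₁, ∀ t ∈ Icc a b, u i x t ≤ K) (i : Fin m) :
    WeakSuper (fun x t => -u i x t) (fun x t => -sysF β r (fun j => u j x t) i) x₀ ρ₁ a b :=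
  weakSuper_of_ptSuper hN hρ hab (h.sepCont hρ hI hK i).neg (h.sepCont_sysF hr hρ hI hK i).neg
    ⟨fun t ht => (h.space i t (hI ht)).neg, fun y hy t ht => ⟨_, (h.time i y hy t (hI ht)).neg, by
      rw [lap_neg ((h.space i t (hI ht)).contDiffAt (isOpen_ball.mem_nhds hy))]; linarith⟩⟩

/-- Testing bounded solutions with nonnegative functions vanishing at both ends. -/
lemma Sol.integral_weakDensity_eq_zero (hN : 1 ≤ N) (hr : 0 < r) (h : Sol β r u x₀ ρ I) (hρ : ρ₁ < ρ)
    (hab : a ≤ b) (hI : Icc a b ⊆ I)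
    (hK : ∀ i, ∀ x ∈ closedBall x₀ ρ₁, ∀ t ∈ Icc a b, u i x t ≤ K) (i : Fin m)
    {η ηt ηL : 𝔼 → ℝ → ℝ} {ρ₂ : ℝ} (hρ₂ : ρ₂ < ρ₁) (hη : IsTest x₀ ρ₂ a b η ηt ηL)
    (ha : ∀ y, η y a = 0) (hb : ∀ y, η y b = 0) :
    ∫ t in a..b, weakDensity (u i) (fun x t => sysF β r (fun j => u j x t) i) η ηt ηL t = 0 := by
  have h1 := h.weakSuper hN hr hρ hab hI hK i ρ₂ hρ₂ η ηt ηL hη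
  have h2 := h.weakSuper_neg hN hr hρ hab hI hK i ρ₂ hρ₂ η ηt ηL hη
  have h3 : ∀ t, weakDensity (fun x t => -u i x t) (fun x t => -sysF β r (fun j => u j x t) i) η ηt ηL t
      = -weakDensity (u i) (fun x t => sysF β r (fun j => u j x t) i) η ηt ηL t := by
    intro t
    simp only [weakDensity, neg_mul, integral_neg]; ring
  simp only [h3, ha, hb, mul_zero, integral_zero, zero_add, intervalIntegral.integral_neg] at h1 h2
  linarith

end Bounded
end Solutions

section Mollification
set_option linter.unusedSectionVars false
variable {V : Type*} [NormedAddCommGroup V] [NormedSpace ℝ V] [FiniteDimensional ℝ V]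
  [MeasurableSpace V] [BorelSpace V] {μ : Measure V} [μ.IsAddHaarMeasure]

/-- Real convolution. -/
noncomputable def conv (μ : Measure V) (g ψ : V → ℝ) (z : V) : ℝ := ∫ z', g z' * ψ (z - z') ∂μ

lemma conv_eq_convolution (g ψ : V → ℝ) :
    conv μ g ψ = convolution g ψ (ContinuousLinearMap.lsmul ℝ ℝ) μ := by
  ext z; simp [conv, convolution_def]

lemma locallyIntegrable_of_bounded {g : V → ℝ} {K : ℝ} (hg : Measurable g) (hK : ∀ z, |g z| ≤ K) :
    LocallyIntegrable g μ :=
  (locallyIntegrable_const K).mono hg.aestronglyMeasurable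
    (Filter.Eventually.of_forall fun z => (hK z).trans (le_abs_self K))

lemma contDiff_conv {g ψ : V → ℝ} (hg : LocallyIntegrable g μ) (hψ : ContDiff ℝ ∞ ψ)
    (hs : HasCompactSupport ψ) : ContDiff ℝ ∞ (conv μ g ψ) := by
  rw [conv_eq_convolution]
  exact hs.contDiff_convolution_right _ hg hψ

lemma dd_conv {g ψ : V → ℝ} (hg : LocallyIntegrable g μ) (hψ : ContDiff ℝ ∞ ψ)
    (hs : HasCompactSupport ψ) (v : V) : dd v (conv μ g ψ) = conv μ g (dd v ψ) := by
  ext z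
  rw [conv_eq_convolution, conv_eq_convolution, dd, (hs.hasFDerivAt_convolution_right
    (ContinuousLinearMap.lsmul ℝ ℝ) hg (contDiff_infty.1 hψ 1) z).fderiv,
    convolution_precompR_apply _ hg (hs.fderiv ℝ) (hψ.continuous_fderiv (by simp))]
  rfl

lemma integrable_conv_integrand {g ψ : V → ℝ} {K : ℝ} (hg : Measurable g) (hK : ∀ z, |g z| ≤ K)
    (hψ : Continuous ψ) (hs : HasCompactSupport ψ) (z : V) : Integrable (fun z' => g z' * ψ (z - z')) μ := by
  have h1 : Integrable (fun z' => ψ (z - z')) μ :=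
    (hψ.integrable_of_hasCompactSupport hs).comp_sub_left z
  exact h1.bdd_mul (c := K) hg.aestronglyMeasurable (Filter.Eventually.of_forall hK)

lemma abs_conv_normed_le {g : V → ℝ} {K : ℝ} (hg : Measurable g) (hK : ∀ z, |g z| ≤ K)
    (φ : ContDiffBump (0 : V)) (z : V) : |conv μ g (φ.normed μ) z| ≤ K := by
  have hi := integrable_conv_integrand (μ := μ) hg hK (φ.contDiff_normed (μ := μ) (n := 0)).continuous
    φ.hasCompactSupport_normed z
  have h1 : Integrable (fun z' => φ.normed μ (z - z')) μ :=
    ((φ.contDiff_normed (μ := μ) (n := 0)).continuous.integrable_of_hasCompactSupport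
      φ.hasCompactSupport_normed).comp_sub_left z
  calc |conv μ g (φ.normed μ) z| ≤ ∫ z', |g z' * φ.normed μ (z - z')| ∂μ := abs_integral_le_integral_abs
    _ ≤ ∫ z', K * φ.normed μ (z - z') ∂μ := by
      refine integral_mono hi.abs (h1.const_mul K) fun z' => ?_
      dsimp only
      rw [abs_mul, abs_of_nonneg (φ.nonneg_normed _)]
      exact mul_le_mul_of_nonneg_right (hK z') (φ.nonneg_normed _)
    _ = K := by
      rw [integral_const_mul, integral_sub_left_eq_self (fun z' => φ.normed μ z'), φ.integral_normed, mul_one]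

lemma conv_normed_pos {g : V → ℝ} {K : ℝ} (hg : Measurable g) (hK : ∀ z, |g z| ≤ K)
    (hpos : ∀ z, 0 < g z) (φ : ContDiffBump (0 : V)) (z : V) : 0 < conv μ g (φ.normed μ) z := by
  have hi := integrable_conv_integrand (μ := μ) hg hK (φ.contDiff_normed (μ := μ) (n := 0)).continuous
    φ.hasCompactSupport_normed z
  refine (integral_pos_iff_support_of_nonneg
    (fun z' => mul_nonneg (hpos z').le (φ.nonneg_normed _)) hi).2 ?_
  have : Function.support (fun z' => g z' * φ.normed μ (z - z')) = ball z φ.rOut := by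
    ext z'
    have h1 : z - z' ∈ Function.support (φ.normed μ) ↔ z - z' ∈ ball (0 : V) φ.rOut := by
      rw [φ.support_normed_eq]
    rw [Function.mem_support, mul_ne_zero_iff, and_iff_right (hpos z').ne', ← Function.mem_support, h1,
      mem_ball_zero_iff, mem_ball, dist_comm, dist_eq_norm]
  rw [this]
  exact measure_ball_pos μ z φ.rOut_pos

/-- A sequence of bumps with radii tending to zero. -/
noncomputable def bumpSeq (V : Type*) [NormedAddCommGroup V] (n : ℕ) : ContDiffBump (0 : V) where
  rIn := 1 / (32 * (n + 1))
  rOut := 1 / (16 * (n + 1))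
  rIn_pos := by positivity
  rIn_lt_rOut := by gcongr; norm_num

lemma bumpSeq_rOut_le (n : ℕ) : (bumpSeq V n).rOut ≤ 1 / 16 := by
  change (1 : ℝ) / (16 * (n + 1)) ≤ 1 / 16
  have : (0 : ℝ) ≤ n := n.cast_nonneg
  gcongr; linarith

lemma ae_tendsto_conv_bumpSeq {g : V → ℝ} (hg : LocallyIntegrable g μ) :
    ∀ᵐ z ∂μ, Tendsto (fun n => conv μ g ((bumpSeq V n).normed μ) z) Filter.atTop (𝓝 (g z)) := by
  have h1 : Tendsto (fun n => (bumpSeq V n).rOut) Filter.atTop (𝓝 0) := by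
    change Tendsto (fun n : ℕ => (1 : ℝ) / (16 * (n + 1))) Filter.atTop (𝓝 0)
    have := (tendsto_one_div_add_atTop_nhds_zero_nat (𝕜 := ℝ)).const_mul (1 / 16)
    rw [mul_zero] at this
    refine this.congr fun n => ?_
    field_simp
  have h2 : ∀ᶠ n in Filter.atTop, (bumpSeq V n).rOut ≤ 2 * (bumpSeq V n).rIn := by
    refine Filter.Eventually.of_forall fun n => ?_
    change (1 : ℝ) / (16 * (n + 1)) ≤ 2 * (1 / (32 * (n + 1)))
    apply le_of_eq; field_simp; norm_num
  filter_upwards [ContDiffBump.ae_convolution_tendsto_right_of_locallyIntegrable h1 h2 hg] with z hz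
  refine hz.congr fun n => ?_
  rw [convolution_eq_swap, conv]
  simp [mul_comm]

end Mollification

section MollifiedSystem
variable {N m : ℕ}
local notation "𝔼" => EuclideanSpace ℝ (Fin N)

/-- Coordinate direction in space-time. -/
noncomputable abbrev spaceDir (a : Fin N) : EuclideanSpace ℝ (Fin N) × ℝ := (ev a, 0)

/-- Time direction in space-time. -/
noncomputable abbrev timeDir (N : ℕ) : EuclideanSpace ℝ (Fin N) × ℝ := (0, 1)

lemma dd_space_sub {f : 𝔼 × ℝ → ℝ} {z : 𝔼 × ℝ} {y : 𝔼} {t : ℝ} (hf : DifferentiableAt ℝ f (z - (y, t)))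
    (v : 𝔼) : dd v (fun y => f (z - (y, t))) y = -dd (v, (0 : ℝ)) f (z - (y, t)) := by
  have h1 : HasFDerivAt (fun y : 𝔼 => z - (y, t)) (-((ContinuousLinearMap.id ℝ 𝔼).prod (0 : 𝔼 →L[ℝ] ℝ))) y :=
    ((hasFDerivAt_id y).prodMk (hasFDerivAt_const t y)).const_sub z
  have h2 := (hf.hasFDerivAt.comp y h1).fderiv
  simp only [Function.comp_def] at h2
  simp only [dd, h2]
  simp [← map_neg]

lemma hasDerivAt_time_sub {f : 𝔼 × ℝ → ℝ} {z : 𝔼 × ℝ} {y : 𝔼} {t : ℝ} (hf : DifferentiableAt ℝ f (z - (y, t))) :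
    HasDerivAt (fun t => f (z - (y, t))) (-dd (timeDir N) f (z - (y, t))) t := by
  have h1 : HasDerivAt (fun t : ℝ => z - (y, t)) (-((0 : 𝔼), (1 : ℝ))) t :=
    ((hasDerivAt_const t y).prodMk (hasDerivAt_id t)).const_sub z
  have h2 := hf.hasFDerivAt.comp_hasDerivAt t h1
  rw [map_neg] at h2
  exact h2

lemma lap_space_sub {f : 𝔼 × ℝ → ℝ} (hf : ContDiff ℝ ∞ f) (z : 𝔼 × ℝ) (y : 𝔼) (t : ℝ) :
    lap (fun y => f (z - (y, t))) y = ∑ a, dd (spaceDir a) (dd (spaceDir a) f) (z - (y, t)) := by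
  have hd : ∀ {f : 𝔼 × ℝ → ℝ}, ContDiff ℝ ∞ f → ∀ w, DifferentiableAt ℝ f w := fun h w =>
    h.differentiable (by simp) w
  rw [lap_eq_sum_dd]
  · refine Finset.sum_congr rfl fun a _ => ?_
    have h1 : dd (ev a) (fun y => f (z - (y, t))) = fun y => -dd (spaceDir a) f (z - (y, t)) :=
      funext fun y => dd_space_sub (hd hf _) _
    have h2 := dd_const_mul (f := fun y => dd (spaceDir a) f (z - (y, t))) (x := y) (-1)
      (by have := hd (hf.dd_smooth (spaceDir a)) (z - (y, t)); fun_prop) (ev a)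
    simp only [neg_one_mul] at h2
    rw [h1, h2, dd_space_sub (hd (hf.dd_smooth (spaceDir a)) _), neg_neg]
  · have := contDiff_infty.1 hf 2
    exact ContDiff.contDiffAt (this.comp (f := fun y : 𝔼 => z - (y, t)) (by fun_prop))

variable {z : EuclideanSpace ℝ (Fin N) × ℝ}

lemma notMem_tsupport_space {φ : 𝔼 × ℝ → ℝ} (hs : tsupport φ ⊆ closedBall 0 (1 / 16))
    (hz : z ∈ ball 0 (3 / 4)) {y : 𝔼} (hy : y ∉ closedBall (0 : 𝔼) (13 / 16)) (t : ℝ) :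
    z - (y, t) ∉ tsupport φ := by
  intro h
  have h1 := hs h
  rw [mem_closedBall_zero_iff] at h1 hy
  rw [mem_ball_zero_iff] at hz
  have h2 : ‖z.1 - y‖ ≤ 1 / 16 := (norm_fst_le (z - (y, t))).trans h1
  have h3 : ‖z.1‖ < 3 / 4 := (norm_fst_le z).trans_lt hz
  have h4 := norm_sub_norm_le y z.1
  rw [norm_sub_rev] at h4
  linarith

lemma notMem_tsupport_time {φ : 𝔼 × ℝ → ℝ} (hs : tsupport φ ⊆ closedBall 0 (1 / 16))
    (hz : z ∈ ball 0 (3 / 4)) (y : 𝔼) {t : ℝ} (ht : 7 / 8 ≤ |t|) :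
    z - (y, t) ∉ tsupport φ := by
  intro h
  have h1 := hs h
  rw [mem_closedBall_zero_iff] at h1
  rw [mem_ball_zero_iff] at hz
  have h2 : ‖z.2 - t‖ ≤ 1 / 16 := (norm_snd_le (z - (y, t))).trans h1
  have h3 : ‖z.2‖ < 3 / 4 := (norm_snd_le z).trans_lt hz
  have h4 := norm_sub_norm_le t z.2
  rw [norm_sub_rev] at h4
  rw [Real.norm_eq_abs t] at h4
  linarith

lemma dd_dd_support {φ : 𝔼 × ℝ → ℝ} (v w : 𝔼 × ℝ) {x : 𝔼 × ℝ} (hx : x ∉ tsupport φ) :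
    dd v (dd w φ) x = 0 :=
  dd_support v fun h => hx (tsupport_dd w h)

lemma isTest_translate {φ : 𝔼 × ℝ → ℝ} (hφ : ContDiff ℝ ∞ φ) (h0 : ∀ z, 0 ≤ φ z)
    (hs : tsupport φ ⊆ closedBall 0 (1 / 16)) (hz : z ∈ ball 0 (3 / 4)) :
    IsTest 0 (13 / 16) (-(7 / 8)) (7 / 8) (fun y t => φ (z - (y, t)))
      (fun y t => -dd (timeDir N) φ (z - (y, t)))
      (fun y t => ∑ a, dd (spaceDir a) (dd (spaceDir a) φ) (z - (y, t))) where
  cont := by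
    have := hφ.continuous
    exact Continuous.continuousOn (by unfold Function.uncurry; fun_prop)
  cont_t := by
    have := (hφ.dd_smooth (timeDir N)).continuous
    exact Continuous.continuousOn (by unfold Function.uncurry; fun_prop)
  cont_L := by
    have := fun a => ((hφ.dd_smooth (spaceDir a)).dd_smooth (spaceDir a)).continuous
    exact Continuous.continuousOn (by unfold Function.uncurry; fun_prop)
  nonneg y t _ := h0 _
  supp y hy t _ := image_eq_zero_of_notMem_tsupport (notMem_tsupport_space hs hz hy t)
  supp_t y hy t _ := by rw [dd_support _ (notMem_tsupport_space hs hz hy t), neg_zero]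
  supp_L y hy t _ := Finset.sum_eq_zero fun a _ => dd_dd_support _ _ (notMem_tsupport_space hs hz hy t)
  hasDeriv y t _ := hasDerivAt_time_sub (hφ.differentiable (by simp) _)
  smooth t _ := (contDiff_infty.1 hφ 2).comp (f := fun y : 𝔼 => z - (y, t)) (by fun_prop)
  lap_eq t _ y := lap_space_sub hφ z y t

/-- Radial retraction onto the closed ball of radius `7 / 8`. -/
noncomputable def clampX (x : EuclideanSpace ℝ (Fin N)) : EuclideanSpace ℝ (Fin N) :=
  (max 1 (‖x‖ / (7 / 8)))⁻¹ • x

/-- Retraction onto `[-7/8, 7/8]`. -/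
noncomputable def clampT (t : ℝ) : ℝ := max (-(7 / 8)) (min (7 / 8) t)

lemma continuous_clampX : Continuous (clampX : 𝔼 → 𝔼) := by
  unfold clampX
  refine Continuous.smul (Continuous.inv₀ (continuous_const.max (continuous_norm.div_const _)) fun x => ?_) continuous_id
  exact (lt_of_lt_of_le one_pos (le_max_left _ _)).ne'

lemma clampX_mem (x : 𝔼) : clampX x ∈ closedBall (0 : 𝔼) (7 / 8) := by
  have h1 : (0 : ℝ) < max 1 (‖x‖ / (7 / 8)) := lt_of_lt_of_le one_pos (le_max_left _ _)
  rw [mem_closedBall_zero_iff, clampX, norm_smul, norm_inv, Real.norm_of_nonneg h1.le,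
    inv_mul_le_iff₀ h1]
  have := le_max_right 1 (‖x‖ / (7 / 8))
  rw [div_le_iff₀ (by norm_num)] at this
  linarith

lemma clampX_of_mem {x : 𝔼} (hx : x ∈ closedBall (0 : 𝔼) (7 / 8)) : clampX x = x := by
  rw [mem_closedBall_zero_iff] at hx
  rw [clampX, max_eq_left, inv_one, one_smul]
  rw [div_le_one (by norm_num)]; exact hx

lemma continuous_clampT : Continuous clampT := by unfold clampT; fun_prop

lemma clampT_mem (t : ℝ) : clampT t ∈ Icc (-(7 / 8) : ℝ) (7 / 8) :=
  ⟨le_max_left _ _, max_le (by norm_num) (min_le_left _ _)⟩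

lemma clampT_of_mem {t : ℝ} (ht : t ∈ Icc (-(7 / 8) : ℝ) (7 / 8)) : clampT t = t := by
  rw [clampT, min_eq_right ht.2, max_eq_right ht.1]

/-- Extension of a function on the closed cylinder to space-time. -/
noncomputable def extCyl (f : EuclideanSpace ℝ (Fin N) → ℝ → ℝ) (z : EuclideanSpace ℝ (Fin N) × ℝ) : ℝ :=
  f (clampX z.1) (clampT z.2)

lemma measurable_extCyl {f : 𝔼 → ℝ → ℝ} (hf : SepCont f 0 (7 / 8) (Icc (-(7 / 8)) (7 / 8))) :
    Measurable (extCyl f) := by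
  refine measurable_uncurry_of_continuous_of_measurable (u := fun x t => f (clampX x) (clampT t)) ?_ ?_
  · intro t
    exact (hf.space _ (clampT_mem t)).comp_continuous continuous_clampX clampX_mem
  · intro x
    exact ((hf.time _ (clampX_mem x)).comp_continuous continuous_clampT clampT_mem).measurable

section Cylinder
variable {β : Fin m → Fin m → ℝ} {r K : ℝ} {u : Fin m → EuclideanSpace ℝ (Fin N) → ℝ → ℝ}

lemma Sol.extCyl_pos (h : Sol β r u 0 1 (Ioo (-1) 1)) (i : Fin m) (z : 𝔼 × ℝ) : 0 < extCyl (u i) z :=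
  h.pos i _ (closedBall_subset_ball (by norm_num) (clampX_mem _)) _
    (Icc_subset_Ioo (by norm_num) (by norm_num) (clampT_mem _))

lemma Sol.conv_eq (hN : 1 ≤ N) (hr : 0 < r) (h : Sol β r u 0 1 (Ioo (-1) 1))
    (hK : ∀ i, ∀ x ∈ closedBall (0 : 𝔼) (7 / 8), ∀ t ∈ Icc (-(7 / 8) : ℝ) (7 / 8), u i x t ≤ K)
    (i : Fin m) {φ : 𝔼 × ℝ → ℝ} (hφ : ContDiff ℝ ∞ φ) (h0 : ∀ z, 0 ≤ φ z)
    (hs : tsupport φ ⊆ closedBall 0 (1 / 16)) (hz : z ∈ ball 0 (3 / 4)) :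
    let μ := (volume : Measure 𝔼).prod (volume : Measure ℝ)
    conv μ (extCyl (u i)) (dd (timeDir N) φ) z
      - ∑ a, conv μ (extCyl (u i)) (dd (spaceDir a) (dd (spaceDir a) φ)) z =
      conv μ (fun w => sysF β r (fun j => extCyl (u j) w) i) φ z := by
  intro μ
  have hI : Icc (-(7 / 8) : ℝ) (7 / 8) ⊆ Ioo (-1) 1 := Icc_subset_Ioo (by norm_num) (by norm_num)
  have hρ : (7 / 8 : ℝ) < 1 := by norm_num
  have hz0 := h.integral_weakDensity_eq_zero hN hr hρ (by norm_num) hI hK i (by norm_num)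
    (isTest_translate hφ h0 hs hz)
    (fun y => image_eq_zero_of_notMem_tsupport (notMem_tsupport_time hs hz y (by norm_num [abs_of_pos])))
    (fun y => image_eq_zero_of_notMem_tsupport (notMem_tsupport_time hs hz y (by norm_num [abs_of_pos])))
  have hsc : HasCompactSupport φ := (isCompact_closedBall _ _).of_isClosed_subset (isClosed_tsupport φ) hs
  have hm : ∀ j, Measurable (extCyl (u j)) := fun j => measurable_extCyl (h.sepCont hρ hI hK j)
  have hp := h.extCyl_pos
  have hle : ∀ j w, extCyl (u j) w ≤ K := fun j w => hK j _ (clampX_mem _) _ (clampT_mem _)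
  obtain ⟨L, hL0, hL⟩ := exists_sysF_bound β hr K
  have hmF : Measurable fun w => sysF β r (fun j => extCyl (u j) w) i :=
    (continuous_sysF β hr i).measurable.comp (measurable_pi_lambda _ hm)
  have hbF : ∀ w, |sysF β r (fun j => extCyl (u j) w) i| ≤ L := fun w =>
    hL _ (fun j => (hp j w).le) (fun j => hle j w) i
  have hbu : ∀ w, |extCyl (u i) w| ≤ K := fun w => by rw [abs_of_pos (hp i w)]; exact hle i w
  have i1 := integrable_conv_integrand (μ := μ) (hm i) hbu (hφ.dd_smooth (timeDir N)).continuous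
    (hsc.dd (timeDir N)) z
  have i2 := fun a => integrable_conv_integrand (μ := μ) (hm i) hbu
    ((hφ.dd_smooth (spaceDir a)).dd_smooth (spaceDir a)).continuous
    ((hsc.dd (spaceDir a)).dd (spaceDir a)) z
  have i3 := integrable_conv_integrand (μ := μ) hmF hbF hφ.continuous hsc z
  have i2' := integrable_finsetSum Finset.univ fun a _ => i2 a
  have i21 : Integrable (fun w => (∑ a, extCyl (u i) w * dd (spaceDir a) (dd (spaceDir a) φ) (z - w))
      - extCyl (u i) w * dd (timeDir N) φ (z - w)) μ := i2'.sub i1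
  have i4 := i21.fun_add i3
  have e1 : ∫ w, ((∑ a, extCyl (u i) w * dd (spaceDir a) (dd (spaceDir a) φ) (z - w))
      - extCyl (u i) w * dd (timeDir N) φ (z - w))
      + sysF β r (fun j => extCyl (u j) w) i * φ (z - w) ∂μ = 0 := by
    rw [integral_prod_symm _ i4, ← hz0, intervalIntegral.integral_of_le (by norm_num),
      ← setIntegral_eq_integral_of_forall_compl_eq_zero (s := Ioc (-(7 / 8) : ℝ) (7 / 8))]
    · refine setIntegral_congr_fun measurableSet_Ioc fun t ht => ?_
      have htI : t ∈ Icc (-(7 / 8) : ℝ) (7 / 8) := Ioc_subset_Icc_self ht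
      have hsu := h.sepCont hρ hI hK i
      have hsF := h.sepCont_sysF hr hρ hI hK i
      have hT := isTest_translate hφ h0 hs hz
      have hcb : closedBall (0 : 𝔼) (13 / 16) ⊆ closedBall 0 (7 / 8) :=
        closedBall_subset_closedBall (by norm_num)
      unfold weakDensity
      rw [← integral_add ((hsu.mono hcb subset_rfl).integrable_mul
        (η := fun y t => -dd (timeDir N) φ (z - (y, t)) +
          ∑ a, dd (spaceDir a) (dd (spaceDir a) φ) (z - (y, t))) (hT.cont_t.add hT.cont_L)
        (fun y hy s hs' => by rw [hT.supp_t y hy s hs', hT.supp_L y hy s hs', add_zero]) htI)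
        ((hsF.mono hcb subset_rfl).integrable_mul hT.cont hT.supp htI)]
      refine integral_congr_ae (Filter.Eventually.of_forall fun y => ?_)
      dsimp only
      by_cases hy : y ∈ closedBall (0 : 𝔼) (13 / 16)
      · simp only [extCyl, clampX_of_mem (hcb hy), clampT_of_mem htI, mul_add, Finset.mul_sum]
        ring
      · have hn := notMem_tsupport_space hs hz hy t
        simp [dd_support _ hn, dd_dd_support _ _ hn, image_eq_zero_of_notMem_tsupport hn]
    · intro t ht
      have ht' : 7 / 8 ≤ |t| := by
        by_contra hc
        rw [not_le, abs_lt] at hc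
        exact ht ⟨hc.1, hc.2.le⟩
      have : ∀ y : 𝔼, z - (y, t) ∉ tsupport φ := fun y => notMem_tsupport_time hs hz y ht'
      simp [dd_support _ (this _), dd_dd_support _ _ (this _), image_eq_zero_of_notMem_tsupport (this _)]
  rw [integral_add i21 i3, integral_sub i2' i1, integral_finsetSum _ fun a _ => i2 a] at e1
  unfold conv
  linarith

end Cylinder
end MollifiedSystem

section BoundedSolutions
variable {N m : ℕ}
local notation "𝔼" => EuclideanSpace ℝ (Fin N)

lemma tendsto_integral_cutoff {V : Type*} [NormedAddCommGroup V] [NormedSpace ℝ V]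
    [FiniteDimensional ℝ V] [MeasurableSpace V] [BorelSpace V] {μ : Measure V} [μ.IsAddHaarMeasure]
    {χ : V → ℝ} (hχ : Continuous χ) (hs : HasCompactSupport χ) (h0 : ∀ z, 0 ≤ χ z) {L : ℝ}
    {f : ℕ → Fin m → V → ℝ} {g : Fin m → V → ℝ} (hf : ∀ n i, Measurable (f n i))
    (hL : ∀ n i z, |f n i z| ≤ L)
    (hfg : ∀ᵐ z ∂μ, ∀ i, Tendsto (fun n => f n i z) Filter.atTop (𝓝 (g i z))) :
    Tendsto (fun n => ∫ z, ∑ i, χ z * f n i z ^ 2 ∂μ) Filter.atTop (𝓝 (∫ z, ∑ i, χ z * g i z ^ 2 ∂μ)) := by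
  refine tendsto_integral_of_dominated_convergence (fun z => ∑ _i : Fin m, χ z * L ^ 2) ?_ ?_ ?_ ?_
  · intro n
    refine Measurable.aestronglyMeasurable ?_
    exact Finset.measurable_fun_sum _ fun i _ => hχ.measurable.mul ((hf n i).pow_const 2)
  · exact integrable_finsetSum _ fun i _ => (hχ.integrable_of_hasCompactSupport hs).mul_const _
  · intro n
    refine Filter.Eventually.of_forall fun z => ?_
    rw [Real.norm_eq_abs, abs_of_nonneg (Finset.sum_nonneg fun i _ => mul_nonneg (h0 z) (sq_nonneg _))]
    refine Finset.sum_le_sum fun i _ => mul_le_mul_of_nonneg_left ?_ (h0 z)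
    have := hL n i z
    rw [← sq_abs]
    gcongr
  · filter_upwards [hfg] with z hz
    exact tendsto_finsetSum _ fun i _ => ((hz i).pow 2).const_mul _

lemma tendsto_sysF {α : Type*} {l : Filter α} {r : ℝ} (hr : 0 < r) (β : Fin m → Fin m → ℝ)
    {f : α → Fin m → ℝ} {g : Fin m → ℝ} (h : ∀ j, Tendsto (fun a => f a j) l (𝓝 (g j))) (i : Fin m) :
    Tendsto (fun a => sysF β r (fun j => f a j) i) l (𝓝 (sysF β r (fun j => g j) i)) :=
  Filter.Tendsto.comp (g := fun v : Fin m → ℝ => sysF β r v i)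
    ((continuous_sysF β hr i).tendsto g) (tendsto_pi_nhds.2 h)

lemma continuous_sysF_comp {α : Type*} [TopologicalSpace α] {r : ℝ} (hr : 0 < r)
    (β : Fin m → Fin m → ℝ) {f : Fin m → α → ℝ} (h : ∀ j, Continuous (f j)) (i : Fin m) :
    Continuous fun a => sysF β r (fun j => f j a) i :=
  Continuous.comp (g := fun v : Fin m → ℝ => sysF β r v i) (continuous_sysF β hr i)
    (continuous_pi h)

lemma measurable_sysF_comp {α : Type*} [MeasurableSpace α] {r : ℝ} (hr : 0 < r)
    (β : Fin m → Fin m → ℝ) {f : Fin m → α → ℝ} (h : ∀ j, Measurable (f j)) (i : Fin m) :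
    Measurable fun a => sysF β r (fun j => f j a) i := by
  have h1 : Measurable fun v : Fin m → ℝ => sysF β r v i := (continuous_sysF β hr i).measurable
  have h2 : Measurable fun a => fun j => f j a := measurable_pi_lambda _ h
  have h3 := h1.comp h2
  exact h3

set_option maxHeartbeats 1000000 in
theorem local_bound_of_bounded (hN : 1 ≤ N) (hm : 0 < m) {r : ℝ} (hr : 0 < r)
    {β : Fin m → Fin m → ℝ} (hsym : ∀ i j, β i j = β j i) (hβ : ∀ i j, 0 ≤ β i j)
    (hdiag : ∀ i, 0 < β i i)
    (hpB : N = 1 ∨ (2 ≤ N ∧ 2 * r + 1 < ((N : ℝ) * (N + 2)) / ((N : ℝ) - 1) ^ 2)) :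
    ∃ C : ℝ, 0 ≤ C ∧ ∀ (u : Fin m → 𝔼 → ℝ → ℝ) (K : ℝ), Sol β r u 0 1 (Ioo (-1) 1) →
      (∀ i, ∀ x ∈ closedBall (0 : 𝔼) (7 / 8), ∀ t ∈ Icc (-(7 / 8) : ℝ) (7 / 8), u i x t ≤ K) →
      ∫ t in Ioo (-(1 : ℝ) / 2) (1 / 2), ∫ x in ball (0 : 𝔼) (1 / 2),
        ∑ i, sysF β r (fun j => u j x t) i ^ 2 ≤ C := by
  let μ : Measure (𝔼 × ℝ) := (volume : Measure 𝔼).prod (volume : Measure ℝ)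
  let ζb : ContDiffBump (0 : 𝔼 × ℝ) := ⟨1 / 2, 3 / 4, by norm_num, by norm_num⟩
  let ζ : smoothAlg (𝔼 × ℝ) := ⟨ζb, ζb.contDiff⟩
  have hζz : ∀ z ∉ ball (0 : 𝔼 × ℝ) (3 / 4), ζb z = 0 := fun z hz => by
    have : z ∉ Function.support ζb := by rw [ζb.support_eq]; exact hz
    simpa using this
  obtain ⟨k, hk⟩ := exists_nat_ge (2 * (2 * r + 1) / r)
  have hk0 : k ≠ 0 := by
    rintro rfl
    have : 0 < 2 * (2 * r + 1) / r := by positivity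
    norm_num at hk; linarith
  obtain ⟨C, hC0, hC⟩ := core_integral (μ := μ) hN hm hr hsym hβ hdiag hpB (fun a => spaceDir a) (timeDir N) ζ
    ζb.hasCompactSupport (fun _ => ζb.nonneg) (fun _ => ζb.le_one) k hk
  refine ⟨C, hC0, fun u K h hK => ?_⟩
  have hI : Icc (-(7 / 8) : ℝ) (7 / 8) ⊆ Ioo (-1) 1 := Icc_subset_Ioo (by norm_num) (by norm_num)
  have hρ : (7 / 8 : ℝ) < 1 := by norm_num
  have hm : ∀ j, Measurable (extCyl (u j)) := fun j => measurable_extCyl (h.sepCont hρ hI hK j)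
  have hp := h.extCyl_pos
  have hle : ∀ j w, extCyl (u j) w ≤ K := fun j w => hK j _ (clampX_mem _) _ (clampT_mem _)
  obtain ⟨L, hL0, hL⟩ := exists_sysF_bound β hr K
  have hmF : ∀ i, Measurable fun w => sysF β r (fun j => extCyl (u j) w) i := fun i =>
    measurable_sysF_comp hr β hm i
  have hbF : ∀ i w, |sysF β r (fun j => extCyl (u j) w) i| ≤ L := fun i w =>
    hL _ (fun j => (hp j w).le) (fun j => hle j w) i
  have hbu : ∀ i w, |extCyl (u i) w| ≤ K := fun i w => by rw [abs_of_pos (hp i w)]; exact hle i w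
  have lu : ∀ i, LocallyIntegrable (extCyl (u i)) μ := fun i => locallyIntegrable_of_bounded (hm i) (hbu i)
  have lF : ∀ i, LocallyIntegrable (fun w => sysF β r (fun j => extCyl (u j) w) i) μ := fun i =>
    locallyIntegrable_of_bounded (hmF i) (hbF i)
  let φ : ℕ → 𝔼 × ℝ → ℝ := fun n => (bumpSeq (𝔼 × ℝ) n).normed μ
  have hφ : ∀ n, ContDiff ℝ ∞ (φ n) := fun n => (bumpSeq (𝔼 × ℝ) n).contDiff_normed
  have hφs : ∀ n, HasCompactSupport (φ n) := fun n => (bumpSeq (𝔼 × ℝ) n).hasCompactSupport_normed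
  have hφt : ∀ n, tsupport (φ n) ⊆ closedBall 0 (1 / 16) := fun n => by
    change tsupport ((bumpSeq (𝔼 × ℝ) n).normed μ) ⊆ _
    rw [ContDiffBump.tsupport_normed_eq]
    exact closedBall_subset_closedBall (bumpSeq_rOut_le n)
  let U : ℕ → Fin m → 𝔼 × ℝ → ℝ := fun n i => conv μ (extCyl (u i)) (φ n)
  let G : ℕ → Fin m → 𝔼 × ℝ → ℝ := fun n i => conv μ (fun w => sysF β r (fun j => extCyl (u j) w) i) (φ n)
  have hUs : ∀ n i, ContDiff ℝ ∞ (U n i) := fun n i => contDiff_conv (lu i) (hφ n) (hφs n)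
  have hGs : ∀ n i, ContDiff ℝ ∞ (G n i) := fun n i => contDiff_conv (lF i) (hφ n) (hφs n)
  have hUp : ∀ n i z, 0 < U n i z := fun n i z => conv_normed_pos (hm i) (hbu i) (hp i) _ z
  have hUK : ∀ n i z, U n i z ≤ K := fun n i z =>
    (le_abs_self _).trans (abs_conv_normed_le (hm i) (hbu i) _ z)
  have hGL : ∀ n i z, |G n i z| ≤ L := fun n i z => abs_conv_normed_le (hmF i) (hbF i) _ z
  have hFL : ∀ n i z, |sysF β r (fun j => U n j z) i| ≤ L := fun n i z =>
    hL _ (fun j => (hUp n j z).le) (fun j => hUK n j z) i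
  have hFc : ∀ n i, Continuous fun z => sysF β r (fun j => U n j z) i := fun n i =>
    continuous_sysF_comp hr β (fun j => (hUs n j).continuous) i
  have hUt : ∀ᵐ z ∂μ, ∀ i, Tendsto (fun n => U n i z) Filter.atTop (𝓝 (extCyl (u i) z)) :=
    ae_all_iff.2 fun i => ae_tendsto_conv_bumpSeq (lu i)
  have hGt : ∀ᵐ z ∂μ, ∀ i, Tendsto (fun n => G n i z) Filter.atTop
      (𝓝 (sysF β r (fun j => extCyl (u j) z) i)) :=
    ae_all_iff.2 fun i => ae_tendsto_conv_bumpSeq (lF i)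
  have hFt : ∀ᵐ z ∂μ, ∀ i, Tendsto (fun n => sysF β r (fun j => U n j z) i) Filter.atTop
      (𝓝 (sysF β r (fun j => extCyl (u j) z) i)) := by
    filter_upwards [hUt] with z hz i
    exact tendsto_sysF hr β hz i
  have hχ : Continuous fun z => ζb z ^ k := ζb.continuous.pow k
  have hχs : HasCompactSupport fun z => ζb z ^ k :=
    ζb.hasCompactSupport.comp_left (g := fun s : ℝ => s ^ k) (zero_pow hk0)
  have hχ0 : ∀ z, 0 ≤ ζb z ^ k := fun z => pow_nonneg ζb.nonneg _
  have key : ∀ n, ∫ z, ∑ i, ζb z ^ k * sysF β r (fun j => U n j z) i ^ 2 ∂μ ≤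
      C * (1 + ∫ z, ∑ i, ζb z ^ k * (G n i z - sysF β r (fun j => U n j z) i) ^ 2 ∂μ) := by
    intro n
    have := hC (fun i => ⟨U n i, hUs n i⟩) (hUp n)
    refine this.trans_eq ?_
    congr 2
    refine integral_congr_ae (Filter.Eventually.of_forall fun z => ?_)
    refine Finset.sum_congr rfl fun i _ => ?_
    change ζb z ^ k * _ = _
    by_cases hz : z ∈ ball (0 : 𝔼 × ℝ) (3 / 4)
    · congr 3
      have e := h.conv_eq hN hr hK i (hφ n) (fun w => (bumpSeq (𝔼 × ℝ) n).nonneg_normed w) (hφt n) hz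
      change dd (timeDir N) (U n i) z - ∑ a, dd (spaceDir a) (dd (spaceDir a) (U n i)) z = G n i z
      refine Eq.trans ?_ e
      have e1 : ∀ a, dd (spaceDir a) (dd (spaceDir a) (U n i)) z =
          conv μ (extCyl (u i)) (dd (spaceDir a) (dd (spaceDir a) (φ n))) z := fun a => by
        rw [dd_conv (lu i) (hφ n) (hφs n), dd_conv (lu i) ((hφ n).dd_smooth _) ((hφs n).dd _)]
      rw [dd_conv (lu i) (hφ n) (hφs n)]
      simp only [e1]
      rfl
    · rw [hζz z hz, zero_pow hk0, zero_mul, zero_mul]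
  have t1 := tendsto_integral_cutoff (μ := μ) hχ hχs hχ0 (fun n i => (hFc n i).measurable) hFL hFt
  have t2 := tendsto_integral_cutoff (μ := μ) hχ hχs hχ0
    (f := fun n i z => G n i z - sysF β r (fun j => U n j z) i) (L := L + L)
    (fun n i => ((hGs n i).continuous.sub (hFc n i)).measurable)
    (fun n i z => (abs_sub _ _).trans (add_le_add (hGL n i z) (hFL n i z)))
    (g := fun _ _ => 0) (by
      filter_upwards [hFt, hGt] with z h1 h2 i
      simpa using (h2 i).sub (h1 i))
  have lim := le_of_tendsto_of_tendsto' t1 ((t2.const_add 1).const_mul C) key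
  simp only [ne_eq, OfNat.ofNat_ne_zero, not_false_eq_true, zero_pow, mul_zero, Finset.sum_const_zero,
    integral_zero, add_zero, mul_one] at lim
  refine le_trans ?_ lim
  set Φ : 𝔼 × ℝ → ℝ := fun z => ∑ i, sysF β r (fun j => extCyl (u j) z) i ^ 2 with hΦ
  have hΦ0 : ∀ z, 0 ≤ Φ z := fun z => Finset.sum_nonneg fun i _ => sq_nonneg _
  have hΦi : ∀ s : Set (𝔼 × ℝ), μ s ≠ ⊤ → IntegrableOn Φ s μ := fun s hs => by
    refine Measure.integrableOn_of_bounded (M := ∑ _i : Fin m, L ^ 2) hs ?_ ?_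
    · exact (Finset.measurable_fun_sum _ fun i _ => (hmF i).pow_const 2).aestronglyMeasurable
    · refine Filter.Eventually.of_forall fun z => ?_
      rw [Real.norm_eq_abs, abs_of_nonneg (hΦ0 z)]
      refine Finset.sum_le_sum fun i _ => ?_
      have := hbF i z
      rw [← sq_abs]; gcongr
  have hsub : ball (0 : 𝔼) (1 / 2) ×ˢ Ioo (-(1 : ℝ) / 2) (1 / 2) ⊆ closedBall (0 : 𝔼 × ℝ) (1 / 2) := by
    rintro ⟨x, t⟩ ⟨hx, ht⟩
    rw [mem_closedBall_zero_iff, Prod.norm_def, max_le_iff]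
    refine ⟨(mem_ball_zero_iff.1 hx).le, ?_⟩
    rw [Real.norm_eq_abs, abs_le]; constructor <;> linarith [ht.1, ht.2]
  have hfin : μ (ball (0 : 𝔼) (1 / 2) ×ˢ Ioo (-(1 : ℝ) / 2) (1 / 2)) ≠ ⊤ :=
    ((measure_mono hsub).trans_lt (isCompact_closedBall _ _).measure_lt_top).ne
  calc ∫ t in Ioo (-(1 : ℝ) / 2) (1 / 2), ∫ x in ball (0 : 𝔼) (1 / 2),
        ∑ i, sysF β r (fun j => u j x t) i ^ 2
      = ∫ t in Ioo (-(1 : ℝ) / 2) (1 / 2), ∫ x in ball (0 : 𝔼) (1 / 2), Φ (x, t) := by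
        refine setIntegral_congr_fun measurableSet_Ioo fun t ht => ?_
        refine setIntegral_congr_fun measurableSet_ball fun x hx => ?_
        have hx' : x ∈ closedBall (0 : 𝔼) (7 / 8) :=
          ball_subset_closedBall (ball_subset_ball (by norm_num) hx)
        have ht' : t ∈ Icc (-(7 / 8) : ℝ) (7 / 8) := ⟨by linarith [ht.1], by linarith [ht.2]⟩
        simp only [hΦ, extCyl, clampX_of_mem hx', clampT_of_mem ht']
    _ = ∫ z in ball (0 : 𝔼) (1 / 2) ×ˢ Ioo (-(1 : ℝ) / 2) (1 / 2), Φ z ∂μ := by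
        have hsw := setIntegral_prod_swap (μ := (volume : Measure 𝔼)) (ν := (volume : Measure ℝ))
          (ball (0 : 𝔼) (1 / 2)) (Ioo (-(1 : ℝ) / 2) (1 / 2)) Φ
        rw [← hsw, setIntegral_prod]
        · rfl
        · have := (hΦi _ hfin).swap
          exact this
    _ ≤ ∫ z in ball (0 : 𝔼) (1 / 2) ×ˢ Ioo (-(1 : ℝ) / 2) (1 / 2),
          ∑ i, ζb z ^ k * sysF β r (fun j => extCyl (u j) z) i ^ 2 ∂μ := by
        refine le_of_eq (setIntegral_congr_fun (measurableSet_ball.prod measurableSet_Ioo) fun z hz => ?_)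
        have : ζb z = 1 := ζb.one_of_mem_closedBall (hsub hz)
        simp only [hΦ, this, one_pow, one_mul]
    _ ≤ ∫ z, ∑ i, ζb z ^ k * sysF β r (fun j => extCyl (u j) z) i ^ 2 ∂μ := by
        refine setIntegral_le_integral ?_ (Filter.Eventually.of_forall fun z =>
          Finset.sum_nonneg fun i _ => mul_nonneg (hχ0 z) (sq_nonneg _))
        refine integrable_finsetSum _ fun i _ => ?_
        refine (hχ.integrable_of_hasCompactSupport hχs).mul_bdd (c := L ^ 2)
          ((hmF i).pow_const 2).aestronglyMeasurable (Filter.Eventually.of_forall fun z => ?_)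
        have := hbF i z
        rw [Real.norm_eq_abs, abs_pow]; gcongr

end BoundedSolutions

section LowerHarnack
variable {N m : ℕ}
local notation "𝔼" => EuclideanSpace ℝ (Fin N)

lemma exists_kerTest_lower (N : ℕ) (l : ℝ) : ∃ c, 0 < c ∧ ∀ (x y : EuclideanSpace ℝ (Fin N)) (ε t : ℝ),
    dist y x ≤ 1 / 4 → ε ∈ Ioc (0 : ℝ) 1 → t ∈ Icc (-(1 / 8) : ℝ) 0 → 0 ≤ l →
    c ≤ kerTest x l ε (1 / 2) (cubeProf (1 / 2)) y t := by
  refine ⟨exp (-l * (5 / 8)) * ((4 * π * (13 / 8)) ^ (-((N : ℝ) / 2)) * exp (-(1 / 16) / 2)) * (27 / 64),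
    by positivity, fun x y ε t hd hε ht hl => ?_⟩
  have hs0 : (0 : ℝ) ≤ ‖y - x‖ ^ 2 := by positivity
  have hs : ‖y - x‖ ^ 2 ≤ 1 / 16 := by
    rw [dist_eq_norm] at hd
    calc ‖y - x‖ ^ 2 ≤ (1 / 4) ^ 2 := by gcongr
      _ = 1 / 16 := by norm_num
  have hτ1 : 1 / 2 ≤ 1 / 2 + ε - t := by linarith [hε.1, ht.2]
  have hτ2 : 1 / 2 + ε - t ≤ 13 / 8 := by linarith [hε.2, ht.1]
  unfold kerTest heatKer
  generalize 1 / 2 + ε - t = τ at hτ1 hτ2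
  generalize ‖y - x‖ ^ 2 = s at hs0 hs
  have e1 : exp (-l * (5 / 8)) ≤ exp (-l * (1 / 2 - t)) := by
    rw [exp_le_exp]; nlinarith [ht.1]
  have e2 : (4 * π * (13 / 8)) ^ (-((N : ℝ) / 2)) ≤ (4 * π * τ) ^ (-((N : ℝ) / 2)) := by
    refine rpow_le_rpow_of_nonpos (by positivity) (by gcongr) ?_
    rw [neg_nonpos]; positivity
  have e3 : exp (-(1 / 16) / 2) ≤ exp (-s / (4 * τ)) := by
    rw [exp_le_exp, neg_div, neg_div, neg_le_neg_iff, div_le_div_iff₀ (by positivity) (by norm_num)]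
    nlinarith
  have e4 : (27 / 64 : ℝ) ≤ cubeProf (1 / 2) s := by
    unfold cubeProf
    calc (27 / 64 : ℝ) = (3 / 4) ^ 3 := by norm_num
      _ ≤ max (1 - s / (1 / 2) ^ 2) 0 ^ 3 := by
        gcongr
        refine le_trans ?_ (le_max_left _ _)
        norm_num; linarith
  gcongr

variable {β : Fin m → Fin m → ℝ} {r : ℝ} {u : Fin m → EuclideanSpace ℝ (Fin N) → ℝ → ℝ}

/-- Bounded truncations of solutions are supersolutions of the heat equation. -/
lemma Sol.ptSuper_trunc (hβ : ∀ i j, 0 ≤ β i j) {x₀ : 𝔼} {ρ : ℝ} {I : Set ℝ} (h : Sol β r u x₀ ρ I)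
    {k : ℝ} (hk : 0 < k) (i : Fin m) :
    PtSuper (fun x t => k - k ^ 2 / (k + u i x t)) (fun _ _ => 0) x₀ ρ I where
  space t ht := by
    refine contDiffOn_const.sub (contDiffOn_const.div (contDiffOn_const.add (h.space i t ht)) fun x hx => ?_)
    have := h.pos i x hx t ht
    positivity
  time y hy t ht := by
    have hp := h.pos i y hy t ht
    have hd : ∀ s : ℝ, 0 < s → HasDerivAt (fun s => k - k ^ 2 / (k + s)) (k ^ 2 / (k + s) ^ 2) s := by
      intro s hs
      have h1 : HasDerivAt (fun s : ℝ => k + s) 1 s := (hasDerivAt_id' s).const_add k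
      convert! ((h1.fun_inv (by positivity)).const_mul (k ^ 2)).const_sub k using 1
      ring
    have hd2 : HasDerivAt (fun s => k ^ 2 / (k + s) ^ 2) (-2 * k ^ 2 / (k + u i y t) ^ 3) (u i y t) := by
      have h1 : HasDerivAt (fun s : ℝ => k + s) 1 (u i y t) := (hasDerivAt_id' _).const_add k
      have h2 := ((h1.fun_pow 2).fun_inv (by positivity)).const_mul (k ^ 2)
      convert! h2 using 1
      have : k + u i y t ≠ 0 := by positivity
      field_simp
      norm_num
    have hc : ContDiffAt ℝ 2 (fun s => k - k ^ 2 / (k + s)) (u i y t) :=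
      contDiffAt_const.sub (contDiffAt_const.div (contDiffAt_const.add contDiffAt_id) (by positivity))
    refine ⟨_, HasDerivAt.comp (h₂ := fun s => k - k ^ 2 / (k + s)) t (hd _ hp) (h.time i y hy t ht), ?_⟩
    have hl := lap_comp ((h.space i t ht).contDiffAt (isOpen_ball.mem_nhds hy)) hc
      ((eventually_gt_nhds hp).mono hd) hd2
    rw [hl]
    have hF : 0 ≤ sysF β r (fun j => u j y t) i := sysF_nonneg hβ (fun j => (h.pos j y hy t ht).le) i
    have hg : 0 ≤ gradSq (fun x => u i x t) y := Finset.sum_nonneg fun _ _ => sq_nonneg _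
    have h1 : -2 * k ^ 2 / (k + u i y t) ^ 3 * gradSq (fun x => u i x t) y ≤ 0 := by
      refine mul_nonpos_of_nonpos_of_nonneg ?_ hg
      rw [neg_mul, neg_div, neg_nonpos]; positivity
    have h2 : 0 ≤ k ^ 2 / (k + u i y t) ^ 2 * sysF β r (fun j => u j y t) i := by positivity
    linarith

/-- A lower Harnack estimate which does not require local boundedness. -/
theorem lower_harnack (hN : 1 ≤ N) {β : Fin m → Fin m → ℝ} (hβ : ∀ i j, 0 ≤ β i j) (r : ℝ) :
    ∃ c, 0 < c ∧ ∀ u : Fin m → 𝔼 → ℝ → ℝ, Sol β r u 0 1 (Ioo (-1) 1) → ∀ i, ∀ x : 𝔼, ‖x‖ ≤ 1 / 8 →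
      ∀ t ∈ Icc (-(1 / 8) : ℝ) 0, c * ∫ y in closedBall 0 (1 / 8), u i y t ≤ u i x (1 / 2) := by
  set l : ℝ := (6 * N + 24) ^ 2 / (96 * (1 / 2 : ℝ) ^ 2) with hl
  have hl0 : 0 ≤ l := by positivity
  obtain ⟨c, hc0, hc⟩ := exists_kerTest_lower N l
  refine ⟨c / 2, by positivity, fun u h i x hx t ht => ?_⟩
  have h12 : t ≤ 1 / 2 := by linarith [ht.2]
  have hI : Icc t (1 / 2) ⊆ Ioo (-1 : ℝ) 1 := Icc_subset_Ioo (by linarith [ht.1]) (by norm_num)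
  have htI : t ∈ Ioo (-1 : ℝ) 1 := hI ⟨le_rfl, h12⟩
  have hut : ContinuousOn (fun y => u i y t) (closedBall (0 : 𝔼) (1 / 8)) :=
    (h.space i t htI).continuousOn.mono (closedBall_subset_ball (by norm_num))
  obtain ⟨M, hM⟩ := (isCompact_closedBall (0 : 𝔼) (1 / 8)).exists_bound_of_continuousOn hut
  set k : ℝ := max M 1
  have hk : 0 < k := lt_of_lt_of_le one_pos (le_max_right _ _)
  set v : 𝔼 → ℝ → ℝ := fun x t => k - k ^ 2 / (k + u i x t) with hv
  have hpt : PtSuper v (fun _ _ => 0) 0 1 (Icc t (1 / 2)) :=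
    (h.mono subset_rfl hI).ptSuper_trunc hβ hk i
  have hv0 : ∀ y ∈ ball (0 : 𝔼) 1, ∀ s ∈ Icc t (1 / 2), 0 ≤ v y s ∧ v y s ≤ k ∧ v y s ≤ u i y s := by
    intro y hy s hs
    have hp := h.pos i y hy s (hI hs)
    refine ⟨?_, ?_, ?_⟩
    · rw [hv, sub_nonneg, div_le_iff₀ (by positivity)]; nlinarith
    · rw [hv, sub_le_self_iff]; positivity
    · rw [hv, sub_le_iff_le_add', ← sub_le_iff_le_add, le_div_iff₀ (by positivity)]; nlinarith
  have hsc : SepCont v 0 (7 / 8) (Icc t (1 / 2)) := by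
    have hb : closedBall (0 : 𝔼) (7 / 8) ⊆ ball 0 1 := closedBall_subset_ball (by norm_num)
    refine ⟨⟨k, fun y hy s hs => ?_⟩, fun s hs => (hpt.space s hs).continuousOn.mono hb, fun y hy s hs => ?_⟩
    · obtain ⟨h1, h2, -⟩ := hv0 y (hb hy) s hs
      rwa [abs_of_nonneg h1]
    · obtain ⟨w, hw, -⟩ := hpt.time y (hb hy) s hs
      exact hw.continuousAt.continuousWithinAt
  have hsc0 : SepCont (fun (_ : 𝔼) (_ : ℝ) => (0 : ℝ)) 0 (7 / 8) (Icc t (1 / 2)) :=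
    ⟨⟨0, by simp⟩, fun _ _ => continuousOn_const, fun _ _ => continuousOn_const⟩
  have hW := weakSuper_of_ptSuper hN (by norm_num : (7 / 8 : ℝ) < 1) h12 hsc hsc0 hpt
  have hWx : WeakSuper v (fun _ _ => 0) x (3 / 4) t (1 / 2) := hW.recenter (by rw [dist_zero_right]; linarith)
  have hcb : closedBall x (1 / 2) ⊆ closedBall (0 : 𝔼) (7 / 8) :=
    closedBall_subset_closedBall' (by rw [dist_zero_right]; linarith)
  have hcb1 : closedBall x (1 / 2) ⊆ ball (0 : 𝔼) 1 :=
    hcb.trans (closedBall_subset_ball (by norm_num))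
  have h8 : closedBall (0 : 𝔼) (1 / 8) ⊆ ball (0 : 𝔼) 1 := closedBall_subset_ball (by norm_num)
  have hxb : x ∈ ball (0 : 𝔼) 1 := hcb1 (mem_closedBall_self (by norm_num))
  have htt : t ∈ Icc t (1 / 2) := ⟨le_rfl, h12⟩
  refine le_trans ?_ (hv0 x hxb _ ⟨h12, le_rfl⟩).2.2
  refine heat_lower_pos (l := l) (by norm_num : (0 : ℝ) < 1 / 2) le_rfl (by norm_num) h12 (hsc.mono hcb subset_rfl) hWx
    (fun y hy s hs => (hv0 y (hcb1 hy) s hs).1) (fun _ _ _ _ => le_rfl) fun ε hε => ?_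
  have hT := isTest_ker (N := N) (l := l) (t₁ := t) (t₂ := 1 / 2) x hε.1 (by norm_num : (0 : ℝ) ≤ 1 / 2)
    (profile_cube (by norm_num : (0 : ℝ) < 1 / 2))
  have hint := (hsc.mono hcb subset_rfl).integrable_mul hT.cont hT.supp htt
  have hnn : ∀ y, 0 ≤ v y t * kerTest x l ε (1 / 2) (cubeProf (1 / 2)) y t := fun y => by
    by_cases hy : y ∈ closedBall x (1 / 2)
    · exact mul_nonneg (hv0 y (hcb1 hy) t htt).1 (hT.nonneg y t htt)
    · rw [hT.supp y hy t htt, mul_zero]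
  calc c / 2 * ∫ y in closedBall 0 (1 / 8), u i y t
      = ∫ y in closedBall 0 (1 / 8), c / 2 * u i y t := (integral_const_mul _ _).symm
    _ ≤ ∫ y in closedBall 0 (1 / 8), v y t * kerTest x l ε (1 / 2) (cubeProf (1 / 2)) y t := by
      refine setIntegral_mono_on ?_ hint.integrableOn measurableSet_closedBall fun y hy => ?_
      · exact ((hut.integrableOn_compact (isCompact_closedBall _ _))).const_mul _
      have hp := h.pos i y (h8 hy) t htI
      have hyk : u i y t ≤ k := ((le_abs_self _).trans (hM y hy)).trans (le_max_left _ _)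
      have hvy : u i y t / 2 ≤ v y t := by
        rw [hv, le_sub_comm, div_le_iff₀ (by positivity)]; nlinarith
      have hd : dist y x ≤ 1 / 4 := by
        rw [mem_closedBall, dist_zero_right] at hy
        rw [dist_eq_norm]; linarith [norm_sub_le y x]
      have hcc := hc x y ε t hd hε ht hl0
      calc c / 2 * u i y t = u i y t / 2 * c := by ring
        _ ≤ v y t * kerTest x l ε (1 / 2) (cubeProf (1 / 2)) y t :=
          mul_le_mul hvy hcc hc0.le (hv0 y (h8 hy) t htt).1
    _ ≤ ∫ y, v y t * kerTest x l ε (1 / 2) (cubeProf (1 / 2)) y t :=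
      setIntegral_le_integral hint (Filter.Eventually.of_forall hnn)

end LowerHarnack

section MeanValue
variable {N m : ℕ}
local notation "𝔼" => EuclideanSpace ℝ (Fin N)

lemma kerTest_upper {x y : 𝔼} {ε t : ℝ} (hε : ε ∈ Ioc (0 : ℝ) 1) (ht : t ≤ -(1 / 8)) {R : ℝ} :
    kerTest x 0 ε 0 (flatProf R) y t ≤ (4 * π * (1 / 8)) ^ (-((N : ℝ) / 2)) := by
  unfold kerTest heatKer
  have hτ : 1 / 8 ≤ 0 + ε - t := by linarith [hε.1]
  generalize 0 + ε - t = τ at hτ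
  have e2 : (4 * π * τ) ^ (-((N : ℝ) / 2)) ≤ (4 * π * (1 / 8)) ^ (-((N : ℝ) / 2)) := by
    refine rpow_le_rpow_of_nonpos (by positivity) (by gcongr) ?_
    rw [neg_nonpos]; positivity
  have e3 : exp (-‖y - x‖ ^ 2 / (4 * τ)) ≤ 1 := by
    rw [exp_le_one_iff, neg_div, neg_nonpos]; positivity
  rw [neg_zero, zero_mul, exp_zero, one_mul]
  calc _ ≤ (4 * π * (1 / 8)) ^ (-((N : ℝ) / 2)) * 1 * 1 := by
        gcongr
        · exact flatProf_nonneg _ _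
        · exact flatProf_le_one _ _
    _ = _ := by ring

lemma exists_le_average {f : ℝ → ℝ} (hf : ContinuousOn f (Icc (-(1 / 4)) 0))
    (h0 : ∀ t ∈ Icc (-(1 / 4) : ℝ) 0, 0 ≤ f t) :
    ∃ t ∈ Icc (-(1 / 4) : ℝ) (-(1 / 8)), f t ≤ 8 * ∫ s in -(1 / 4)..0, f s ∧
      ∫ s in t..0, f s ≤ ∫ s in -(1 / 4)..0, f s := by
  have hs : Icc (-(1 / 4) : ℝ) (-(1 / 8)) ⊆ Icc (-(1 / 4)) 0 := Icc_subset_Icc le_rfl (by norm_num)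
  obtain ⟨t, ht, hmin⟩ := isCompact_Icc.exists_isMinOn (nonempty_Icc.2 (by norm_num)) (hf.mono hs)
  have hi : ∀ a ∈ Icc (-(1 / 4) : ℝ) 0, ∀ b ∈ Icc (-(1 / 4) : ℝ) 0, IntervalIntegrable f volume a b :=
    fun a ha b hb => (hf.mono (uIcc_subset_Icc ha hb)).intervalIntegrable
  have m0 : (-(1 / 4) : ℝ) ∈ Icc (-(1 / 4) : ℝ) 0 := ⟨le_rfl, by norm_num⟩
  have m1 : (-(1 / 8) : ℝ) ∈ Icc (-(1 / 4) : ℝ) 0 := ⟨by norm_num, by norm_num⟩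
  have m2 : (0 : ℝ) ∈ Icc (-(1 / 4) : ℝ) 0 := ⟨by norm_num, le_rfl⟩
  have pos : ∀ a ∈ Icc (-(1 / 4) : ℝ) 0, ∀ b ∈ Icc (-(1 / 4) : ℝ) 0, a ≤ b → 0 ≤ ∫ s in a..b, f s :=
    fun a ha b hb hab => intervalIntegral.integral_nonneg hab fun s hs =>
      h0 s ⟨ha.1.trans hs.1, hs.2.trans hb.2⟩
  refine ⟨t, ht, ?_, ?_⟩
  · have h1 : ∫ s in -(1 / 4)..-(1 / 8), f t ≤ ∫ s in -(1 / 4)..-(1 / 8), f s :=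
      intervalIntegral.integral_mono_on (by norm_num) (by simp) (hi _ m0 _ m1) fun s hs => hmin hs
    have h2 := intervalIntegral.integral_add_adjacent_intervals (hi _ m0 _ m1) (hi _ m1 _ m2)
    have h3 := pos _ m1 _ m2 (by norm_num)
    rw [intervalIntegral.integral_const, smul_eq_mul] at h1
    norm_num at h1 h2 h3 ⊢
    linarith
  · have h2 := intervalIntegral.integral_add_adjacent_intervals (hi _ m0 _ (hs ht)) (hi _ (hs ht) _ m2)
    have h3 := pos _ m0 _ (hs ht) ht.1
    linarith

/-- A local mean value inequality for solutions with a linear bound on the nonlinearity. -/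
theorem mean_value_upper (hN : 1 ≤ N) (β : Fin m → Fin m → ℝ) (r : ℝ) {k : ℝ} (hk : 0 ≤ k) :
    ∃ C, 0 ≤ C ∧ ∀ (u : Fin m → 𝔼 → ℝ → ℝ) (K : ℝ) (f : ℝ → ℝ), Sol β r u 0 (7 / 8) (Icc (-(1 / 4)) 0) →
      (∀ i, ∀ x ∈ closedBall (0 : 𝔼) (3 / 4), ∀ t ∈ Icc (-(1 / 4) : ℝ) 0, u i x t ≤ K) →
      (∀ x ∈ ball (0 : 𝔼) (7 / 8), ∀ t ∈ Icc (-(1 / 4) : ℝ) 0,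
        ∑ i, sysF β r (fun j => u j x t) i ≤ k * ∑ i, u i x t) →
      ContinuousOn f (Icc (-(1 / 4)) 0) →
      (∀ t ∈ Icc (-(1 / 4) : ℝ) 0, ∫ y in closedBall (0 : 𝔼) (1 / 2), ∑ i, u i y t ≤ f t) →
      ∑ i, u i 0 0 ≤ C * ∫ t in -(1 / 4)..0, f t := by
  obtain ⟨C, hC0, hC⟩ := heat_lower_flat hN (by norm_num : (0 : ℝ) < 1 / 2)
  set c₁ : ℝ := (4 * π * (1 / 8)) ^ (-((N : ℝ) / 2)) with hc₁
  have hc0 : 0 ≤ c₁ := by positivity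
  refine ⟨exp (k / 4) * (8 * c₁ + C), by positivity, fun u K f h hK hF hf hfm => ?_⟩
  have hsc : ∀ i, SepCont (u i) 0 (3 / 4) (Icc (-(1 / 4)) 0) := fun i =>
    h.sepCont (by norm_num) subset_rfl hK i
  have hb : closedBall (0 : 𝔼) (3 / 4) ⊆ ball 0 (7 / 8) := closedBall_subset_ball (by norm_num)
  have hb2 : closedBall (0 : 𝔼) (1 / 2) ⊆ closedBall 0 (3 / 4) := closedBall_subset_closedBall (by norm_num)
  have hsw := (SepCont.sum (s := Finset.univ) fun i _ => hsc i)
  have hw0 : ∀ y ∈ ball (0 : 𝔼) (7 / 8), ∀ t ∈ Icc (-(1 / 4) : ℝ) 0, 0 ≤ ∑ i, u i y t := fun y hy t ht =>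
    Finset.sum_nonneg fun i _ => (h.pos i y hy t ht).le
  have hf0 : ∀ t ∈ Icc (-(1 / 4) : ℝ) 0, 0 ≤ f t := fun t ht =>
    (setIntegral_nonneg measurableSet_closedBall fun y hy => hw0 y (hb (hb2 hy)) t ht).trans (hfm t ht)
  obtain ⟨t₁, ht₁, hft, hfi⟩ := exists_le_average hf hf0
  set v : 𝔼 → ℝ → ℝ := fun y t => -(exp (-k * t) * ∑ i, u i y t) with hv
  have hJ : Icc t₁ 0 ⊆ Icc (-(1 / 4)) 0 := Icc_subset_Icc ht₁.1 le_rfl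
  have h10 : t₁ ≤ 0 := by linarith [ht₁.2]
  have hexp : ∀ t ∈ Icc (-(1 / 4) : ℝ) 0, exp (-k * t) ≤ exp (k / 4) := fun t ht => by
    rw [exp_le_exp]; nlinarith [ht.1]
  have hpt : PtSuper v (fun _ _ => 0) 0 (7 / 8) (Icc t₁ 0) := by
    constructor
    · intro t ht
      exact (contDiffOn_const.mul (ContDiffOn.sum fun i _ => h.space i t (hJ ht))).neg
    · intro y hy t ht
      have hc : ∀ i, ContDiffAt ℝ 2 (fun y => u i y t) y := fun i =>
        (h.space i t (hJ ht)).contDiffAt (isOpen_ball.mem_nhds hy)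
      have hcs : ContDiffAt ℝ 2 (fun y => ∑ i, u i y t) y := ContDiffAt.sum fun i _ => hc i
      have h1 : HasDerivAt (fun t => exp (-k * t)) (-k * exp (-k * t)) t := by
        convert! ((hasDerivAt_id' t).const_mul (-k)).exp using 1
        ring
      have h2 : HasDerivAt (fun t => ∑ i, u i y t)
          (∑ i, (lap (fun x => u i x t) y + sysF β r (fun j => u j y t) i)) t :=
        HasDerivAt.fun_sum fun i _ => h.time i y hy t (hJ ht)
      refine ⟨_, (h1.fun_mul h2).fun_neg, ?_⟩
      rw [hv, lap_neg (contDiffAt_const.mul hcs), lap_const_mul hcs, lap_sum _ fun i _ => hc i,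
        Finset.sum_add_distrib]
      have h3 := hF y hy t (hJ ht)
      nlinarith [mul_le_mul_of_nonneg_left h3 (exp_pos (-k * t)).le]
  have hscv : SepCont v 0 (3 / 4) (Icc t₁ 0) := by
    obtain ⟨L, hL⟩ := hsw.bdd
    refine ⟨⟨exp (k / 4) * L, fun y hy t ht => ?_⟩, fun t ht => ?_, fun y hy => ?_⟩
    · rw [hv, abs_neg, abs_mul, abs_of_pos (exp_pos _)]
      have := hL y hy t (hJ ht)
      have := hexp t (hJ ht)
      gcongr
    · exact (continuousOn_const.mul (hsw.space t (hJ ht))).neg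
    · refine (ContinuousOn.mul ?_ ((hsw.time y hy).mono hJ)).neg
      fun_prop
  have hsc0 : ∀ ρ : ℝ, SepCont (fun (_ : 𝔼) (_ : ℝ) => (0 : ℝ)) 0 ρ (Icc t₁ 0) := fun _ =>
    ⟨⟨0, by simp⟩, fun _ _ => continuousOn_const, fun _ _ => continuousOn_const⟩
  have hW := weakSuper_of_ptSuper hN (by norm_num : (3 / 4 : ℝ) < 7 / 8) h10 hscv (hsc0 _) hpt
  have hwi : ∀ t ∈ Icc (-(1 / 4) : ℝ) 0, IntegrableOn (fun y => ∑ i, u i y t) (closedBall (0 : 𝔼) (1 / 2)) :=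
    fun t ht => ((hsw.space t ht).mono hb2).integrableOn_compact (isCompact_closedBall _ _)
  have ht₁' : t₁ ∈ Icc (-(1 / 4) : ℝ) 0 := ⟨ht₁.1, h10⟩
  have key := hC v (fun _ _ => 0) 0 (3 / 4) t₁ 0 0 (-(c₁ * (exp (k / 4) * f t₁))) (fun t => exp (k / 4) * f t)
    (by norm_num) h10 (hscv.mono hb2 subset_rfl) (hsc0 _) hW le_rfl (fun _ _ _ _ => by simp)
    (continuousOn_const.mul (hf.mono hJ)) ?_ ?_
  · rw [intervalIntegral.integral_const_mul] at key
    have e : v 0 0 = -∑ i, u i 0 0 := by simp [hv]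
    rw [e] at key
    have hk4 := exp_pos (k / 4)
    have a1 : c₁ * (exp (k / 4) * f t₁) ≤ c₁ * (exp (k / 4) * (8 * ∫ s in -(1 / 4)..0, f s)) := by gcongr
    have a2 : C * (exp (k / 4) * ∫ s in t₁..0, f s) ≤ C * (exp (k / 4) * ∫ s in -(1 / 4)..0, f s) := by
      gcongr
    nlinarith
  · intro t ht
    calc ∫ y in closedBall (0 : 𝔼) (1 / 2), |v y t|
        ≤ ∫ y in closedBall (0 : 𝔼) (1 / 2), exp (k / 4) * ∑ i, u i y t := by
          refine setIntegral_mono_on ?_ ((hwi t (hJ ht)).const_mul _) measurableSet_closedBall fun y hy => ?_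
          · exact ((((hscv.space t ht).mono hb2).abs)).integrableOn_compact (isCompact_closedBall _ _)
          · have h0 := hw0 y (hb (hb2 hy)) t (hJ ht)
            rw [hv, abs_neg, abs_mul, abs_of_pos (exp_pos _), abs_of_nonneg h0]
            exact mul_le_mul_of_nonneg_right (hexp t (hJ ht)) h0
      _ ≤ exp (k / 4) * f t := by
          rw [integral_const_mul]
          exact mul_le_mul_of_nonneg_left (hfm t (hJ ht)) (exp_pos _).le
  · intro ε hε
    have hT := isTest_ker (N := N) (l := 0) (t₁ := t₁) (t₂ := 0) 0 hε.1 (by norm_num : (0 : ℝ) ≤ 1 / 2)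
      (profile_flat (by norm_num : (0 : ℝ) < 1 / 2))
    have htt : t₁ ∈ Icc t₁ 0 := ⟨le_rfl, h10⟩
    have e : ∫ y, v y t₁ * kerTest 0 0 ε 0 (flatProf (1 / 2)) y t₁ =
        ∫ y in closedBall (0 : 𝔼) (1 / 2), v y t₁ * kerTest 0 0 ε 0 (flatProf (1 / 2)) y t₁ := by
      refine (setIntegral_eq_integral_of_forall_compl_eq_zero fun y hy => ?_).symm
      rw [hT.supp y hy t₁ htt, mul_zero]
    rw [e]
    have hint := ((hscv.mono hb2 subset_rfl).integrable_mul hT.cont hT.supp htt).integrableOn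
      (s := closedBall (0 : 𝔼) (1 / 2))
    calc -(c₁ * (exp (k / 4) * f t₁))
        ≤ -(c₁ * (exp (k / 4) * ∫ y in closedBall (0 : 𝔼) (1 / 2), ∑ i, u i y t₁)) := by
          rw [neg_le_neg_iff]
          have := hfm t₁ ht₁'
          gcongr
      _ = ∫ y in closedBall (0 : 𝔼) (1 / 2), -(c₁ * (exp (k / 4) * ∑ i, u i y t₁)) := by
          rw [integral_neg, integral_const_mul, integral_const_mul]
      _ ≤ _ := by
          refine setIntegral_mono_on ?_ hint measurableSet_closedBall fun y hy => ?_
          · exact (((hwi t₁ ht₁').const_mul _).const_mul _).neg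
          · have h0 := hw0 y (hb (hb2 hy)) t₁ ht₁'
            have a := kerTest_upper (x := (0 : 𝔼)) (y := y) hε ht₁.2 (R := 1 / 2)
            have b := hT.nonneg y t₁ htt
            have c := mul_le_mul_of_nonneg_right (hexp t₁ ht₁') h0
            have d : exp (-k * t₁) * ∑ i, u i y t₁ * 1 = exp (-k * t₁) * ∑ i, u i y t₁ := by simp
            have g : 0 ≤ exp (-k * t₁) * ∑ i, u i y t₁ := mul_nonneg (exp_pos _).le h0
            have := mul_le_mul c a b (g.trans c)
            rw [hv, neg_mul, neg_le_neg_iff]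
            linarith

end MeanValue

section DominatedSolutions
variable {N m : ℕ}
local notation "𝔼" => EuclideanSpace ℝ (Fin N)

lemma exists_linear_bound {β : Fin m → Fin m → ℝ} (hβ : ∀ i j, 0 ≤ β i j) {r : ℝ} (hr : 0 < r) {W : ℝ}
    (hW : 0 ≤ W) : ∃ k, 0 ≤ k ∧ ∀ u : Fin m → ℝ, (∀ j, 0 < u j) → ∑ i, u i ≤ W →
      ∑ i, sysF β r u i ≤ k * ∑ i, u i := by
  refine ⟨∑ i, ∑ j, β i j * W ^ (2 * r), Finset.sum_nonneg fun i _ =>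
    Finset.sum_nonneg fun j _ => mul_nonneg (hβ i j) (by positivity), fun u hu hs => ?_⟩
  have hle : ∀ i, u i ≤ ∑ i, u i := fun i =>
    Finset.single_le_sum (f := u) (fun j _ => (hu j).le) (Finset.mem_univ i)
  rw [Finset.sum_mul]
  refine Finset.sum_le_sum fun i _ => ?_
  rw [sysF, Finset.sum_mul]
  refine Finset.sum_le_sum fun j _ => ?_
  have hui := hu i
  have huj := hu j
  have h1 : u i ^ r ≤ W ^ r := rpow_le_rpow hui.le ((hle i).trans hs) hr.le
  have h2 : u j ^ (r + 1) ≤ W ^ r * ∑ i, u i := by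
    rw [rpow_add huj, rpow_one]
    have : u j ^ r ≤ W ^ r := rpow_le_rpow huj.le ((hle j).trans hs) hr.le
    have := hle j
    gcongr
  have h3 : W ^ (2 * r) = W ^ r * W ^ r := by
    rw [two_mul, rpow_add_of_nonneg hW hr.le hr.le]
  rw [h3]
  have := hβ i j
  calc β i j * u i ^ r * u j ^ (r + 1) ≤ β i j * W ^ r * (W ^ r * ∑ i, u i) := by gcongr
    _ = _ := by ring

lemma exists_sum_le_sq {β : Fin m → Fin m → ℝ} (hβ : ∀ i j, 0 ≤ β i j) (hdiag : ∀ i, 0 < β i i) {r : ℝ}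
    (hr : 0 < r) {ε : ℝ} (hε : 0 < ε) : ∃ D, 0 ≤ D ∧ ∀ u : Fin m → ℝ, (∀ j, 0 < u j) →
      ∑ i, u i ≤ m * ε + D * ∑ i, sysF β r u i ^ 2 := by
  refine ⟨∑ i, 1 / (β i i ^ 2 * ε ^ (4 * r + 1)), ?_, fun u hu => ?_⟩
  · exact Finset.sum_nonneg fun i _ => by have := hdiag i; positivity
  have key : ∀ i, u i ≤ ε + 1 / (β i i ^ 2 * ε ^ (4 * r + 1)) * sysF β r u i ^ 2 := by
    intro i
    have hb := hdiag i
    have hui := hu i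
    rcases le_or_gt (u i) ε with h | h
    · have : 0 ≤ 1 / (β i i ^ 2 * ε ^ (4 * r + 1)) * sysF β r u i ^ 2 := by positivity
      linarith
    have h1 := le_sysF (r := r) hβ hu i le_rfl
    have h2 : (β i i * u i ^ (2 * r + 1)) ^ 2 ≤ sysF β r u i ^ 2 := by gcongr
    have h3 : (β i i * u i ^ (2 * r + 1)) ^ 2 = β i i ^ 2 * u i ^ (4 * r + 1) * u i := by
      rw [mul_pow, ← rpow_natCast (u i ^ (2 * r + 1)) 2, ← rpow_mul hui.le, mul_assoc]
      congr 1
      rw [show (2 * r + 1) * ((2 : ℕ) : ℝ) = (4 * r + 1) + 1 by push_cast; ring, rpow_add hui, rpow_one]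
    have h4 : ε ^ (4 * r + 1) ≤ u i ^ (4 * r + 1) := rpow_le_rpow hε.le h.le (by positivity)
    have h5 : u i ≤ 1 / (β i i ^ 2 * ε ^ (4 * r + 1)) * sysF β r u i ^ 2 := by
      rw [one_div, inv_mul_eq_div, le_div_iff₀ (by positivity), mul_comm]
      refine le_trans ?_ (h3 ▸ h2)
      gcongr
    linarith
  calc ∑ i, u i ≤ ∑ i, (ε + 1 / (β i i ^ 2 * ε ^ (4 * r + 1)) * sysF β r u i ^ 2) :=
        Finset.sum_le_sum fun i _ => key i
    _ = m * ε + ∑ i, 1 / (β i i ^ 2 * ε ^ (4 * r + 1)) * sysF β r u i ^ 2 := by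
        rw [Finset.sum_add_distrib]; simp
    _ ≤ _ := by
        rw [Finset.mul_sum]
        gcongr with i
        exact Finset.single_le_sum (f := fun i => 1 / (β i i ^ 2 * ε ^ (4 * r + 1)))
          (fun i _ => by have := hdiag i; positivity) (Finset.mem_univ i)

lemma SepCont.integrableOn {f : 𝔼 → ℝ → ℝ} {x₀ : 𝔼} {ρ : ℝ} {J : Set ℝ} (hf : SepCont f x₀ ρ J)
    {A : Set 𝔼} (hA : A ⊆ closedBall x₀ ρ) {t : ℝ} (ht : t ∈ J) : IntegrableOn (fun y => f y t) A :=
  ((hf.space t ht).integrableOn_compact (isCompact_closedBall _ _)).mono_set hA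

lemma SepCont.continuousOn_setIntegral {f : 𝔼 → ℝ → ℝ} {x₀ : 𝔼} {ρ : ℝ} {J : Set ℝ} (hf : SepCont f x₀ ρ J)
    {A : Set 𝔼} (hA : A ⊆ closedBall x₀ ρ) (hAm : MeasurableSet A) :
    ContinuousOn (fun t => ∫ y in A, f y t) J := by
  obtain ⟨K, hK⟩ := hf.bdd
  refine continuousOn_of_dominated (bound := fun _ => K) (fun t ht => (hf.integrableOn hA ht).1) (fun t ht => ?_) ?_ ?_
  · filter_upwards [ae_restrict_mem hAm] with y hy using hK y (hA hy) t ht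
  · have : volume A ≠ ⊤ := ((measure_mono hA).trans_lt (isCompact_closedBall _ _).measure_lt_top).ne
    exact integrableOn_const this
  · filter_upwards [ae_restrict_mem hAm] with y hy using hf.time y (hA hy)

lemma Sol.sum_pos {β : Fin m → Fin m → ℝ} {r : ℝ} {u : Fin m → 𝔼 → ℝ → ℝ} {x₀ : 𝔼} {ρ : ℝ} {I : Set ℝ}
    (h : Sol β r u x₀ ρ I) (hm : 0 < m) {x : 𝔼} (hx : x ∈ ball x₀ ρ) {t : ℝ} (ht : t ∈ I) :
    0 < ∑ i, u i x t := by
  have : Nonempty (Fin m) := ⟨⟨0, hm⟩⟩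
  exact Finset.sum_pos (fun i _ => h.pos i x hx t ht) Finset.univ_nonempty

lemma scaling_exponent_pos (hN : 1 ≤ N) {r : ℝ} (hr : 0 < r)
    (hpB : N = 1 ∨ (2 ≤ N ∧ 2 * r + 1 < ((N : ℝ) * (N + 2)) / ((N : ℝ) - 1) ^ 2)) :
    0 < 2 * (1 / r) + 2 - N := by
  rcases hpB with rfl | ⟨h2, h⟩
  · have : 0 < 1 / r := by positivity
    push_cast; linarith
  have hN2 : (2 : ℝ) ≤ N := by exact_mod_cast h2
  have h1 : (0 : ℝ) < ((N : ℝ) - 1) ^ 2 := by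
    have : (0 : ℝ) < (N : ℝ) - 1 := by linarith
    positivity
  rw [lt_div_iff₀ h1] at h
  have key : r * ((N : ℝ) - 2) < 2 := by
    by_contra hc
    push Not at hc
    have : 4 * ((N : ℝ) - 1) ^ 2 ≤ 2 * r * ((N : ℝ) - 1) ^ 2 * ((N : ℝ) - 2) := by nlinarith
    have h3 : 2 * r * ((N : ℝ) - 1) ^ 2 < 4 * N - 1 := by nlinarith
    nlinarith
  have : ((N : ℝ) - 2) < 2 * (1 / r) := by
    rw [mul_one_div, lt_div_iff₀ hr]; linarith
  linarith

end DominatedSolutions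

section DominatedBound
open scoped Pointwise
variable {N m : ℕ}
local notation "𝔼" => EuclideanSpace ℝ (Fin N)

set_option maxHeartbeats 1000000 in
/-- Solutions which are almost maximal at the center are bounded there. -/
theorem center_bound_of_dominated (hN : 1 ≤ N) (hm : 0 < m) {r : ℝ} (hr : 0 < r)
    {β : Fin m → Fin m → ℝ} (hsym : ∀ i j, β i j = β j i) (hβ : ∀ i j, 0 ≤ β i j)
    (hdiag : ∀ i, 0 < β i i)
    (hpB : N = 1 ∨ (2 ≤ N ∧ 2 * r + 1 < ((N : ℝ) * (N + 2)) / ((N : ℝ) - 1) ^ 2)) {Λ : ℝ} (hΛ : 0 ≤ Λ) :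
    ∃ C : ℝ, ∀ u : Fin m → 𝔼 → ℝ → ℝ, Sol β r u 0 1 (Ioo (-1) 1) →
      (∀ x ∈ ball (0 : 𝔼) 1, ∀ t ∈ Ioo (-1 : ℝ) 1, ∑ i, u i x t ≤ Λ * ∑ i, u i 0 0) →
      ∑ i, u i 0 0 ≤ C := by
  obtain ⟨C0, hC00, hC0⟩ := local_bound_of_bounded (N := N) hN hm hr hsym hβ hdiag hpB
  obtain ⟨k, hk0, hk⟩ := exists_linear_bound hβ hr hΛ
  obtain ⟨C, hC00', hC⟩ := mean_value_upper hN β r hk0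
  set V : ℝ := volume.real (closedBall (0 : 𝔼) (1 / 2)) with hV
  have hV0 : 0 ≤ V := measureReal_nonneg
  set ε : ℝ := 1 / (C * m * V + 1) with hε
  have hε0 : 0 < ε := by positivity
  have hεC : C * (m * ε * V) ≤ 1 := by
    rw [hε, show C * (m * (1 / (C * m * V + 1)) * V) = (C * m * V) / (C * m * V + 1) by ring,
      div_le_one (by positivity)]
    linarith
  obtain ⟨D, hD0, hD⟩ := exists_sum_le_sq hβ hdiag hr hε0
  set γ : ℝ := 2 * (1 / r) + 2 - N with hγ
  have hγ0 : 0 < γ := scaling_exponent_pos hN hr hpB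
  set E : ℝ := C * D * C0 with hE
  have hE0 : 0 ≤ E := by positivity
  refine ⟨max ((1 / 2) ^ (-(1 / r))) (((1 / (2 * (E + 1))) ^ (1 / γ)) ^ (-(1 / r))), fun u h hu => ?_⟩
  set M : ℝ := ∑ i, u i 0 0 with hM
  have hM0 : 0 < M := h.sum_pos hm (mem_ball_self one_pos) (by norm_num)
  set l : ℝ := M ^ (-r) with hl
  have hl0 : 0 < l := rpow_pos_of_pos hM0 _
  have hlM : l ^ (-(1 / r)) = M := by
    rw [hl, ← rpow_mul hM0.le, show -r * -(1 / r) = 1 by field_simp, rpow_one]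
  have hlr : l ^ (1 / r) = M⁻¹ := by
    rw [← hlM, rpow_neg hl0.le, inv_inv]
  have hanti : -(1 / r) ≤ 0 := by rw [neg_nonpos]; positivity
  suffices hh : l < 1 / 2 → (1 / (2 * (E + 1))) ^ (1 / γ) ≤ l by
    rcases lt_or_ge l (1 / 2) with h1 | h1
    · refine le_trans ?_ (le_max_right _ _)
      rw [← hlM]
      exact rpow_le_rpow_of_nonpos (by positivity) (hh h1) hanti
    · refine le_trans ?_ (le_max_left _ _)
      rw [← hlM]
      exact rpow_le_rpow_of_nonpos (by norm_num) h1 hanti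
  intro hl2
  suffices hh : 1 / (2 * (E + 1)) ≤ l ^ γ by
    calc (1 / (2 * (E + 1))) ^ (1 / γ) ≤ (l ^ γ) ^ (1 / γ) := by gcongr
      _ = l := by rw [← rpow_mul hl0.le, mul_one_div_cancel hγ0.ne', rpow_one]
  -- bounds on the original solution
  have hui : ∀ i, ∀ x ∈ ball (0 : 𝔼) 1, ∀ t ∈ Ioo (-1 : ℝ) 1, u i x t ≤ Λ * M := fun i x hx t ht =>
    (Finset.single_le_sum (f := fun i => u i x t) (fun j _ => (h.pos j x hx t ht).le)
      (Finset.mem_univ i)).trans (hu x hx t ht)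
  have hb78 : closedBall (0 : 𝔼) (7 / 8) ⊆ ball 0 1 := closedBall_subset_ball (by norm_num)
  have hI78 : Icc (-(7 / 8) : ℝ) (7 / 8) ⊆ Ioo (-1) 1 := Icc_subset_Ioo (by norm_num) (by norm_num)
  have hA := hC0 u (Λ * M) h fun i x hx t ht => hui i x (hb78 hx) t (hI78 ht)
  set Φ : 𝔼 → ℝ → ℝ := fun x t => ∑ i, sysF β r (fun j => u j x t) i ^ 2 with hΦ
  have hΦ0 : ∀ x t, 0 ≤ Φ x t := fun x t => Finset.sum_nonneg fun i _ => sq_nonneg _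
  have hΦsc : SepCont Φ 0 (7 / 8) (Icc (-(7 / 8)) (7 / 8)) := by
    refine SepCont.sum fun i _ => ?_
    have hs := h.sepCont_sysF (ρ₁ := 7 / 8) hr (by norm_num) hI78 (fun i x hx t ht => hui i x (hb78 hx) t (hI78 ht)) i
    obtain ⟨L, hL⟩ := hs.bdd
    refine ⟨⟨L ^ 2, fun y hy t ht => ?_⟩, fun t ht => (hs.space t ht).pow 2, fun y hy => (hs.time y hy).pow 2⟩
    have := hL y hy t ht
    rw [abs_pow]; gcongr
  have hb12 : ball (0 : 𝔼) (1 / 2) ⊆ closedBall 0 (7 / 8) :=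
    ball_subset_closedBall.trans (closedBall_subset_closedBall (by norm_num))
  set J : ℝ → ℝ := fun t => ∫ x in ball (0 : 𝔼) (1 / 2), Φ x t with hJ
  have hJc : ContinuousOn J (Icc (-(7 / 8)) (7 / 8)) := hΦsc.continuousOn_setIntegral hb12 measurableSet_ball
  have hJ0 : ∀ t, 0 ≤ J t := fun t => integral_nonneg fun x => hΦ0 x t
  -- the rescaled solution
  have hmul : ∀ y : 𝔼, ‖(0 : 𝔼) + l • y‖ = l * ‖y‖ := fun y => by
    rw [zero_add, norm_smul, Real.norm_eq_abs, abs_of_pos hl0]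
  have hbl : ∀ y ∈ ball (0 : 𝔼) 1, (0 : 𝔼) + l • y ∈ ball (0 : 𝔼) 1 := fun y hy => by
    rw [mem_ball_zero_iff] at hy ⊢
    rw [hmul]; nlinarith [norm_nonneg y]
  have hll : l ^ 2 ≤ 1 / 4 := by nlinarith
  have hll0 : 0 < l ^ 2 := by positivity
  have hIl : ∀ s ∈ Icc (-(1 / 4) : ℝ) 0, 0 + l ^ 2 * s ∈ Ioo (-1 : ℝ) 1 := fun s hs =>
    ⟨by nlinarith [hs.1, hs.2], by nlinarith [hs.1, hs.2]⟩
  set û := rescale r l 0 0 u with hû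
  have hS : Sol β r û 0 1 (Icc (-(1 / 4)) 0) := h.rescale hr hl0 hbl hIl
  have hûs : ∀ y s, ∑ i, û i y s = M⁻¹ * ∑ i, u i (0 + l • y) (0 + l ^ 2 * s) := fun y s => by
    rw [Finset.mul_sum, ← hlr]; rfl
  have hûΛ : ∀ y ∈ ball (0 : 𝔼) 1, ∀ s ∈ Icc (-(1 / 4) : ℝ) 0, ∑ i, û i y s ≤ Λ := fun y hy s hs => by
    rw [hûs, inv_mul_le_iff₀ hM0, mul_comm M]
    exact hu _ (hbl y hy) _ (hIl s hs)
  have hûi : ∀ i, ∀ y ∈ ball (0 : 𝔼) 1, ∀ s ∈ Icc (-(1 / 4) : ℝ) 0, û i y s ≤ Λ := fun i y hy s hs =>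
    (Finset.single_le_sum (f := fun i => û i y s) (fun j _ => (hS.pos j y hy s hs).le)
      (Finset.mem_univ i)).trans (hûΛ y hy s hs)
  have hûF : ∀ i, ∀ y ∈ ball (0 : 𝔼) 1, ∀ s ∈ Icc (-(1 / 4) : ℝ) 0, sysF β r (fun j => û j y s) i =
      l ^ 2 * l ^ (1 / r) * sysF β r (fun j => u j (0 + l • y) (0 + l ^ 2 * s)) i := fun i y hy s hs => by
    rw [← rescale_rpow hr hl0, ← sysF_const_mul β r (rpow_pos_of_pos hl0 _)
      (fun j => (h.pos j _ (hbl y hy) _ (hIl s hs)).le)]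
    rfl
  have hb34 : closedBall (0 : 𝔼) (3 / 4) ⊆ ball 0 1 := closedBall_subset_ball (by norm_num)
  have hb121 : closedBall (0 : 𝔼) (1 / 2) ⊆ ball 0 1 := closedBall_subset_ball (by norm_num)
  set q : ℝ := (l ^ 2 * l ^ (1 / r)) ^ 2 with hq
  have hq0 : 0 < q := by positivity
  set f : ℝ → ℝ := fun s => m * ε * V + D * (q * ((l ^ N)⁻¹ * J (l ^ 2 * s))) with hf
  have hmaps : ∀ s ∈ Icc (-(1 / 4) : ℝ) 0, l ^ 2 * s ∈ Icc (-(7 / 8) : ℝ) (7 / 8) := fun s hs =>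
    ⟨by nlinarith [hs.1, hs.2], by nlinarith [hs.1, hs.2]⟩
  have hJl : ContinuousOn (fun s => J (l ^ 2 * s)) (Icc (-(1 / 4)) 0) :=
    hJc.comp (by fun_prop) hmaps
  have hfc : ContinuousOn f (Icc (-(1 / 4)) 0) :=
    continuousOn_const.add (continuousOn_const.mul (continuousOn_const.mul (continuousOn_const.mul hJl)))
  have hsub : l • closedBall (0 : 𝔼) (1 / 2) ⊆ ball 0 (1 / 2) := by
    rw [smul_closedBall l _ (by norm_num), smul_zero]
    refine closedBall_subset_ball ?_
    rw [Real.norm_eq_abs, abs_of_pos hl0]; linarith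
  have hfle : ∀ s ∈ Icc (-(1 / 4) : ℝ) 0, ∫ y in closedBall (0 : 𝔼) (1 / 2), ∑ i, û i y s ≤ f s := by
    intro s hs
    have hcΦ : ContinuousOn (fun y : 𝔼 => Φ (l • y) (l ^ 2 * s)) (closedBall 0 (1 / 2)) := by
      refine (hΦsc.space _ (hmaps s hs)).comp (f := fun y : 𝔼 => l • y) (by fun_prop) fun y hy => ?_
      exact hb12 (hsub (smul_mem_smul_set hy))
    have hi1 : IntegrableOn (fun y : 𝔼 => Φ (l • y) (l ^ 2 * s)) (closedBall 0 (1 / 2)) :=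
      hcΦ.integrableOn_compact (isCompact_closedBall _ _)
    have hi2 : IntegrableOn (fun y : 𝔼 => ∑ i, û i y s) (closedBall 0 (1 / 2)) :=
      ContinuousOn.integrableOn_compact (isCompact_closedBall _ _)
        (continuousOn_finsetSum _ fun i _ => (hS.space i s hs).continuousOn.mono hb121)
    have hi3 : IntegrableOn (fun _ : 𝔼 => m * ε) (closedBall (0 : 𝔼) (1 / 2)) :=
      integrableOn_const (isCompact_closedBall _ _).measure_lt_top.ne
    calc ∫ y in closedBall (0 : 𝔼) (1 / 2), ∑ i, û i y s
        ≤ ∫ y in closedBall (0 : 𝔼) (1 / 2), (m * ε + D * (q * Φ (l • y) (l ^ 2 * s))) := by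
          refine setIntegral_mono_on hi2 (hi3.fun_add ((hi1.const_mul _).const_mul _))
            measurableSet_closedBall fun y hy => ?_
          have hy1 := hb121 hy
          refine (hD _ fun j => hS.pos j y hy1 s hs).trans_eq ?_
          congr 2
          rw [hΦ, Finset.mul_sum]
          refine Finset.sum_congr rfl fun i _ => ?_
          rw [hûF i y hy1 s hs, mul_pow, zero_add, zero_add]
      _ = m * ε * V + D * (q * ((l ^ N)⁻¹ * ∫ x in l • closedBall (0 : 𝔼) (1 / 2), Φ x (l ^ 2 * s))) := by
          have e1 := Measure.setIntegral_comp_smul_of_pos volume (fun x => Φ x (l ^ 2 * s))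
            (closedBall (0 : 𝔼) (1 / 2)) hl0
          rw [finrank_euclideanSpace_fin, smul_eq_mul] at e1
          rw [integral_add hi3 ((hi1.const_mul _).const_mul _), integral_const_mul D, integral_const_mul q,
            setIntegral_const, e1, smul_eq_mul]
          ring
      _ ≤ f s := by
          have : ∫ x in l • closedBall (0 : 𝔼) (1 / 2), Φ x (l ^ 2 * s) ≤ J (l ^ 2 * s) :=
            setIntegral_mono_set (hΦsc.integrableOn hb12 (hmaps s hs))
              (Filter.Eventually.of_forall fun x => hΦ0 x _) hsub.eventuallyLE
          simp only [hf]
          gcongr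
  have key := hC û Λ f (hS.mono (ball_subset_ball (by norm_num)) subset_rfl)
    (fun i x hx t ht => hûi i x (hb34 hx) t ht) (fun x hx t ht => ?_) hfc hfle
  swap
  · have hx1 : x ∈ ball (0 : 𝔼) 1 := ball_subset_ball (by norm_num) hx
    exact hk _ (fun j => hS.pos j x hx1 t ht) (hûΛ x hx1 t ht)
  have h1 : ∑ i, û i 0 0 = 1 := by
    rw [hûs, smul_zero, mul_zero, add_zero, add_zero, inv_mul_cancel₀ hM0.ne']
  have hJi : ∫ s in -(1 / 4)..0, J (l ^ 2 * s) ≤ (l ^ 2)⁻¹ * C0 := by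
    rw [intervalIntegral.integral_comp_mul_left (fun s => J s) hll0.ne', smul_eq_mul, mul_zero]
    gcongr
    rw [intervalIntegral.integral_of_le (by nlinarith)]
    refine le_trans ?_ hA
    have hsub2 : Ioo (-(1 : ℝ) / 2) (1 / 2) ⊆ Icc (-(7 / 8)) (7 / 8) := fun s hs =>
      ⟨by linarith [hs.1], by linarith [hs.2]⟩
    refine setIntegral_mono_set (f := J) ((hJc.integrableOn_compact isCompact_Icc).mono_set hsub2)
      (Filter.Eventually.of_forall hJ0) (LE.le.eventuallyLE ?_)
    intro s hs
    exact ⟨by nlinarith [hs.1], by linarith [hs.2]⟩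
  have hfi : ∫ s in -(1 / 4)..0, f s ≤ m * ε * V * (1 / 4) + D * (q * ((l ^ N)⁻¹ * ((l ^ 2)⁻¹ * C0))) := by
    have hii : IntervalIntegrable (fun s => J (l ^ 2 * s)) volume (-(1 / 4)) 0 :=
      ContinuousOn.intervalIntegrable (by rwa [uIcc_of_le (by norm_num)])
    have e2 : ∫ s in -(1 / 4)..0, D * (q * ((l ^ N)⁻¹ * J (l ^ 2 * s))) =
        D * (q * ((l ^ N)⁻¹ * ∫ s in -(1 / 4)..0, J (l ^ 2 * s))) := by
      simp only [intervalIntegral.integral_const_mul]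
    have e3 : ∫ _s in (-(1 / 4) : ℝ)..0, m * ε * V = m * ε * V * (1 / 4) := by
      rw [intervalIntegral.integral_const, smul_eq_mul]; ring
    rw [hf, intervalIntegral.integral_add (by simp) (((hii.const_mul _).const_mul _).const_mul _), e2, e3]
    gcongr
  have hqγ : q * ((l ^ N)⁻¹ * (l ^ 2)⁻¹) = l ^ γ := by
    rw [hq, ← rpow_natCast l N, ← rpow_natCast l 2, ← rpow_add hl0, ← rpow_natCast _ 2, ← rpow_mul hl0.le,
      ← rpow_neg hl0.le, ← rpow_neg hl0.le, ← rpow_add hl0, ← rpow_add hl0]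
    congr 1
    rw [hγ]; push_cast; ring
  rw [h1] at key
  have h2 : C * ∫ s in -(1 / 4)..0, f s ≤ 1 / 4 + E * l ^ γ := by
    calc C * ∫ s in -(1 / 4)..0, f s
        ≤ C * (m * ε * V * (1 / 4) + D * (q * ((l ^ N)⁻¹ * ((l ^ 2)⁻¹ * C0)))) := by gcongr
      _ = C * (m * ε * V) * (1 / 4) + E * (q * ((l ^ N)⁻¹ * (l ^ 2)⁻¹)) := by rw [hE]; ring
      _ ≤ 1 / 4 + E * l ^ γ := by rw [hqγ]; linarith
  rw [div_le_iff₀ (by positivity)]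
  have : 0 < l ^ γ := rpow_pos_of_pos hl0 _
  nlinarith

end DominatedBound

section Doubling
variable {N m : ℕ}
local notation "𝔼" => EuclideanSpace ℝ (Fin N)

lemma sum_rescale (r l : ℝ) (x₁ : 𝔼) (t₁ : ℝ) (u : Fin m → 𝔼 → ℝ → ℝ) (y : 𝔼) (s : ℝ) :
    ∑ i, rescale r l x₁ t₁ u i y s = l ^ (1 / r) * ∑ i, u i (x₁ + l • y) (t₁ + l ^ 2 * s) := by
  simp only [rescale, Finset.mul_sum]

lemma norm_add_smul_lt {x y : EuclideanSpace ℝ (Fin N)} {l : ℝ} (hl : 0 < l) (hy : ‖y‖ < 1) :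
    ‖x + l • y‖ < ‖x‖ + l := by
  refine (norm_add_le _ _).trans_lt ?_
  rw [norm_smul, norm_of_nonneg hl.le]
  nlinarith

/-- Bounded solutions satisfy a universal interior bound, by a doubling argument. -/
theorem interior_bound_of_bounded (hN : 1 ≤ N) (hm : 0 < m) {r : ℝ} (hr : 0 < r)
    {β : Fin m → Fin m → ℝ} (hsym : ∀ i j, β i j = β j i) (hβ : ∀ i j, 0 ≤ β i j)
    (hdiag : ∀ i, 0 < β i i)
    (hpB : N = 1 ∨ (2 ≤ N ∧ 2 * r + 1 < ((N : ℝ) * (N + 2)) / ((N : ℝ) - 1) ^ 2)) :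
    ∃ C : ℝ, 0 ≤ C ∧ ∀ (u : Fin m → 𝔼 → ℝ → ℝ) (K : ℝ), Sol β r u 0 1 (Ioo (-1) 1) →
      (∀ x ∈ ball (0 : 𝔼) 1, ∀ t ∈ Ioo (-1 : ℝ) 1, ∑ i, u i x t ≤ K) →
      ∀ x : 𝔼, ‖x‖ ≤ 1 / 2 → ∀ t : ℝ, |t| ≤ 1 / 4 → ∑ i, u i x t ≤ C := by
  obtain ⟨C, hC⟩ := center_bound_of_dominated (N := N) hN hm hr hsym hβ hdiag hpB
    (by positivity : (0 : ℝ) ≤ 2 * 2 ^ (1 / r))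
  refine ⟨2 ^ (1 / r) * (2 * 2 ^ (1 / r) * max C 0), by positivity, fun u K h hK x hx t ht => ?_⟩
  have ha : 0 < 1 / r := by positivity
  set a := 1 / r with ha'
  set d : 𝔼 × ℝ → ℝ := fun P => min (1 - ‖P.1‖) (√(1 - |P.2|)) with hd
  set M : 𝔼 × ℝ → ℝ := fun P => d P ^ a * ∑ i, u i P.1 P.2 with hM
  set Q : Set (𝔼 × ℝ) := ball 0 1 ×ˢ Ioo (-1) 1 with hQ
  have hdpos : ∀ P ∈ Q, 0 < d P := by
    rintro ⟨x, t⟩ ⟨h1, h2⟩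
    simp only [mem_ball_zero_iff] at h1
    have := abs_lt.2 h2
    exact lt_min (by simpa using h1) (sqrt_pos.2 (by simpa using this))
  have hdle : ∀ P, d P ≤ 1 := fun P =>
    (min_le_left _ _).trans (by have := norm_nonneg P.1; linarith)
  have hw : ∀ P ∈ Q, 0 < ∑ i, u i P.1 P.2 := fun P hP => h.sum_pos hm hP.1 hP.2
  have hMK : ∀ P ∈ Q, M P ≤ K := fun P hP => by
    have h1 : d P ^ a ≤ 1 := rpow_le_one (hdpos P hP).le (hdle P) ha.le
    have h2 := hK P.1 hP.1 P.2 hP.2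
    have h3 := hw P hP
    calc M P ≤ 1 * ∑ i, u i P.1 P.2 := by simp only [hM]; gcongr
      _ ≤ K := by linarith
  have hbdd : BddAbove (M '' Q) := ⟨K, by rintro _ ⟨P, hP, rfl⟩; exact hMK P hP⟩
  have h0 : ((0 : 𝔼), (0 : ℝ)) ∈ Q := ⟨by simp, by simp⟩
  have hle : ∀ P ∈ Q, M P ≤ sSup (M '' Q) := fun P hP => le_csSup hbdd ⟨P, hP, rfl⟩
  have hS0 : 0 < sSup (M '' Q) :=
    (mul_pos (rpow_pos_of_pos (hdpos _ h0) _) (hw _ h0)).trans_le (hle _ h0)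
  set S := sSup (M '' Q) with hS
  obtain ⟨_, ⟨⟨x₁, t₁⟩, hP, rfl⟩, hPS⟩ :=
    exists_lt_of_lt_csSup (⟨_, ⟨_, h0, rfl⟩⟩ : (M '' Q).Nonempty) (half_lt_self hS0)
  set l := d (x₁, t₁) / 2 with hl
  have hl0 : 0 < l := half_pos (hdpos _ hP)
  have hl1 : 2 * l ≤ 1 - ‖x₁‖ := by
    have : d (x₁, t₁) ≤ 1 - ‖x₁‖ := min_le_left _ _
    linarith
  have hl2 : (2 * l) ^ 2 ≤ 1 - |t₁| := by
    have h1 : d (x₁, t₁) ≤ √(1 - |t₁|) := min_le_right _ _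
    have h2 : 2 * l ≤ √(1 - |t₁|) := by linarith
    have h3 : |t₁| < 1 := abs_lt.2 hP.2
    exact (le_sqrt (by linarith) (by linarith)).1 h2
  have hX : ∀ y ∈ ball (0 : 𝔼) 1, ‖x₁ + l • y‖ ≤ 1 - l := fun y hy => by
    have := norm_add_smul_lt (x := x₁) hl0 (mem_ball_zero_iff.1 hy)
    linarith
  have hT : ∀ s ∈ Ioo (-1 : ℝ) 1, |t₁ + l ^ 2 * s| ≤ 1 - l ^ 2 := fun s hs => by
    have h1 : |s| < 1 := abs_lt.2 hs
    have h2 := abs_add_le t₁ (l ^ 2 * s)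
    rw [abs_mul, abs_of_nonneg (sq_nonneg l)] at h2
    nlinarith [sq_nonneg l]
  have hXb : ∀ y ∈ ball (0 : 𝔼) 1, x₁ + l • y ∈ ball (0 : 𝔼) 1 := fun y hy =>
    mem_ball_zero_iff.2 (by linarith [hX y hy])
  have hTb : ∀ s ∈ Ioo (-1 : ℝ) 1, t₁ + l ^ 2 * s ∈ Ioo (-1 : ℝ) 1 := fun s hs =>
    abs_lt.1 (by have := hT s hs; have : 0 < l ^ 2 := by positivity
                 linarith)
  have hla : d (x₁, t₁) ^ a = 2 ^ a * l ^ a := by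
    rw [← mul_rpow (by norm_num) hl0.le]; congr 1; rw [hl]; ring
  have hlp : 0 < l ^ a := rpow_pos_of_pos hl0 _
  have key := hC (rescale r l x₁ t₁ u) (h.rescale hr hl0 hXb hTb) (fun y hy s hs => by
    rw [sum_rescale, sum_rescale, ← ha']
    have h1 : l ≤ d (x₁ + l • y, t₁ + l ^ 2 * s) := le_min (by have := hX y hy; linarith)
      (le_sqrt_of_sq_le (by have := hT s hs; linarith))
    have hq : (x₁ + l • y, t₁ + l ^ 2 * s) ∈ Q := ⟨hXb y hy, hTb s hs⟩
    have h2 := hle _ hq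
    have h3 := hw _ hq
    have h4 : l ^ a ≤ d (x₁ + l • y, t₁ + l ^ 2 * s) ^ a := rpow_le_rpow hl0.le h1 ha.le
    simp only [hM, hla] at h2 hPS h3
    simp only [smul_zero, add_zero, mul_zero]
    calc _ ≤ _ := mul_le_mul_of_nonneg_right h4 h3.le
      _ ≤ _ := h2
      _ ≤ _ := by linarith)
  rw [sum_rescale, ← ha'] at key
  simp only [smul_zero, add_zero, mul_zero] at key
  simp only [hM, hla] at hPS
  have h2a : (0 : ℝ) < 2 ^ a := by positivity
  have hSC : S ≤ 2 * 2 ^ a * max C 0 := by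
    have : 2 ^ a * (l ^ a * ∑ i, u i x₁ t₁) ≤ 2 ^ a * max C 0 := by
      gcongr; exact key.trans (le_max_left _ _)
    linarith
  have hxt : (x, t) ∈ Q := ⟨mem_ball_zero_iff.2 (by linarith), abs_lt.1 (by linarith)⟩
  have h5 : (1 / 2 : ℝ) ≤ d (x, t) := le_min (by simp only; linarith)
    (le_sqrt_of_sq_le (by simp only; norm_num; linarith))
  have h6 : (1 / 2 : ℝ) ^ a ≤ d (x, t) ^ a := rpow_le_rpow (by norm_num) h5 ha.le
  have h7 := hle _ hxt
  have h8 := hw _ hxt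
  have h9 : (1 / 2 : ℝ) ^ a * ∑ i, u i x t ≤ S := (mul_le_mul_of_nonneg_right h6 h8.le).trans h7
  rw [div_rpow (by norm_num) (by norm_num), one_rpow, one_div, inv_mul_le_iff₀ h2a] at h9
  exact h9.trans (by gcongr)

end Doubling

section Harnack
open scoped Pointwise
variable {N m : ℕ}
local notation "𝔼" => EuclideanSpace ℝ (Fin N)

/-- A weak Harnack type inequality: local boundedness near the origin is only assumed qualitatively. -/
theorem center_le_of_locally_bounded (hN : 1 ≤ N) (hm : 0 < m) {r : ℝ} (hr : 0 < r)
    {β : Fin m → Fin m → ℝ} (hsym : ∀ i j, β i j = β j i) (hβ : ∀ i j, 0 ≤ β i j)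
    (hdiag : ∀ i, 0 < β i i)
    (hpB : N = 1 ∨ (2 ≤ N ∧ 2 * r + 1 < ((N : ℝ) * (N + 2)) / ((N : ℝ) - 1) ^ 2)) :
    ∃ C : ℝ, 0 ≤ C ∧ ∀ (u : Fin m → 𝔼 → ℝ → ℝ) (K : ℝ), Sol β r u 0 1 (Ioo (-1) 1) →
      (∀ x : 𝔼, ‖x‖ < 1 / 32 → ∀ t : ℝ, |t| < 1 / 1024 → ∑ i, u i x t ≤ K) →
      ∀ x : 𝔼, ‖x‖ ≤ 1 / 8 → ∑ i, u i 0 0 ≤ C * ∑ i, u i x (1 / 2) := by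
  obtain ⟨C1, hC10, hC1⟩ := interior_bound_of_bounded (N := N) hN hm hr hsym hβ hdiag hpB
  obtain ⟨k, hk0, hk⟩ := exists_linear_bound hβ hr hC10
  obtain ⟨C2, hC20, hC2⟩ := mean_value_upper hN β r hk0
  obtain ⟨c, hc0, hc⟩ := lower_harnack hN hβ r
  refine ⟨C2 * 64 ^ N / (4 * c), by positivity, fun u K h hK x hx => ?_⟩
  have ha : 0 < 1 / r := by positivity
  have hnsm : ∀ {l : ℝ} {y : 𝔼}, 0 ≤ l → ‖(0 : 𝔼) + l • y‖ = l * ‖y‖ := fun {l y} hl => by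
    rw [zero_add, norm_smul, norm_of_nonneg hl]
  set v := rescale r (1 / 32) 0 0 u with hv
  have hvS : Sol β r v 0 1 (Ioo (-1) 1) := h.rescale hr (by norm_num)
    (fun y hy => by
      rw [mem_ball_zero_iff] at hy ⊢; rw [hnsm (by norm_num)]; linarith)
    (fun s hs => by constructor <;> linarith [hs.1, hs.2])
  have hvb : ∀ y ∈ ball (0 : 𝔼) 1, ∀ s ∈ Ioo (-1 : ℝ) 1, ∑ i, v i y s ≤ (1 / 32) ^ (1 / r) * K := by
    intro y hy s hs
    rw [hv, sum_rescale]
    rw [mem_ball_zero_iff] at hy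
    gcongr
    refine hK _ (by rw [hnsm (by norm_num)]; linarith) _ ?_
    rw [abs_lt]; constructor <;> linarith [hs.1, hs.2]
  have hv1 := hC1 v _ hvS hvb
  set z := rescale r (1 / 64) 0 0 u with hz
  have hzS : Sol β r z 0 1 (Ioo (-1) 1) := h.rescale hr (by norm_num)
    (fun y hy => by
      rw [mem_ball_zero_iff] at hy ⊢; rw [hnsm (by norm_num)]; linarith)
    (fun s hs => by constructor <;> linarith [hs.1, hs.2])
  have hz1 : ∀ y : 𝔼, ‖y‖ ≤ 1 → ∀ s : ℝ, |s| ≤ 1 → ∑ i, z i y s ≤ C1 := by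
    intro y hy s hs
    have h1 := hv1 ((1 / 2 : ℝ) • y) (by
      rw [norm_smul, norm_of_nonneg (by norm_num)]; linarith) (s / 4) (by
      rw [abs_div, abs_of_pos (by norm_num : (0 : ℝ) < 4)]; linarith)
    rw [hv, sum_rescale, smul_smul] at h1
    rw [hz, sum_rescale]
    have e1 : (1 / 32 : ℝ) * (1 / 2) = 1 / 64 := by norm_num
    have e2 : (0 : ℝ) + (1 / 32) ^ 2 * (s / 4) = 0 + (1 / 64) ^ 2 * s := by ring
    rw [e1, e2] at h1
    refine le_trans ?_ h1
    have h0 : 0 < ∑ i, u i ((0 : 𝔼) + (1 / 64 : ℝ) • y) (0 + (1 / 64) ^ 2 * s) := by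
      refine h.sum_pos hm ?_ ?_
      · rw [mem_ball_zero_iff, hnsm (by norm_num)]; linarith
      · have := abs_le.1 hs
        constructor <;> linarith [this.1, this.2]
    gcongr
    norm_num
  have hpos : ∀ i, ∀ t ∈ Ioo (-1 : ℝ) 1, ∀ y : 𝔼, ‖y‖ ≤ 1 / 8 → 0 < u i y t := fun i t ht y hy =>
    h.pos i y (mem_ball_zero_iff.2 (by linarith)) t ht
  set w := ∑ i, u i x (1 / 2) with hw
  set q : ℝ := (1 / 64) ^ (1 / r) with hq
  have hq0 : 0 < q := by positivity
  have hint : ∀ i, ∀ t ∈ Ioo (-1 : ℝ) 1, IntegrableOn (fun y => u i y t) (closedBall 0 (1 / 8)) :=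
    fun i t ht => ((h.space i t ht).continuousOn.mono
      (closedBall_subset_ball (by norm_num))).integrableOn_compact (isCompact_closedBall _ _)
  have hmass : ∀ t ∈ Icc (-(1 / 4) : ℝ) 0,
      ∫ y in closedBall (0 : 𝔼) (1 / 2), ∑ i, z i y t ≤ q * (64 ^ N * (w / c)) := by
    intro t ht
    have hT : (0 : ℝ) + (1 / 64) ^ 2 * t ∈ Icc (-(1 / 8) : ℝ) 0 := by
      constructor <;> linarith [ht.1, ht.2]
    set T : ℝ := 0 + (1 / 64) ^ 2 * t with hTd
    have hT1 : T ∈ Ioo (-1 : ℝ) 1 := ⟨by linarith [hT.1], by linarith [hT.2]⟩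
    have e1 : ∫ y in closedBall (0 : 𝔼) (1 / 2), ∑ i, z i y t
        = q * ∫ y in closedBall (0 : 𝔼) (1 / 2), ∑ i, u i ((1 / 64 : ℝ) • y) T := by
      rw [← integral_const_mul]
      refine integral_congr_ae (Filter.Eventually.of_forall fun y => ?_)
      simp only [hz]
      rw [sum_rescale, zero_add]
    have e2 : ∫ y in closedBall (0 : 𝔼) (1 / 2), ∑ i, u i ((1 / 64 : ℝ) • y) T
        = 64 ^ N * ∫ y in closedBall (0 : 𝔼) (1 / 128), ∑ i, u i y T := by
      rw [Measure.setIntegral_comp_smul_of_pos volume (fun y => ∑ i, u i y T) _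
        (by norm_num : (0 : ℝ) < 1 / 64), smul_closedBall (1 / 64 : ℝ) _ (by norm_num), finrank_euclideanSpace_fin,
        smul_zero, norm_of_nonneg (by norm_num : (0 : ℝ) ≤ 1 / 64), smul_eq_mul,
        one_div, inv_pow, inv_inv]
      norm_num
    rw [e1, e2]
    gcongr
    calc ∫ y in closedBall (0 : 𝔼) (1 / 128), ∑ i, u i y T
        ≤ ∫ y in closedBall (0 : 𝔼) (1 / 8), ∑ i, u i y T := by
          refine setIntegral_mono_set (integrable_finsetSum _ fun i _ => hint i T hT1) ?_
            (closedBall_subset_closedBall (by norm_num)).eventuallyLE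
          filter_upwards [ae_restrict_mem measurableSet_closedBall] with y hy
          exact Finset.sum_nonneg fun i _ => (hpos i T hT1 y (mem_closedBall_zero_iff.1 hy)).le
      _ = ∑ i, ∫ y in closedBall (0 : 𝔼) (1 / 8), u i y T :=
          integral_finsetSum _ fun i _ => hint i T hT1
      _ ≤ ∑ i, u i x (1 / 2) / c := Finset.sum_le_sum fun i _ => by
          rw [le_div_iff₀' hc0]; exact hc u h i x hx T hT
      _ = w / c := by rw [hw, Finset.sum_div]
  have key := hC2 z C1 (fun _ => q * (64 ^ N * (w / c)))
    (hzS.mono (ball_subset_ball (by norm_num)) (fun t ht => ⟨by linarith [ht.1], by linarith [ht.2]⟩))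
    (fun i y hy t ht => by
      have hy' := mem_closedBall_zero_iff.1 hy
      have ht' : |t| ≤ 1 / 4 := abs_le.2 ⟨ht.1, by linarith [ht.2]⟩
      refine le_trans ?_ (hz1 y (by linarith) t (by linarith))
      exact Finset.single_le_sum (f := fun i => z i y t) (fun j _ => (hzS.pos j y
        (mem_ball_zero_iff.2 (by linarith)) t ⟨by linarith [ht.1], by linarith [ht.2]⟩).le)
        (Finset.mem_univ i))
    (fun y hy t ht => by
      have hy' := mem_ball_zero_iff.1 hy
      have ht' : |t| ≤ 1 / 4 := abs_le.2 ⟨ht.1, by linarith [ht.2]⟩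
      exact hk _ (fun j => hzS.pos j y (mem_ball_zero_iff.2 (by linarith)) t
        ⟨by linarith [ht.1], by linarith [ht.2]⟩) (hz1 y (by linarith) t (by linarith)))
    continuousOn_const hmass
  rw [intervalIntegral.integral_const, smul_eq_mul, hz, sum_rescale, ← hq] at key
  simp only [smul_zero, add_zero, mul_zero] at key
  rw [← mul_le_mul_iff_of_pos_left hq0]
  refine key.trans_eq ?_
  field_simp
  ring

end Harnack

section LocallyBounded
variable {N m : ℕ}
local notation "𝔼" => EuclideanSpace ℝ (Fin N)

/-- A function bounded above near every point of a compact set is bounded above on it. -/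
lemma IsCompact.exists_le_of_eventually_le {X : Type*} [TopologicalSpace X] {Z : Set X} (hZ : IsCompact Z)
    {f : X → ℝ} (h : ∀ q ∈ Z, ∃ M, ∀ᶠ q' in 𝓝 q, f q' ≤ M) : ∃ M, ∀ q ∈ Z, f q ≤ M := by
  refine hZ.induction_on (p := fun s => ∃ M, ∀ q ∈ s, f q ≤ M) ⟨0, by simp⟩
    (fun s t hst ⟨M, hM⟩ => ⟨M, fun q hq => hM q (hst hq)⟩)
    (fun s t ⟨M, hM⟩ ⟨M', hM'⟩ => ⟨max M M', fun q hq => ?_⟩)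
    (fun q hq => ?_)
  · rcases hq with hq | hq
    · exact (hM q hq).trans (le_max_left _ _)
    · exact (hM' q hq).trans (le_max_right _ _)
  · obtain ⟨M, hM⟩ := h q hq
    exact ⟨_, mem_nhdsWithin_of_mem_nhds hM, M, fun _ hz => hz⟩

/-- The set of points near which `f` is bounded above is open. -/
lemma isOpen_setOf_eventually_le {X : Type*} [TopologicalSpace X] (f : X → ℝ) :
    IsOpen {q | ∃ M, ∀ᶠ q' in 𝓝 q, f q' ≤ M} := by
  rw [isOpen_iff_eventually]
  rintro q ⟨M, hM⟩
  filter_upwards [hM.eventually_nhds] with z hz using ⟨M, hz⟩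

/-- `center_le_of_locally_bounded` on an arbitrary parabolic cylinder. -/
theorem le_of_locally_bounded (hN : 1 ≤ N) (hm : 0 < m) {r : ℝ} (hr : 0 < r)
    {β : Fin m → Fin m → ℝ} (hsym : ∀ i j, β i j = β j i) (hβ : ∀ i j, 0 ≤ β i j)
    (hdiag : ∀ i, 0 < β i i)
    (hpB : N = 1 ∨ (2 ≤ N ∧ 2 * r + 1 < ((N : ℝ) * (N + 2)) / ((N : ℝ) - 1) ^ 2)) :
    ∃ C : ℝ, 0 ≤ C ∧ ∀ (u : Fin m → 𝔼 → ℝ → ℝ) (K l : ℝ) (y : 𝔼) (s : ℝ), 0 < l →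
      Sol β r u y l (Ioo (s - l ^ 2) (s + l ^ 2)) →
      (∀ q ∈ closedBall y (l / 32) ×ˢ Icc (s - l ^ 2 / 1024) (s + l ^ 2 / 1024), ∑ i, u i q.1 q.2 ≤ K) →
      ∀ x : 𝔼, dist x y ≤ l / 8 → ∑ i, u i y s ≤ C * ∑ i, u i x (s + l ^ 2 / 2) := by
  obtain ⟨C, hC0, hC⟩ := center_le_of_locally_bounded (N := N) hN hm hr hsym hβ hdiag hpB
  refine ⟨C, hC0, fun u K l y s hl h hK x hx => ?_⟩
  have hla : 0 < l ^ (1 / r) := rpow_pos_of_pos hl _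
  have hl2 : 0 < l ^ 2 := by positivity
  have hd : ∀ z : 𝔼, dist (y + l • z) y = l * ‖z‖ := fun z => by
    rw [dist_eq_norm, add_sub_cancel_left, norm_smul, norm_of_nonneg hl.le]
  have key := hC (rescale r l y s u) (l ^ (1 / r) * K)
    (h.rescale hr hl
      (fun z hz => by
        rw [mem_ball_zero_iff] at hz
        rw [mem_ball, hd]; nlinarith)
      (fun τ hτ => ⟨by nlinarith [hτ.1], by nlinarith [hτ.2]⟩))
    (fun z hz τ hτ => by
      rw [sum_rescale]
      obtain ⟨h1, h2⟩ := abs_lt.1 hτ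
      gcongr
      refine hK (y + l • z, s + l ^ 2 * τ) ⟨?_, ?_, ?_⟩
      · rw [mem_closedBall]; simp only [hd]; nlinarith
      · simp only; nlinarith
      · simp only; nlinarith)
    (l⁻¹ • (x - y)) (by
      rw [norm_smul, norm_inv, norm_of_nonneg hl.le, ← dist_eq_norm, inv_mul_le_iff₀ hl]; linarith)
  rw [sum_rescale, sum_rescale, smul_smul, mul_inv_cancel₀ hl.ne', one_smul, add_sub_cancel, smul_zero,
    add_zero, mul_zero, add_zero, mul_one_div] at key
  rw [← mul_le_mul_iff_of_pos_left hla]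
  linarith

/-- Classical solutions which are only separately regular are locally bounded. -/
theorem Sol.eventually_le (hN : 1 ≤ N) (hm : 0 < m) {r : ℝ} (hr : 0 < r)
    {β : Fin m → Fin m → ℝ} (hsym : ∀ i j, β i j = β j i) (hβ : ∀ i j, 0 ≤ β i j)
    (hdiag : ∀ i, 0 < β i i)
    (hpB : N = 1 ∨ (2 ≤ N ∧ 2 * r + 1 < ((N : ℝ) * (N + 2)) / ((N : ℝ) - 1) ^ 2))
    {u : Fin m → 𝔼 → ℝ → ℝ} (h : Sol β r u 0 1 (Ioo (-1) 1)) {P : 𝔼 × ℝ}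
    (hP : P ∈ ball (0 : 𝔼) 1 ×ˢ Ioo (-1 : ℝ) 1) :
    ∃ M, ∀ᶠ q in 𝓝 P, ∑ i, u i q.1 q.2 ≤ M := by
  obtain ⟨C, hC0, hC⟩ := le_of_locally_bounded (N := N) hN hm hr hsym hβ hdiag hpB
  set Q : Set (𝔼 × ℝ) := ball 0 1 ×ˢ Ioo (-1) 1 with hQ
  have hQo : IsOpen Q := isOpen_ball.prod isOpen_Ioo
  set w : 𝔼 × ℝ → ℝ := fun q => ∑ i, u i q.1 q.2 with hw
  set G : Set (𝔼 × ℝ) := {q | ∃ M, ∀ᶠ q' in 𝓝 q, w q' ≤ M} with hG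
  have hGo : IsOpen G := isOpen_setOf_eventually_le w
  have hwx : ∀ x ∈ ball (0 : 𝔼) 1, ∀ t ∈ Ioo (-1 : ℝ) 1, ContinuousAt (fun y => w (y, t)) x :=
    fun x hx t ht => by
      simp only [hw]
      exact tendsto_finsetSum _ fun i _ =>
        (h.space i t ht).continuousOn.continuousAt (isOpen_ball.mem_nhds hx)
  have hwt : ∀ x ∈ ball (0 : 𝔼) 1, ∀ t ∈ Ioo (-1 : ℝ) 1, ContinuousAt (fun s => w (x, s)) t :=
    fun x hx t ht => by
      simp only [hw]
      exact tendsto_finsetSum _ fun i _ => (h.time i x hx t ht).continuousAt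
  by_contra hPG
  set A : ℕ → Set (𝔼 × ℝ) := fun n =>
    {q | ∀ s ∈ Ioo (-1 : ℝ) 1, |s - q.2| < 1 / ((n : ℝ) + 1) → w (q.1, s) ≤ n} with hA
  have hcov : Q ∩ Gᶜ ⊆ ⋃ n, A n := by
    rintro ⟨x, t⟩ ⟨⟨hx, ht⟩, -⟩
    have h1 : ∀ᶠ s in 𝓝 t, w (x, s) < w (x, t) + 1 := (hwt x hx t ht).eventually_lt_const (by simp)
    obtain ⟨δ, hδ, hδ'⟩ := Metric.eventually_nhds_iff.1 h1
    obtain ⟨n₁, hn₁⟩ := exists_nat_one_div_lt hδ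
    obtain ⟨n₂, hn₂⟩ := exists_nat_ge (w (x, t) + 1)
    refine mem_iUnion.2 ⟨max n₁ n₂, fun s hs hst => ?_⟩
    have e1 : (n₁ : ℝ) ≤ (max n₁ n₂ : ℕ) := by exact_mod_cast le_max_left _ _
    have e2 : (n₂ : ℝ) ≤ (max n₁ n₂ : ℕ) := by exact_mod_cast le_max_right _ _
    have e3 : 1 / (((max n₁ n₂ : ℕ) : ℝ) + 1) ≤ 1 / ((n₁ : ℝ) + 1) := by gcongr
    have := hδ' (y := s) (by rw [Real.dist_eq]; simp only at hst; linarith)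
    simp only
    linarith
  have hcl : ∀ n, ∀ q ∈ Q ∩ Gᶜ, q ∈ closure (A n ∩ (Q ∩ Gᶜ)) → q ∈ A n := by
    rintro n ⟨x, t⟩ ⟨⟨hx, ht⟩, -⟩ hcl s hs hst
    by_contra! hlt
    have h1 : ∀ᶠ y in 𝓝 x, (n : ℝ) < w (y, s) := (hwx x hx s hs).eventually_const_lt hlt
    have h2 : ∀ᶠ τ in 𝓝 t, |s - τ| < 1 / ((n : ℝ) + 1) :=
      (by fun_prop : ContinuousAt (fun τ => |s - τ|) t).eventually_lt_const hst
    obtain ⟨⟨y, τ⟩, ⟨hy, hτ⟩, hyA, -⟩ := mem_closure_iff_nhds.1 hcl _ (h1.prod_nhds h2)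
    exact absurd (hyA s hs hτ) (not_le.2 hy)
  obtain ⟨n, ⟨x₀, t₀⟩, hP₀, V, hV, hVA⟩ := exists_local_subset_of_baire (S := Q ∩ Gᶜ)
    (hQo.isLocallyClosed.inter hGo.isClosed_compl.isLocallyClosed) ⟨P, hP, hPG⟩ A hcov hcl
  refine hP₀.2 ?_
  obtain ⟨ε₀, hε₀, hball⟩ := Metric.mem_nhds_iff.1 (Filter.inter_mem hV (hQo.mem_nhds hP₀.1))
  set ε : ℝ := min ε₀ (min 1 (1 / ((n : ℝ) + 1))) with hε
  have hε0 : 0 < ε := by positivity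
  have hε1 : ε ≤ 1 := (min_le_right _ _).trans (min_le_left _ _)
  have hεn : ε ≤ 1 / ((n : ℝ) + 1) := (min_le_right _ _).trans (min_le_right _ _)
  have hbox : ∀ x t, dist x x₀ < ε → |t - t₀| < ε → (x, t) ∈ V ∩ Q := fun x t hx ht =>
    hball (by
      rw [mem_ball, Prod.dist_eq]
      exact (max_lt hx ht).trans_le (min_le_left _ _))
  set l₀ : ℝ := ε / 4 with hl₀
  have hl₀0 : 0 < l₀ := by positivity
  refine ⟨max n (C * n), ?_⟩
  have hnear : ∀ᶠ q : 𝔼 × ℝ in 𝓝 (x₀, t₀), dist q.1 x₀ < l₀ / 8 ∧ |q.2 - t₀| < l₀ ^ 2 / 64 :=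
    Filter.Eventually.prod_nhds (p := fun x => dist x x₀ < l₀ / 8) (q := fun t => |t - t₀| < l₀ ^ 2 / 64)
      (Metric.ball_mem_nhds x₀ (by positivity)) (Metric.ball_mem_nhds t₀ (by positivity))
  filter_upwards [hnear]
  rintro ⟨y, s⟩ ⟨hy, hs⟩
  simp only at hy hs
  have hl₀2 : l₀ ^ 2 ≤ l₀ / 4 := by nlinarith
  have hyQ := hbox y s (by linarith) (by linarith)
  by_cases hyG : (y, s) ∈ G
  swap
  · refine le_trans ?_ (le_max_left _ _)
    exact hVA ⟨⟨hyQ.2, hyG⟩, hyQ.1⟩ s hyQ.2.2 (by simp; positivity)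
  refine le_trans ?_ (le_max_right _ _)
  set good : ℕ → Prop := fun k => ∃ q ∈ Q ∩ Gᶜ, dist q.1 y ≤ l₀ / 2 ^ k / 8 ∧
    |q.2 - s| ≤ (l₀ / 2 ^ k) ^ 2 / 64 with hgood
  have hg0 : good 0 := ⟨(x₀, t₀), hP₀, by rw [dist_comm]; simpa using hy.le, by
    rw [abs_sub_comm]; simpa using hs.le⟩
  have hbad : ∃ k, ¬ good k := by
    obtain ⟨η, hη, hηG⟩ := Metric.mem_nhds_iff.1 (hGo.mem_nhds hyG)
    obtain ⟨k, hk⟩ := pow_unbounded_of_one_lt (l₀ / η) (by norm_num : (1 : ℝ) < 2)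
    refine ⟨k, ?_⟩
    rintro ⟨q, hq, hq1, hq2⟩
    refine hq.2 (hηG ?_)
    have h2k : (1 : ℝ) ≤ 2 ^ k := one_le_pow₀ (by norm_num)
    have h3 : l₀ / 2 ^ k < η := by
      rw [div_lt_iff₀ hη] at hk
      rw [div_lt_iff₀ (by positivity)]; linarith
    have h4 : l₀ / 2 ^ k ≤ l₀ := div_le_self hl₀0.le h2k
    have h5 : 0 < l₀ / 2 ^ k := by positivity
    rw [mem_ball, Prod.dist_eq]
    exact max_lt (by simp only; linarith) (by simp only [Real.dist_eq]; nlinarith)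
  classical
  obtain ⟨k, hk⟩ : ∃ k, Nat.find hbad = k + 1 :=
    Nat.exists_eq_succ_of_ne_zero fun h0 => Nat.find_spec hbad (h0 ▸ hg0)
  have hk1 : ¬ good (k + 1) := hk ▸ Nat.find_spec hbad
  have hk0 : good k := not_not.1 (Nat.find_min hbad (by omega))
  set l := l₀ / 2 ^ k with hl
  have hlk : l₀ / 2 ^ (k + 1) = l / 2 := by rw [pow_succ, ← div_div]
  have hl0 : 0 < l := by positivity
  have hll : l ≤ l₀ := div_le_self hl₀0.le (one_le_pow₀ (by norm_num))
  have hl2 : l ^ 2 ≤ l₀ / 4 := by nlinarith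
  have hl20 : 0 < l ^ 2 := by positivity
  have hyt := abs_lt.1 hs
  have hcyl : ∀ x t, dist x y < l → |t - s| < l ^ 2 → (x, t) ∈ V ∩ Q := fun x t hx ht => by
    have h1 := abs_lt.1 ht
    exact hbox x t (by linarith [dist_triangle x y x₀])
      (abs_lt.2 ⟨by linarith [h1.1, hyt.1], by linarith [h1.2, hyt.2]⟩)
  obtain ⟨⟨x, t⟩, hxS, hx, ht⟩ := hk0
  simp only [← hl] at hx ht
  have hxV := hcyl x t (by linarith) (by linarith)
  have hsol : Sol β r u y l (Ioo (s - l ^ 2) (s + l ^ 2)) := by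
    refine h.mono (fun z hz => ?_) (fun τ hτ => ?_)
    · exact (hcyl z s hz (by simpa using hl20)).2.1
    · exact (hcyl y τ (by simpa using hl0) (abs_lt.2 ⟨by linarith [hτ.1], by linarith [hτ.2]⟩)).2.2
  obtain ⟨M, hM⟩ := ((isCompact_closedBall y (l / 32)).prod
    (isCompact_Icc (a := s - l ^ 2 / 1024) (b := s + l ^ 2 / 1024))).exists_le_of_eventually_le
    (f := w) (fun q hq => by
      have h1 : dist q.1 y ≤ l / 32 := hq.1
      have h2 : |q.2 - s| ≤ l ^ 2 / 1024 := abs_le.2 ⟨by linarith [hq.2.1], by linarith [hq.2.2]⟩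
      by_contra hqG
      refine hk1 ⟨q, ⟨(hcyl q.1 q.2 (by linarith) (by linarith)).2, hqG⟩, ?_, ?_⟩
      · rw [hlk]; linarith
      · rw [hlk, div_pow]; linarith)
  have key := hC u M l y s hl0 hsol hM x hx
  have hxA := hVA ⟨hxS, hxV.1⟩
  have ht' := abs_le.1 ht
  have hwn : w (x, s + l ^ 2 / 2) ≤ n := hxA (s + l ^ 2 / 2)
    (hcyl y (s + l ^ 2 / 2) (by simpa using hl0) (by
      rw [abs_lt]; constructor <;> linarith)).2.2
    (by
      refine lt_of_lt_of_le ?_ hεn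
      simp only
      rw [abs_lt]; constructor <;> linarith [ht'.1, ht'.2])
  exact key.trans (mul_le_mul_of_nonneg_left hwn hC0)

end LocallyBounded

/-- Separately regular pointwise solutions, as in the main theorem, satisfy `Sol`. -/
lemma sol_of_pointwise {N m : ℕ} {r : ℝ} {β : Fin m → Fin m → ℝ}
    {u : Fin m → EuclideanSpace ℝ (Fin N) → ℝ → ℝ} {x₀ : EuclideanSpace ℝ (Fin N)} {ρ : ℝ} {I : Set ℝ}
    (hI : IsOpen I) (hpos : ∀ i, ∀ x ∈ ball x₀ ρ, ∀ t ∈ I, 0 < u i x t)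
    (hx : ∀ i, ∀ t ∈ I, ContDiffOn ℝ 2 (fun x => u i x t) (ball x₀ ρ))
    (ht : ∀ i, ∀ x ∈ ball x₀ ρ, ContDiffOn ℝ 1 (fun s => u i x s) I)
    (he : ∀ i, ∀ x ∈ ball x₀ ρ, ∀ t ∈ I, deriv (fun s => u i x s) t - lap (fun y => u i y t) x
      = ∑ j, β i j * u i x t ^ r * u j x t ^ (r + 1)) : Sol β r u x₀ ρ I where
  pos := hpos
  space := hx
  time i x hxb t htI := by
    have h1 : HasDerivAt (u i x) (deriv (fun s => u i x s) t) t :=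
      (((ht i x hxb).contDiffAt (hI.mem_nhds htI)).differentiableAt (by simp)).hasDerivAt
    have h2 : lap (fun y => u i y t) x + sysF β r (fun j => u j x t) i = deriv (fun s => u i x s) t := by
      have := he i x hxb t htI
      unfold sysF
      linarith
    rwa [h2]

/-- local integral bound (Lemma 4.2) for positive classical solutions of
(S) on `B_1 × (−1,1)`: the `L^2` norm of the nonlinearity on `B_{1/2} × (−1/2,1/2)`
is bounded by a constant depending only on `N`, `p` and `B`. -/
theorem local_integral_bound
    (N m : ℕ) (hN : 1 ≤ N) (hm : 2 ≤ m)
    (r : ℝ) (hr : 0 < r)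
    (β : Fin m → Fin m → ℝ)
    (hsym : ∀ i j, β i j = β j i)
    (hoff : ∀ i j, i ≠ j → 0 ≤ β i j)
    (hdiag : ∀ i, 0 < β i i)
    (hpB : N = 1 ∨ (2 ≤ N ∧ 2 * r + 1 < ((N : ℝ) * (N + 2)) / ((N : ℝ) - 1) ^ 2)) :
    ∃ C : ℝ, 0 < C ∧
      ∀ (u : Fin m → EuclideanSpace ℝ (Fin N) → ℝ → ℝ),
        (∀ i, ∀ x ∈ ball (0 : EuclideanSpace ℝ (Fin N)) 1, ∀ t ∈ Ioo (-1 : ℝ) 1,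
          0 < u i x t) →
        (∀ i, ∀ t ∈ Ioo (-1 : ℝ) 1, ContDiffOn ℝ 2 (fun x => u i x t)
          (ball (0 : EuclideanSpace ℝ (Fin N)) 1)) →
        (∀ i, ∀ x ∈ ball (0 : EuclideanSpace ℝ (Fin N)) 1,
          ContDiffOn ℝ 1 (fun s => u i x s) (Ioo (-1 : ℝ) 1)) →
        (∀ i, ∀ x ∈ ball (0 : EuclideanSpace ℝ (Fin N)) 1, ∀ t ∈ Ioo (-1 : ℝ) 1,
          deriv (fun s => u i x s) t - lap (fun y => u i y t) x
            = ∑ j, β i j * u i x t ^ r * u j x t ^ (r + 1)) →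
        (∫ t in Ioo (-(1 : ℝ) / 2) (1 / 2),
            ∫ x in ball (0 : EuclideanSpace ℝ (Fin N)) (1 / 2),
              ∑ i, (∑ j, β i j * u i x t ^ r * u j x t ^ (r + 1)) ^ 2) ≤ C := by
  have hm0 : 0 < m := by omega
  have hβ : ∀ i j, 0 ≤ β i j := fun i j => by
    rcases eq_or_ne i j with rfl | hij
    · exact (hdiag i).le
    · exact hoff i j hij
  obtain ⟨C, hC0, hC⟩ := local_bound_of_bounded (N := N) hN hm0 hr hsym hβ hdiag hpB
  refine ⟨C + 1, by linarith, fun u hpos hx ht he => ?_⟩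
  have h : Sol β r u 0 1 (Ioo (-1) 1) := sol_of_pointwise isOpen_Ioo hpos hx ht he
  obtain ⟨K, hK⟩ := ((isCompact_closedBall (0 : EuclideanSpace ℝ (Fin N)) (7 / 8)).prod
    (isCompact_Icc (a := (-(7 / 8) : ℝ)) (b := 7 / 8))).exists_le_of_eventually_le
    (f := fun q => ∑ i, u i q.1 q.2) (fun q hq => h.eventually_le hN hm0 hr hsym hβ hdiag hpB
      ⟨closedBall_subset_ball (by norm_num) hq.1, by linarith [hq.2.1], by linarith [hq.2.2]⟩)
  have key := hC u K h fun i x hx t ht => by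
    refine le_trans ?_ (hK (x, t) ⟨hx, ht⟩)
    exact Finset.single_le_sum (f := fun i => u i x t) (fun j _ => (h.pos j x
      (closedBall_subset_ball (by norm_num) hx) t ⟨by linarith [ht.1], by linarith [ht.2]⟩).le)
      (Finset.mem_univ i)
  unfold sysF at key
  linarith
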